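/- arXiv:0804.2910 — 2 statements merged into one kernel-verified Lean document; each statement's English description precedes it below -/
import Mathlib

section
/- Let d ≥ 3, k ≥ 1, and let T ⊂ ℝ^d be a clean lattice d-simplex whose interior contains exactly k lattice points and whose volume is Vol(T) = (dk + 1)/d!. Then there exist a vertex v of T and a line L ⊂ ℝ^d through v such that every lattice point in the interior of T lies on L. -/
open MeasureTheory Set
open scoped ENNReal

noncomputable section

/-- A point of `ℝ^d` is a lattice point if all its coordinates are integers. -/
def IsLatticePt (d : ℕ) (x : Fin d → ℝ) : Prop := ∀ i, ∃ z : ℤ, x i = (z : ℝ)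

/-- A lattice `d`-simplex: the convex hull of `d+1` affinely independent points of `ℤ^d`. -/
def IsLatticeSimplex (d : ℕ) (T : Set (Fin d → ℝ)) : Prop :=
  ∃ v : Fin (d + 1) → Fin d → ℤ,
    AffineIndependent ℝ (fun i => fun j => ((v i j : ℤ) : ℝ)) ∧
    T = convexHull ℝ (Set.range (fun i => fun j => ((v i j : ℤ) : ℝ)))

/-- A lattice `d`-polytope: convex hull of a finite set of lattice points affinely
spanning `ℝ^d`. -/
def IsLatticePolytope (d : ℕ) (P : Set (Fin d → ℝ)) : Prop :=
  ∃ F : Finset (Fin d → ℤ),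
    affineSpan ℝ ((fun v : Fin d → ℤ => fun j : Fin d => (v j : ℝ)) '' ↑F) = ⊤ ∧
    P = convexHull ℝ ((fun v : Fin d → ℤ => fun j : Fin d => (v j : ℝ)) '' ↑F)

/-- Clean: the only lattice points on the boundary are the vertices (extreme points). -/
def IsClean (d : ℕ) (P : Set (Fin d → ℝ)) : Prop :=
  frontier P ∩ {x | IsLatticePt d x} = Set.extremePoints ℝ P

/-- Unimodular equivalence of subsets of `ℝ^d`. -/
def UnimodEquiv (d : ℕ) (P Q : Set (Fin d → ℝ)) : Prop :=
  ∃ (M : Matrix (Fin d) (Fin d) ℤ) (u : Fin d → ℤ),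
    (M.det = 1 ∨ M.det = -1) ∧
    (fun x => (M.map (fun z : ℤ => (z : ℝ))).mulVec x + (fun i => (u i : ℝ))) '' P = Q

/-- `S_d(k) = conv(e_1, …, e_d, -k(e_1 + ⋯ + e_d))`. -/
def Sdk (d k : ℕ) : Set (Fin d → ℝ) :=
  convexHull ℝ
    ((Set.range fun i : Fin d => (Pi.single i 1 : Fin d → ℝ)) ∪ {fun _ => -(k : ℝ)})

/-- `T_{a_1,…,a_d}`: vertex set `{0, e_1, …, e_{d-1}, (a_1,…,a_d)}`. -/
def Ta (d : ℕ) (a : Fin d → ℤ) : Set (Fin d → ℝ) :=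
  convexHull ℝ
    ({(0 : Fin d → ℝ)} ∪
      {x | ∃ i : Fin d, i.val < d - 1 ∧ x = (Pi.single i 1 : Fin d → ℝ)} ∪
      {fun i => (a i : ℝ)})

section

set_option linter.unusedSectionVars false

open scoped Pointwise in
theorem scherk_aux {G : Type*} [AddCommGroup G] [DecidableEq G] (n : ℕ) :
    ∀ A B : Finset G, B.card = n → (0 : G) ∈ A → (0 : G) ∈ B →
      (∀ a ∈ A, ∀ b ∈ B, a + b = 0 → b = 0) → A.card + B.card ≤ (A + B).card + 1 := by
  induction n using Nat.strong_induction_on with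
  | _ n ih =>
    intro A B hn hA hB h0
    by_cases hB1 : ∃ b ∈ B, b ≠ 0
    · obtain ⟨b, hb, hb0⟩ := hB1
      have hex : ∃ a ∈ A, a + b ∉ A := by
        by_contra hcon
        push Not at hcon
        have hmap : A.image (fun a => a + b) = A := by
          apply Finset.eq_of_subset_of_card_le
          · intro x hx
            obtain ⟨a, ha, rfl⟩ := Finset.mem_image.1 hx
            exact hcon a ha
          · rw [Finset.card_image_of_injective _ (add_left_injective b)]
        have h0' : (0 : G) ∈ A.image (fun a => a + b) := by rw [hmap]; exact hA
        obtain ⟨a, ha, hab⟩ := Finset.mem_image.1 h0'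
        exact hb0 (h0 a ha b hb hab)
      obtain ⟨a0, ha0, hab⟩ := hex
      set B0 := B.filter (fun b => a0 + b ∉ A) with hB0
      set B' := B.filter (fun b => a0 + b ∈ A) with hB'
      set A' := A ∪ B0.image (fun b => a0 + b) with hA'
      have hcB : B'.card + B0.card = B.card := by
        rw [hB0, hB']; exact Finset.card_filter_add_card_filter_not _
      have hcA : A'.card = A.card + B0.card := by
        rw [hA', Finset.card_union_of_disjoint, Finset.card_image_of_injective _ (add_right_injective a0)]
        rw [Finset.disjoint_left]
        intro x hx hx'
        obtain ⟨b, hb, rfl⟩ := Finset.mem_image.1 hx'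
        exact (Finset.mem_filter.1 hb).2 hx
      have hpos : 0 < B0.card := Finset.card_pos.2 ⟨b, Finset.mem_filter.2 ⟨hb, hab⟩⟩
      have hsub : A' + B' ⊆ A + B := by
        intro x hx
        obtain ⟨a, ha, c, hc, rfl⟩ := Finset.mem_add.1 hx
        obtain ⟨hc1, hc2⟩ := Finset.mem_filter.1 hc
        rcases Finset.mem_union.1 ha with ha | ha
        · exact Finset.add_mem_add ha hc1
        · obtain ⟨e, he, rfl⟩ := Finset.mem_image.1 ha
          have : a0 + e + c = (a0 + c) + e := by abel
          rw [this]
          exact Finset.add_mem_add hc2 (Finset.mem_filter.1 he).1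
      have := ih B'.card (by omega) A' B' rfl (Finset.mem_union_left _ hA)
        (Finset.mem_filter.2 ⟨hB, by simpa using ha0⟩) (by
          intro a ha c hc hac
          obtain ⟨hc1, hc2⟩ := Finset.mem_filter.1 hc
          rcases Finset.mem_union.1 ha with ha | ha
          · exact h0 a ha c hc1 hac
          · obtain ⟨e, he, rfl⟩ := Finset.mem_image.1 ha
            obtain ⟨he1, he2⟩ := Finset.mem_filter.1 he
            have h1 : (a0 + c) + e = 0 := by rw [← hac]; abel
            have := h0 _ hc2 e he1 h1
            subst this
            exact absurd (by simpa using ha0) he2)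
      have := Finset.card_le_card hsub
      omega
    · push Not at hB1
      have : B = {0} := by
        ext x; simp only [Finset.mem_singleton]
        exact ⟨hB1 x, fun h => h ▸ hB⟩
      subst this
      simp

variable {ι : Type*} [Fintype ι] [DecidableEq ι]

def fr (p : ι → ℝ) : ι → ℝ := fun i => Int.fract (p i)

def intVec (ι : Type*) : AddSubgroup (ι → ℝ) where
  carrier := {p | ∀ i, ∃ z : ℤ, p i = z}
  zero_mem' := fun i => ⟨0, by simp⟩
  add_mem' := by
    intro a b ha hb i
    obtain ⟨x, hx⟩ := ha i
    obtain ⟨y, hy⟩ := hb i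
    exact ⟨x + y, by simp [hx, hy]⟩
  neg_mem' := by
    intro a ha i
    obtain ⟨x, hx⟩ := ha i
    exact ⟨-x, by simp [hx]⟩

theorem mem_intVec {p : ι → ℝ} : p ∈ intVec ι ↔ ∀ i, ∃ z : ℤ, p i = z := Iff.rfl

theorem fr_eq_fr {p q : ι → ℝ} : fr p = fr q ↔ p - q ∈ intVec ι := by
  rw [mem_intVec, funext_iff]
  exact forall_congr' fun i => Int.fract_eq_fract

theorem fr_eq_self {p : ι → ℝ} (h : ∀ i, 0 ≤ p i ∧ p i < 1) : fr p = p :=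
  funext fun i => Int.fract_eq_self.2 (h i)

theorem sub_fr (p : ι → ℝ) : p - fr p ∈ intVec ι := fun i => ⟨⌊p i⌋, by simp [fr]⟩

open scoped Pointwise in
theorem scherk_box (X Y : Finset (ι → ℝ)) (hX : ∀ p ∈ X, fr p = p) (hY : ∀ p ∈ Y, fr p = p)
    (h0X : 0 ∈ X) (h0Y : 0 ∈ Y) (h : ∀ x ∈ X, ∀ y ∈ Y, fr (x + y) = 0 → y = 0) :
    X.card + Y.card ≤ (Finset.image₂ (fun x y => fr (x + y)) X Y).card + 1 := by
  classical
  let π : (ι → ℝ) → (ι → ℝ) ⧸ intVec ι := fun p => (p : (ι → ℝ) ⧸ intVec ι)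
  have hπ : ∀ p q, π p = π q ↔ fr p = fr q := by
    intro p q
    rw [fr_eq_fr, eq_comm]
    show ((q : (ι → ℝ) ⧸ intVec ι) = p) ↔ _
    rw [QuotientAddGroup.eq, neg_add_eq_sub]
  have hfr : ∀ p : ι → ℝ, fr (fr p) = fr p := fun p => fr_eq_self fun i => ⟨Int.fract_nonneg _, Int.fract_lt_one _⟩
  have h1 := scherk_aux _ (X.image π) (Y.image π) rfl
    (Finset.mem_image.2 ⟨0, h0X, rfl⟩) (Finset.mem_image.2 ⟨0, h0Y, rfl⟩) (by
      intro a ha b hb hab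
      obtain ⟨x, hx, rfl⟩ := Finset.mem_image.1 ha
      obtain ⟨y, hy, rfl⟩ := Finset.mem_image.1 hb
      have : π (x + y) = π 0 := hab
      rw [hπ] at this
      rw [h x hx y hy (by rw [this]; funext i; simp [fr])]
      rfl)
  rw [Finset.card_image_of_injOn, Finset.card_image_of_injOn] at h1
  · refine h1.trans (Nat.add_le_add_right ?_ 1)
    have : X.image π + Y.image π = (Finset.image₂ (fun x y => fr (x + y)) X Y).image π := by
      ext z
      simp only [Finset.mem_add, Finset.mem_image, Finset.mem_image₂]
      constructor
      · rintro ⟨_, ⟨x, hx, rfl⟩, _, ⟨y, hy, rfl⟩, rfl⟩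
        exact ⟨_, ⟨x, hx, y, hy, rfl⟩, ((hπ _ (x + y)).2 (hfr _))⟩
      · rintro ⟨_, ⟨x, hx, y, hy, rfl⟩, rfl⟩
        exact ⟨_, ⟨x, hx, rfl⟩, _, ⟨y, hy, rfl⟩, ((hπ (x + y) _).2 (hfr _).symm)⟩
    rw [this]
    exact Finset.card_image_le
  · intro x hx y hy hxy
    have := (hπ _ _).1 hxy
    rwa [hY x hx, hY y hy] at this
  · intro x hx y hy hxy
    have := (hπ _ _).1 hxy
    rwa [hX x hx, hX y hy] at this


structure BLat (L : AddSubgroup (ι → ℝ)) (Bx : Finset (ι → ℝ)) : Prop where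
  single : ∀ i, Pi.single i (1 : ℝ) ∈ L
  sum : ∀ p ∈ L, ∃ z : ℤ, ∑ i, p i = z
  mem : ∀ p, p ∈ Bx ↔ p ∈ L ∧ ∀ i, 0 ≤ p i ∧ p i < 1

theorem BLat.int_mem {L : AddSubgroup (ι → ℝ)} {Bx : Finset (ι → ℝ)} (h : BLat L Bx) {p : ι → ℝ}
    (hp : p ∈ intVec ι) : p ∈ L := by
  choose z hz using hp
  have : p = ∑ i, z i • (Pi.single i (1 : ℝ) : ι → ℝ) := by
    funext j
    simp [Finset.sum_apply, Pi.single_apply, hz]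
  rw [this]
  exact L.sum_mem fun i _ => L.zsmul_mem (h.single i) _

theorem BLat.fr_mem {L : AddSubgroup (ι → ℝ)} {Bx : Finset (ι → ℝ)} (h : BLat L Bx) {p : ι → ℝ}
    (hp : p ∈ L) : fr p ∈ Bx := by
  rw [h.mem]
  refine ⟨?_, fun i => ⟨Int.fract_nonneg _, Int.fract_lt_one _⟩⟩
  have : fr p = p - (p - fr p) := by abel
  rw [this]
  exact L.sub_mem hp (h.int_mem (sub_fr p))

theorem BLat.zero_mem {L : AddSubgroup (ι → ℝ)} {Bx : Finset (ι → ℝ)} (h : BLat L Bx) :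
    (0 : ι → ℝ) ∈ Bx := by
  rw [h.mem]; exact ⟨L.zero_mem, fun i => by simp⟩

theorem fract_add_le {x y : ℝ} (hx : 0 ≤ x) (hy : 0 ≤ y) : Int.fract (x + y) ≤ x + y := by
  have : 0 ≤ ⌊x + y⌋ := Int.floor_nonneg.2 (by positivity)
  have h2 : (0:ℝ) ≤ ⌊x + y⌋ := by exact_mod_cast this
  unfold Int.fract; linarith

theorem fract_add_cases {x y : ℝ} (hx : 0 ≤ x ∧ x < 1) (hy : 0 ≤ y ∧ y < 1) :
    (x + y < 1 ∧ Int.fract (x + y) = x + y) ∨ (1 ≤ x + y ∧ Int.fract (x + y) = x + y - 1) := by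
  rcases lt_or_ge (x + y) 1 with h | h
  · left; exact ⟨h, Int.fract_eq_self.2 ⟨by linarith, h⟩⟩
  · right; refine ⟨h, ?_⟩
    rw [Int.fract_eq_iff]
    exact ⟨by linarith, by linarith, 1, by push_cast; ring⟩

def supp (p : ι → ℝ) : Finset ι := Finset.univ.filter (fun i => p i ≠ 0)

theorem ht_zero_sum {x y : ι → ℝ} (hx : ∀ i, 0 ≤ x i ∧ x i < 1) (hy : ∀ i, 0 ≤ y i ∧ y i < 1)
    (h : fr (x + y) = 0) : ∑ i, x i + ∑ i, y i = ((supp y).card : ℝ) := by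
  rw [← Finset.sum_add_distrib, supp, Finset.card_filter]
  push_cast
  refine Finset.sum_congr rfl fun i _ => ?_
  have h1 : Int.fract (x i + y i) = 0 := congrFun h i
  have hx := hx i; have hy := hy i
  rcases fract_add_cases hx hy with h2 | h2
  · have : y i = 0 := by linarith
    rw [if_neg (by simp [this])]; linarith
  · have : y i ≠ 0 := by intro h; linarith
    rw [if_pos this]; linarith

theorem ht_zero_of {x : ι → ℝ} (hx : ∀ i, 0 ≤ x i) (h : ∑ i, x i ≤ 0) : x = 0 := by
  have := (Finset.sum_eq_zero_iff_of_nonneg (fun i _ => hx i)).1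
    (le_antisymm h (Finset.sum_nonneg fun i _ => hx i))
  funext i; exact this i (Finset.mem_univ i)

def lev (Bx : Finset (ι → ℝ)) (j : ℕ) : Finset (ι → ℝ) := Bx.filter (fun p => ∑ i, p i ≤ j)

theorem BLat.ht_fr_le {L : AddSubgroup (ι → ℝ)} {Bx : Finset (ι → ℝ)} (h : BLat L Bx) {x y : ι → ℝ}
    (hx : x ∈ Bx) (hy : y ∈ Bx) : ∑ i, fr (x + y) i ≤ ∑ i, x i + ∑ i, y i := by
  rw [← Finset.sum_add_distrib]
  exact Finset.sum_le_sum fun i _ => fract_add_le (((h.mem x).1 hx).2 i).1 (((h.mem y).1 hy).2 i).1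

theorem BLat.add_mem {L : AddSubgroup (ι → ℝ)} {Bx : Finset (ι → ℝ)} (h : BLat L Bx) {x y : ι → ℝ}
    (hx : x ∈ Bx) (hy : y ∈ Bx) : fr (x + y) ∈ Bx :=
  h.fr_mem (L.add_mem ((h.mem x).1 hx).1 ((h.mem y).1 hy).1)

theorem BLat.fr_self {L : AddSubgroup (ι → ℝ)} {Bx : Finset (ι → ℝ)} (h : BLat L Bx) {x : ι → ℝ}
    (hx : x ∈ Bx) : fr x = x := fr_eq_self ((h.mem x).1 hx).2

theorem BLat.step {L : AddSubgroup (ι → ℝ)} {Bx : Finset (ι → ℝ)} (h : BLat L Bx) (j : ℕ) :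
    (lev Bx j).card + (Bx.filter (fun p => ∑ i, p i = 1 ∧ j + 2 ≤ (supp p).card)).card
      ≤ (lev Bx (j + 1)).card := by
  classical
  set F := Bx.filter (fun p => ∑ i, p i = 1 ∧ j + 2 ≤ (supp p).card) with hF
  have h0F : (0 : ι → ℝ) ∉ F := by simp [hF]
  have h0l : (0 : ι → ℝ) ∈ lev Bx j := Finset.mem_filter.2 ⟨h.zero_mem, by simp⟩
  have key := scherk_box (lev Bx j) (insert 0 F) (fun p hp => h.fr_self (Finset.mem_filter.1 hp).1)
    (by
      intro p hp
      rcases Finset.mem_insert.1 hp with rfl | hp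
      · exact h.fr_self h.zero_mem
      · exact h.fr_self (Finset.mem_filter.1 hp).1) h0l (Finset.mem_insert_self _ _) (by
      intro x hx y hy hxy
      rcases Finset.mem_insert.1 hy with rfl | hy
      · rfl
      exfalso
      obtain ⟨hx1, hx2⟩ := Finset.mem_filter.1 hx
      obtain ⟨hy1, hy2, hy3⟩ := Finset.mem_filter.1 hy
      have := ht_zero_sum ((h.mem x).1 hx1).2 ((h.mem y).1 hy1).2 hxy
      have h4 : ((j + 2 : ℕ) : ℝ) ≤ (supp y).card := by exact_mod_cast hy3
      push_cast at h4
      linarith)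
  rw [Finset.card_insert_of_notMem h0F] at key
  have : (Finset.image₂ (fun x y => fr (x + y)) (lev Bx j) (insert 0 F)).card ≤ (lev Bx (j+1)).card := by
    apply Finset.card_le_card
    intro z hz
    obtain ⟨x, hx, y, hy, rfl⟩ := Finset.mem_image₂.1 hz
    obtain ⟨hx1, hx2⟩ := Finset.mem_filter.1 hx
    have hy' : y ∈ Bx ∧ ∑ i, y i ≤ 1 := by
      rcases Finset.mem_insert.1 hy with rfl | hy
      · exact ⟨h.zero_mem, by simp⟩
      · obtain ⟨hy1, hy2, hy3⟩ := Finset.mem_filter.1 hy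
        exact ⟨hy1, hy2.le⟩
    refine Finset.mem_filter.2 ⟨h.add_mem hx1 hy'.1, ?_⟩
    have := h.ht_fr_le hx1 hy'.1
    push_cast
    linarith [hy'.2]
  omega

theorem BLat.lev_bound {L : AddSubgroup (ι → ℝ)} {Bx : Finset (ι → ℝ)} (h : BLat L Bx) (j : ℕ) :
    1 + ∑ m ∈ Finset.range j, (Bx.filter (fun p => ∑ i, p i = 1 ∧ m + 2 ≤ (supp p).card)).card
      ≤ (lev Bx j).card := by
  induction j with
  | zero =>
    simp only [Finset.range_zero, Finset.sum_empty, add_zero]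
    exact Finset.card_pos.2 ⟨0, Finset.mem_filter.2 ⟨h.zero_mem, by simp⟩⟩
  | succ j ih =>
    rw [Finset.sum_range_succ]
    have := h.step j
    omega

theorem BLat.mass {L : AddSubgroup (ι → ℝ)} {Bx : Finset (ι → ℝ)} (h : BLat L Bx) :
    1 + ∑ p ∈ Bx.filter (fun p => ∑ i, p i = 1), ((supp p).card - 1) ≤ Bx.card := by
  have h1 := h.lev_bound (Fintype.card ι)
  have h2 : (lev Bx (Fintype.card ι)).card ≤ Bx.card := Finset.card_filter_le _ _
  refine le_trans (le_trans (le_of_eq ?_) h1) h2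
  congr 1
  have : ∀ m, (Bx.filter (fun p => ∑ i, p i = 1 ∧ m + 2 ≤ (supp p).card)).card =
      ∑ p ∈ Bx.filter (fun p => ∑ i, p i = 1), if m + 2 ≤ (supp p).card then 1 else 0 := by
    intro m
    rw [← Finset.filter_filter, Finset.card_filter]
  simp_rw [this]
  rw [Finset.sum_comm]
  refine Finset.sum_congr rfl fun p _ => ?_
  rw [← Finset.card_filter]
  have hle : (supp p).card ≤ Fintype.card ι := Finset.card_le_univ _
  have : (Finset.range (Fintype.card ι)).filter (fun m => m + 2 ≤ (supp p).card) =
      Finset.range ((supp p).card - 1) := by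
    ext m; simp only [Finset.mem_filter, Finset.mem_range]; omega
  rw [this, Finset.card_range]

/-- counting lemma -/
theorem BLat.count {L : AddSubgroup (ι → ℝ)} {Bx : Finset (ι → ℝ)} (h : BLat L Bx) {w : ι → ℝ}
    (hw : w ∈ Bx) (i : ι) : ((Bx.filter (fun t => t i < w i)).card : ℝ) = Bx.card * w i := by
  have hwi := ((h.mem w).1 hw).2 i
  have hinj : Set.InjOn (fun t => fr (t + w)) (Bx : Set (ι → ℝ)) := by
    intro a ha b hb hab
    have := fr_eq_fr.1 hab
    rw [add_sub_add_right_eq_sub] at this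
    rw [← h.fr_self ha, ← h.fr_self hb]
    exact fr_eq_fr.2 this
  have himg : Bx.image (fun t => fr (t + w)) = Bx := by
    apply Finset.eq_of_subset_of_card_le
    · intro x hx
      obtain ⟨t, ht, rfl⟩ := Finset.mem_image.1 hx
      exact h.add_mem ht hw
    · rw [Finset.card_image_of_injOn hinj]
  have hs : ∀ f : (ι → ℝ) → ℝ, ∑ t ∈ Bx, f (fr (t + w)) = ∑ t ∈ Bx, f t := by
    intro f
    conv_rhs => rw [← himg]
    rw [Finset.sum_image hinj]
  have h1 := hs (fun t => t i)
  have h2 := hs (fun t => if t i < w i then 1 else 0)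
  rw [Finset.card_filter]
  push_cast
  rw [← h2]
  have h3 : ∀ t ∈ Bx, (if fr (t + w) i < w i then (1:ℝ) else 0) = t i + w i - fr (t + w) i := by
    intro t ht
    have hti := ((h.mem t).1 ht).2 i
    show (if Int.fract (t i + w i) < w i then (1:ℝ) else 0) = t i + w i - Int.fract (t i + w i)
    rcases fract_add_cases hti hwi with ⟨h4, h5⟩ | ⟨h4, h5⟩
    · rw [h5, if_neg (by linarith)]; ring
    · rw [h5, if_pos (by linarith)]; ring
  rw [Finset.sum_congr rfl h3, Finset.sum_sub_distrib, Finset.sum_add_distrib, h1]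
  simp


structure Cfg (d k : ℕ) (L : AddSubgroup (ι → ℝ)) (Bx S : Finset (ι → ℝ)) : Prop where
  lat : BLat L Bx
  hι : Fintype.card ι = d + 1
  hd : 3 ≤ d
  hN : Bx.card = d * k + 1
  hS : ∀ p, p ∈ S ↔ p ∈ L ∧ (∀ i, 0 < p i) ∧ ∑ i, p i = 1
  hclean : ∀ p ∈ Bx, ∑ i, p i = 1 → ∀ i, p i ≠ 0
  hk : S.card = k

def psi (w : ι → ℝ) (i : ι) : (ι → ℝ) →+ (ι → ℝ) where
  toFun c := fun j => (if j = i then 0 else c j) + c i * w j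
  map_zero' := by funext j; simp
  map_add' := by
    intro a b; funext j
    simp only [Pi.add_apply]
    split_ifs <;> ring

theorem psi_apply (w : ι → ℝ) (i : ι) (c : ι → ℝ) (j : ι) :
    psi w i c j = (if j = i then 0 else c j) + c i * w j := rfl

theorem psi_sum (w : ι → ℝ) (i : ι) (hw : ∑ j, w j = 1) (c : ι → ℝ) :
    ∑ j, psi w i c j = ∑ j, c j := by
  simp only [psi_apply]
  rw [Finset.sum_add_distrib, ← Finset.mul_sum, hw, mul_one]
  have : ∀ j, (if j = i then 0 else c j) = c j - (if j = i then c i else 0) := by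
    intro j; split_ifs with h
    · subst h; ring
    · ring
  simp_rw [this]
  rw [Finset.sum_sub_distrib]
  simp

def amin (y w : ι → ℝ) : Finset ι := Finset.univ.filter (fun i => ∀ j, y i * w j ≤ y j * w i)

theorem mem_amin {y w : ι → ℝ} {i : ι} : i ∈ amin y w ↔ ∀ j, y i * w j ≤ y j * w i := by
  simp [amin]

variable {d k : ℕ} {L : AddSubgroup (ι → ℝ)} {Bx S : Finset (ι → ℝ)}

theorem Cfg.exists_ne (C : Cfg d k L Bx S) (i : ι) : ∃ j, j ≠ i := by
  have : Nontrivial ι := by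
    rw [← Fintype.one_lt_card_iff_nontrivial, C.hι]; have := C.hd; omega
  exact _root_.exists_ne i

theorem Cfg.lt_one (C : Cfg d k L Bx S) {p : ι → ℝ} (h0 : ∀ i, 0 < p i) (h1 : ∑ i, p i = 1) (i : ι) :
    p i < 1 := by
  obtain ⟨j, hj⟩ := C.exists_ne i
  have : p i + p j ≤ ∑ i, p i := by
    rw [← Finset.sum_pair hj.symm]
    exact Finset.sum_le_sum_of_subset_of_nonneg (Finset.subset_univ _) fun i _ _ => (h0 i).le
  have := h0 j
  linarith

theorem Cfg.S_sub (C : Cfg d k L Bx S) {p : ι → ℝ} (hp : p ∈ S) : p ∈ Bx := by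
  obtain ⟨h1, h2, h3⟩ := (C.hS p).1 hp
  exact (C.lat.mem p).2 ⟨h1, fun i => ⟨(h2 i).le, C.lt_one h2 h3 i⟩⟩

theorem eq_of_ratio {y w : ι → ℝ} (hw0 : ∀ i, 0 < w i) (hw : ∑ i, w i = 1) (hy : ∑ i, y i = 1)
    {i : ι} (hi : i ∈ amin y w) (h : w i ≤ y i) : y = w := by
  have h1 : ∀ j, w j ≤ y j := by
    intro j
    have h2 := mem_amin.1 hi j
    have : w i * w j ≤ y j * w i := le_trans (mul_le_mul_of_nonneg_right h (hw0 j).le) h2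
    have h3 := hw0 i
    nlinarith
  have h2 := (Finset.sum_eq_sum_iff_of_le (fun j (_ : j ∈ Finset.univ) => h1 j)).1 (by rw [hw, hy])
  funext j; exact (h2 j (Finset.mem_univ j)).symm

theorem Cfg.sub_bound (C : Cfg d k L Bx S) {w : ι → ℝ} (hw : w ∈ S) (i : ι) :
    ((1 + ∑ y ∈ (S.erase w).filter (fun y => i ∈ amin y w), (d + 1 - (amin y w).card) : ℕ) : ℝ)
      ≤ Bx.card * w i := by
  classical
  obtain ⟨hwL, hw0, hw1⟩ := (C.hS w).1 hw
  have hwB := C.S_sub hw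
  have hwi := hw0 i
  set B' : Set (ι → ℝ) := {c | psi w i c ∈ L ∧ ∀ j, 0 ≤ c j ∧ c j < 1} with hB'
  have hmaps : ∀ c ∈ B', fr (psi w i c) ∈ Bx.filter (fun t => t i < w i) := by
    intro c hc
    refine Finset.mem_filter.2 ⟨C.lat.fr_mem hc.1, ?_⟩
    show Int.fract (psi w i c i) < w i
    have h1 : psi w i c i = c i * w i := by simp [psi_apply]
    have h2 := hc.2 i
    have h3 : c i * w i < w i := by nlinarith
    have h4 := C.lt_one hw0 hw1 i
    rw [h1, Int.fract_eq_self.2 ⟨mul_nonneg h2.1 hwi.le, by linarith⟩]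
    exact h3
  have hinj : Set.InjOn (fun c => fr (psi w i c)) B' := by
    intro a ha b hb hab
    have h4 := C.lt_one hw0 hw1 i
    have hai := ha.2 i
    have hbi := hb.2 i
    have hii : a i = b i := by
      have := congrFun hab i
      simp only [fr, psi_apply, if_true, zero_add] at this
      rw [Int.fract_eq_self.2 ⟨mul_nonneg hai.1 hwi.le, by nlinarith⟩,
        Int.fract_eq_self.2 ⟨mul_nonneg hbi.1 hwi.le, by nlinarith⟩] at this
      exact mul_right_cancel₀ hwi.ne' this
    funext j
    by_cases hj : j = i
    · rw [hj]; exact hii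
    · have := congrFun hab j
      simp only [fr, psi_apply, if_neg hj, hii] at this
      rw [Int.fract_eq_fract] at this
      obtain ⟨z, hz⟩ := this
      have h5 : Int.fract (a j) = Int.fract (b j) := Int.fract_eq_fract.2 ⟨z, by linarith⟩
      rwa [Int.fract_eq_self.2 (ha.2 j), Int.fract_eq_self.2 (hb.2 j)] at h5
  have hfin : B'.Finite := Set.Finite.of_injOn (t := ((Bx.filter (fun t => t i < w i) : Finset _) : Set (ι → ℝ)))
    (fun c hc => hmaps c hc) hinj (Finset.finite_toSet _)
  have hlat : BLat (L.comap (psi w i)) hfin.toFinset := by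
    refine ⟨?_, ?_, ?_⟩
    · intro j
      show psi w i _ ∈ L
      by_cases hj : j = i
      · subst hj
        convert hwL using 1
        funext l
        rw [psi_apply]
        split_ifs with h <;> simp [h]
      · convert C.lat.single j using 1
        funext l
        rw [psi_apply]
        rw [Pi.single_eq_of_ne (Ne.symm hj)]
        split_ifs with h
        · rw [h, Pi.single_eq_of_ne (Ne.symm hj)]; ring
        · ring
    · intro p hp
      obtain ⟨z, hz⟩ := C.lat.sum _ hp
      exact ⟨z, by rw [← hz, psi_sum w i hw1]⟩
    · intro p
      rw [Set.Finite.mem_toFinset]; rfl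
  have hcard : hfin.toFinset.card ≤ (Bx.filter (fun t => t i < w i)).card := by
    apply Finset.card_le_card_of_injOn (fun c => fr (psi w i c))
    · intro c hc
      exact hmaps c (by simpa using hc)
    · simpa using hinj
  have hmass := hlat.mass
  rw [← C.lat.count hwB i]
  norm_cast
  refine le_trans (le_trans (Nat.add_le_add_left ?_ 1) hmass) hcard
  let cy : (ι → ℝ) → (ι → ℝ) := fun y j => if j = i then y i / w i else y j - y i / w i * w j
  have hpsi : ∀ y, psi w i (cy y) = y := by
    intro y; funext j
    rw [psi_apply]
    by_cases hj : j = i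
    · subst hj; simp only [cy, if_true]; field_simp; ring
    · simp only [cy, if_neg hj, if_true]; ring
  have hcyinj : Function.Injective cy := Function.LeftInverse.injective hpsi
  have hsub : ((S.erase w).filter (fun y => i ∈ amin y w)).image cy ⊆
      hfin.toFinset.filter (fun p => ∑ i, p i = 1) := by
    intro c hc
    obtain ⟨y, hy, rfl⟩ := Finset.mem_image.1 hc
    obtain ⟨hy1, hy2⟩ := Finset.mem_filter.1 hy
    obtain ⟨hyw, hyS⟩ := Finset.mem_erase.1 hy1
    obtain ⟨hyL, hy0, hys⟩ := (C.hS y).1 hyS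
    have hlt : y i < w i := by
      by_contra hcon
      exact hyw (eq_of_ratio hw0 hw1 hys hy2 (not_lt.1 hcon))
    rw [Finset.mem_filter, Set.Finite.mem_toFinset]
    refine ⟨⟨by rw [hpsi]; exact hyL, ?_⟩, by rw [← psi_sum w i hw1, hpsi, hys]⟩
    intro j
    have hq : 0 < y i / w i := div_pos (hy0 i) hwi
    by_cases hj : j = i
    · simp only [cy, if_pos hj]
      exact ⟨hq.le, (div_lt_one hwi).2 hlt⟩
    · simp only [cy, if_neg hj]
      have h1 := mem_amin.1 hy2 j
      have h2 : y i / w i * w j ≤ y j := by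
        rw [div_mul_eq_mul_div, div_le_iff₀ hwi]; exact h1
      have h3 := C.lt_one hy0 hys j
      have h4 : 0 < y i / w i * w j := mul_pos hq (hw0 j)
      exact ⟨by linarith, by linarith⟩
  refine le_trans (le_of_eq ?_) (Finset.sum_le_sum_of_subset hsub)
  rw [Finset.sum_image hcyinj.injOn]
  refine Finset.sum_congr rfl fun y hy => ?_
  obtain ⟨hy1, hy2⟩ := Finset.mem_filter.1 hy
  obtain ⟨hyw, hyS⟩ := Finset.mem_erase.1 hy1
  obtain ⟨hyL, hy0, hys⟩ := (C.hS y).1 hyS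
  have hsupp : supp (cy y) = insert i (amin y w)ᶜ := by
    ext j
    simp only [supp, Finset.mem_filter, Finset.mem_univ, true_and, Finset.mem_insert, Finset.mem_compl]
    by_cases hj : j = i
    · simp only [cy, if_pos hj, hj, true_or, iff_true]
      exact (div_pos (hy0 i) hwi).ne'
    · simp only [cy, if_neg hj, hj, false_or]
      have h1 := mem_amin.1 hy2
      rw [not_iff_not, sub_eq_zero, div_mul_eq_mul_div, eq_div_iff hwi.ne']
      constructor
      · intro he
        rw [mem_amin]
        intro l
        have h2 := h1 l
        have : (y j * w l) * w i ≤ (y l * w j) * w i := by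
          calc (y j * w l) * w i = (y j * w i) * w l := by ring
            _ = (y i * w l) * w j := by rw [he]; ring
            _ ≤ (y l * w i) * w j := mul_le_mul_of_nonneg_right h2 (hw0 j).le
            _ = (y l * w j) * w i := by ring
        exact le_of_mul_le_mul_right this hwi
      · intro he
        exact le_antisymm (mem_amin.1 he i) (h1 j)
  rw [hsupp, Finset.card_insert_of_notMem (by simpa using hy2), Finset.card_compl, C.hι]
  rfl

theorem Cfg.amin_nonempty (C : Cfg d k L Bx S) {w y : ι → ℝ} (hw : w ∈ S) : 1 ≤ (amin y w).card := by
  obtain ⟨hwL, hw0, hw1⟩ := (C.hS w).1 hw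
  have : Nonempty ι := by
    rw [← Fintype.card_pos_iff, C.hι]; omega
  obtain ⟨i, _, hi⟩ := Finset.exists_min_image Finset.univ (fun i => y i / w i) Finset.univ_nonempty
  apply Finset.card_pos.2
  refine ⟨i, mem_amin.2 fun j => ?_⟩
  have := hi j (Finset.mem_univ j)
  rwa [div_le_div_iff₀ (hw0 i) (hw0 j)] at this

theorem Cfg.amin_card_le (C : Cfg d k L Bx S) {w y : ι → ℝ} (hw : w ∈ S) (hy : y ∈ S) (hne : y ≠ w) :
    (amin y w).card ≤ d := by
  obtain ⟨hwL, hw0, hw1⟩ := (C.hS w).1 hw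
  obtain ⟨hyL, hy0, hy1⟩ := (C.hS y).1 hy
  by_contra hcon
  have h1 : amin y w = Finset.univ := by
    apply Finset.eq_univ_of_card
    have : (amin y w).card ≤ Fintype.card ι := Finset.card_le_univ _
    have := C.hι
    omega
  apply hne
  obtain ⟨i, hi⟩ : ∃ i, w i ≤ y i := by
    by_contra hc
    push Not at hc
    have : Nonempty ι := by
      rw [← Fintype.card_pos_iff, C.hι]; omega
    have := Finset.sum_lt_sum_of_nonempty (s := Finset.univ) Finset.univ_nonempty (fun i _ => hc i)
    linarith
  exact eq_of_ratio hw0 hw1 hy1 (i := i) (by rw [h1]; simp) hi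

theorem mul_aux (m d : ℕ) (h1 : 1 ≤ m) (h2 : m ≤ d) :
    d ≤ m * (d + 1 - m) ∧ (m * (d + 1 - m) = d → m = 1 ∨ m = d) := by
  obtain ⟨a, rfl⟩ := Nat.exists_eq_add_of_le h1
  obtain ⟨b, rfl⟩ := Nat.exists_eq_add_of_le h2
  have : 1 + a + b + 1 - (1 + a) = b + 1 := by omega
  rw [this]
  constructor
  · nlinarith [Nat.zero_le (a * b)]
  · intro h
    have : a * b = 0 := by nlinarith
    rcases Nat.mul_eq_zero.1 this with h | h
    · left; omega
    · right; omega

theorem Cfg.main_eq (C : Cfg d k L Bx S) {w : ι → ℝ} (hw : w ∈ S) :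
    (∀ y ∈ S, y ≠ w → (amin y w).card = 1 ∨ (amin y w).card = d) ∧
    (∀ i, ((1 + ∑ y ∈ (S.erase w).filter (fun y => i ∈ amin y w), (d + 1 - (amin y w).card) : ℕ) : ℝ)
      = Bx.card * w i) := by
  obtain ⟨hwL, hw0, hw1⟩ := (C.hS w).1 hw
  set f : ι → ℕ := fun i => 1 + ∑ y ∈ (S.erase w).filter (fun y => i ∈ amin y w), (d + 1 - (amin y w).card)
    with hf
  have hle : ∀ i, (f i : ℝ) ≤ Bx.card * w i := fun i => C.sub_bound hw i
  have hsum : ∑ i, f i = (d + 1) + ∑ y ∈ S.erase w, (amin y w).card * (d + 1 - (amin y w).card) := by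
    rw [hf]
    rw [Finset.sum_add_distrib]
    congr 1
    · simp [C.hι]
    · simp_rw [Finset.sum_filter]
      rw [Finset.sum_comm]
      refine Finset.sum_congr rfl fun y _ => ?_
      rw [← Finset.sum_filter]
      simp
  have hge : ∀ y ∈ S.erase w, d ≤ (amin y w).card * (d + 1 - (amin y w).card) := by
    intro y hy
    obtain ⟨hyw, hyS⟩ := Finset.mem_erase.1 hy
    exact (mul_aux _ d (C.amin_nonempty hw) (C.amin_card_le hw hyS hyw)).1
  have hcard : (S.erase w).card + 1 = k := by
    rw [Finset.card_erase_add_one hw, C.hk]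
  have hS1 : ∑ y ∈ S.erase w, d + (d + 1) = Bx.card := by
    rw [C.hN, ← hcard]; simp; ring
  have h1 : (Bx.card : ℝ) ≤ ∑ i, (f i : ℝ) := by
    have : Bx.card ≤ ∑ i, f i := by
      rw [hsum, ← hS1, add_comm]
      exact Nat.add_le_add_left (Finset.sum_le_sum hge) _
    exact_mod_cast this
  have h2 : ∑ i, (Bx.card : ℝ) * w i = Bx.card := by rw [← Finset.mul_sum, hw1, mul_one]
  have h3 : ∑ i, (f i : ℝ) ≤ ∑ i, (Bx.card : ℝ) * w i := Finset.sum_le_sum fun i _ => hle i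
  have h4 : ∑ i, (f i : ℝ) = ∑ i, (Bx.card : ℝ) * w i := by linarith
  constructor
  · intro y hy hyw
    have h5 : ∑ i, f i = Bx.card := by
      have : ∑ i, (f i : ℝ) = Bx.card := by rw [h4, h2]
      exact_mod_cast this
    have h6 : ∑ y ∈ S.erase w, d = ∑ y ∈ S.erase w, (amin y w).card * (d + 1 - (amin y w).card) := by
      omega
    have h7 := (Finset.sum_eq_sum_iff_of_le hge).1 h6 y (Finset.mem_erase.2 ⟨hyw, hy⟩)
    exact (mul_aux _ d (C.amin_nonempty hw) (C.amin_card_le hw hy hyw)).2 h7.symm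
  · intro i
    exact (Finset.sum_eq_sum_iff_of_le (fun i _ => hle i)).1 h4 i (Finset.mem_univ i)

theorem Cfg.exists_one (C : Cfg d k L Bx S) (hk : 1 ≤ k) (i : ι) :
    ∃ w ∈ S, (Bx.card : ℝ) * w i = 1 := by
  have hne : S.Nonempty := by rw [← Finset.card_pos, C.hk]; omega
  obtain ⟨w, hw, hmin⟩ := Finset.exists_min_image S (fun w => w i) hne
  refine ⟨w, hw, ?_⟩
  obtain ⟨hwL, hw0, hw1⟩ := (C.hS w).1 hw
  rw [← (C.main_eq hw).2 i]
  have : (S.erase w).filter (fun y => i ∈ amin y w) = ∅ := by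
    rw [Finset.filter_eq_empty_iff]
    intro y hy hi
    obtain ⟨hyw, hy⟩ := Finset.mem_erase.1 hy
    obtain ⟨hyL, hy0, hy1⟩ := (C.hS y).1 hy
    exact hyw (eq_of_ratio hw0 hw1 hy1 hi (hmin y hy))
  rw [this]; simp

theorem Cfg.Npos (C : Cfg d k L Bx S) : (0:ℝ) < Bx.card := by
  rw [C.hN]; positivity

theorem Cfg.eq_zero (C : Cfg d k L Bx S) (hk : 1 ≤ k) {t : ι → ℝ} (ht : t ∈ Bx) {i : ι}
    (h : t i = 0) : t = 0 := by
  obtain ⟨w, hw, hw1⟩ := C.exists_one hk i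
  have hwi := ((C.hS w).1 hw).2.1 i
  have h1 := C.lat.count (C.S_sub hw) i
  rw [hw1] at h1
  have h2 : (Bx.filter (fun t => t i < w i)).card ≤ 1 := by
    have : (Bx.filter (fun t => t i < w i)).card = 1 := by exact_mod_cast h1
    omega
  exact Finset.card_le_one.1 h2 t (Finset.mem_filter.2 ⟨ht, by rw [h]; exact hwi⟩) 0
    (Finset.mem_filter.2 ⟨C.lat.zero_mem, hwi⟩)

theorem Cfg.coord_inj (C : Cfg d k L Bx S) (hk : 1 ≤ k) {s t : ι → ℝ} (hs : s ∈ Bx) (ht : t ∈ Bx)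
    {i : ι} (h : s i = t i) : s = t := by
  have h1 : fr (s - t) ∈ Bx :=
    C.lat.fr_mem (L.sub_mem ((C.lat.mem s).1 hs).1 ((C.lat.mem t).1 ht).1)
  have h2 : fr (s - t) = 0 := C.eq_zero hk h1 (i := i) (by simp [fr, h])
  have h3 : fr s = fr t := by
    rw [fr_eq_fr]
    have : fr (s - t) = fr 0 := by rw [h2]; funext j; simp [fr]
    simpa using fr_eq_fr.1 this
  rwa [C.lat.fr_self hs, C.lat.fr_self ht] at h3

theorem Cfg.pos (C : Cfg d k L Bx S) (hk : 1 ≤ k) {t : ι → ℝ} (ht : t ∈ Bx) (h : t ≠ 0) (i : ι) :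
    0 < t i :=
  lt_of_le_of_ne (((C.lat.mem t).1 ht).2 i).1 fun h0 => h (C.eq_zero hk ht h0.symm)

theorem Cfg.supp_card (C : Cfg d k L Bx S) (hk : 1 ≤ k) {t : ι → ℝ} (ht : t ∈ Bx) (h : t ≠ 0) :
    (supp t).card = d + 1 := by
  rw [← C.hι, ← Finset.card_univ]
  congr 1
  rw [supp, Finset.filter_true_of_mem]
  exact fun i _ => (C.pos hk ht h i).ne'

theorem Cfg.mem_S (C : Cfg d k L Bx S) (hk : 1 ≤ k) {t : ι → ℝ} (ht : t ∈ Bx) (h : ∑ i, t i = 1) :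
    t ∈ S := by
  have : t ≠ 0 := by rintro rfl; simp at h
  exact (C.hS t).2 ⟨((C.lat.mem t).1 ht).1, C.pos hk ht this, h⟩

theorem Cfg.S_ne (C : Cfg d k L Bx S) {t : ι → ℝ} (ht : t ∈ S) : t ≠ 0 := by
  rintro rfl
  have := ((C.hS 0).1 ht).2.2
  simp at this

theorem Cfg.lev_step (C : Cfg d k L Bx S) (hk : 1 ≤ k) {j : ℕ} (hj : j < d) :
    (lev Bx j).card + k ≤ (lev Bx (j+1)).card := by
  have h := C.lat.step j
  have : Bx.filter (fun p => ∑ i, p i = 1 ∧ j + 2 ≤ (supp p).card) = S := by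
    ext p
    rw [Finset.mem_filter]
    constructor
    · rintro ⟨h1, h2, h3⟩; exact C.mem_S hk h1 h2
    · intro hp
      have hb := C.S_sub hp
      refine ⟨hb, ((C.hS p).1 hp).2.2, ?_⟩
      rw [C.supp_card hk hb (C.S_ne hp)]; omega
  rw [this, C.hk] at h
  exact h

theorem Cfg.lev_low (C : Cfg d k L Bx S) (hk : 1 ≤ k) (j n : ℕ) (hj : j + n ≤ d) :
    (lev Bx j).card + n * k ≤ (lev Bx (j+n)).card := by
  induction n with
  | zero => simp
  | succ n ih =>
    have h1 := ih (by omega)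
    have h2 := C.lev_step hk (j := j + n) (by omega)
    rw [← add_assoc]
    have : (n+1) * k = n * k + k := by ring
    omega

theorem Cfg.lev_card (C : Cfg d k L Bx S) (hk : 1 ≤ k) {j : ℕ} (hj : j ≤ d) :
    (lev Bx j).card = j * k + 1 := by
  have h1 := C.lev_low hk 0 j (by omega)
  have h2 := C.lev_low hk j (d - j) (by omega)
  have h3 : (lev Bx (j + (d - j))).card ≤ Bx.card := Finset.card_filter_le _ _
  have h4 : 1 ≤ (lev Bx 0).card := Finset.card_pos.2 ⟨0, Finset.mem_filter.2 ⟨C.lat.zero_mem, by simp⟩⟩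
  rw [C.hN] at h3
  have h5 : d * k = j * k + (d - j) * k := by rw [← add_mul]; congr 1; omega
  rw [zero_add] at h1
  omega

theorem Cfg.fr_add_notin (C : Cfg d k L Bx S) (hk : 1 ≤ k) {y z : ι → ℝ} (hy : y ∈ S) (hz : z ∈ S)
    (h : ∀ l, z + y - Pi.single l 1 ∉ S) : fr (z + y) ∉ lev Bx 1 := by
  intro hm
  obtain ⟨hb, hs⟩ := Finset.mem_filter.1 hm
  have hyb := C.S_sub hy
  have hzb := C.S_sub hz
  have hy' := ((C.lat.mem y).1 hyb).2
  have hz' := ((C.lat.mem z).1 hzb).2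
  have sy := ((C.hS y).1 hy).2.2
  have sz := ((C.hS z).1 hz).2.2
  have hd := C.hd
  set t := fr (z + y) with ht
  have h0 : t ≠ 0 := by
    intro h0
    have := ht_zero_sum hz' hy' h0
    rw [sy, sz, C.supp_card hk hyb (C.S_ne hy)] at this
    push_cast at this
    have : (3:ℝ) ≤ d := by exact_mod_cast hd
    linarith
  have hpos : 0 < ∑ i, t i := by
    obtain ⟨i⟩ : Nonempty ι := by rw [← Fintype.card_pos_iff, C.hι]; omega
    exact Finset.sum_pos (fun i _ => C.pos hk hb h0 i) ⟨i, Finset.mem_univ i⟩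
  have h1 : ∑ i, t i = 1 := by
    obtain ⟨n, hn⟩ := C.lat.sum t ((C.lat.mem t).1 hb).1
    rw [hn] at hpos hs ⊢
    have a : 0 < n := by exact_mod_cast hpos
    have b : n ≤ 1 := by exact_mod_cast hs
    have : n = 1 := by omega
    rw [this]; simp
  have hc : ∀ l, z l + y l - t l = 0 ∨ z l + y l - t l = 1 := by
    intro l
    have e : t l = Int.fract (z l + y l) := rfl
    rcases fract_add_cases (hz' l) (hy' l) with ⟨_, h2⟩ | ⟨_, h2⟩
    · left; rw [e, h2]; ring
    · right; rw [e, h2]; ring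
  have hsum : ∑ l, (z l + y l - t l) = 1 := by
    rw [Finset.sum_sub_distrib, Finset.sum_add_distrib, sy, sz, h1]; ring
  obtain ⟨l, hl⟩ : ∃ l, z l + y l - t l = 1 := by
    by_contra hcon
    push Not at hcon
    rw [Finset.sum_eq_zero fun l _ => (hc l).resolve_right (hcon l)] at hsum
    norm_num at hsum
  apply h l
  have : z + y - Pi.single l 1 = t := by
    funext j
    by_cases hjl : j = l
    · subst hjl; simp; linarith
    · have hr : ∑ l' ∈ Finset.univ.erase l, (z l' + y l' - t l') = 0 := by
        have := Finset.add_sum_erase Finset.univ (fun l => z l + y l - t l) (Finset.mem_univ l)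
        simp only [hsum, hl] at this
        linarith
      rw [Finset.sum_eq_zero_iff_of_nonneg] at hr
      · have := hr j (Finset.mem_erase.2 ⟨hjl, Finset.mem_univ j⟩)
        simp [hjl]; linarith
      · intro l' _
        rcases hc l' with h | h <;> rw [h]; norm_num
  rw [this]
  exact C.mem_S hk hb h1

theorem Cfg.lemK (C : Cfg d k L Bx S) (hk : 1 ≤ k) {y : ι → ℝ} (hy : y ∈ S) (i : ι)
    (R : Finset (ι → ℝ)) (hRS : R ⊆ S) (hR : ∀ z ∈ R, ∀ l, z + y - Pi.single l 1 ∉ S) :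
    1 + ((d:ℝ) - 1) * R.card ≤ Bx.card - Bx.card * y i := by
  classical
  have hyb := C.S_sub hy
  have sy := ((C.hS y).1 hy).2.2
  have hd := C.hd
  let f : (ι → ℝ) → (ι → ℝ) := fun t => fr (t + y)
  have finj : Set.InjOn f (Bx : Set (ι → ℝ)) := by
    intro a ha b hb hab
    have := fr_eq_fr.1 hab
    rw [add_sub_add_right_eq_sub] at this
    have := fr_eq_fr.2 this
    rwa [C.lat.fr_self ha, C.lat.fr_self hb] at this
  let D : ℕ → Finset (ι → ℝ) := fun j => (lev Bx j).image f \ lev Bx j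
  have hD : ∀ j, ∀ t ∈ D j, t ∈ Bx ∧ ∑ l, t l = j + 1 ∧ y i ≤ t i := by
    intro j t ht
    obtain ⟨h1, h2⟩ := Finset.mem_sdiff.1 ht
    obtain ⟨s, hs, rfl⟩ := Finset.mem_image.1 h1
    obtain ⟨hsb, hsj⟩ := Finset.mem_filter.1 hs
    have htb : f s ∈ Bx := C.lat.add_mem hsb hyb
    have hgt : (j:ℝ) < ∑ l, f s l := by
      by_contra hc; exact h2 (Finset.mem_filter.2 ⟨htb, not_lt.1 hc⟩)
    obtain ⟨n, hn⟩ := C.lat.sum _ ((C.lat.mem _).1 htb).1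
    have hge : (j:ℝ) + 1 ≤ ∑ l, f s l := by
      rw [hn] at hgt ⊢
      have : (j:ℤ) < n := by exact_mod_cast hgt
      have : (j:ℤ) + 1 ≤ n := by omega
      exact_mod_cast this
    have hle : ∑ l, f s l ≤ ∑ l, s l + ∑ l, y l := C.lat.ht_fr_le hsb hyb
    rw [sy] at hle
    refine ⟨htb, by linarith, ?_⟩
    have hs0 := ((C.lat.mem s).1 hsb).2
    have hy0 := ((C.lat.mem y).1 hyb).2
    have heq : ∑ l, f s l = ∑ l, (s l + y l) := by
      rw [Finset.sum_add_distrib, sy]; linarith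
    have := (Finset.sum_eq_sum_iff_of_le
      (fun l _ => fract_add_le (hs0 l).1 (hy0 l).1)).1 heq i (Finset.mem_univ i)
    have e : f s i = s i + y i := this
    rw [e]; linarith [(hs0 i).1]
  have hsubs : (Finset.range d).biUnion D ⊆ Bx.filter (fun t => ¬ t i < y i) := by
    intro t ht
    obtain ⟨j, _, hj⟩ := Finset.mem_biUnion.1 ht
    obtain ⟨h1, h2, h3⟩ := hD j t hj
    exact Finset.mem_filter.2 ⟨h1, not_lt.2 h3⟩
  have hdisj : ((Finset.range d : Finset ℕ) : Set ℕ).PairwiseDisjoint D := by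
    intro a _ b _ hab
    rw [Function.onFun, Finset.disjoint_left]
    intro t h1 h2
    have e1 := (hD a t h1).2.1
    have e2 := (hD b t h2).2.1
    have : (a:ℝ) = b := by linarith
    exact hab (by exact_mod_cast this)
  have hcard := Finset.card_le_card hsubs
  rw [Finset.card_biUnion hdisj] at hcard
  have hcount := C.lat.count hyb i
  have htot := Finset.card_filter_add_card_filter_not (s := Bx) (fun t => t i < y i)
  have hD0 : 1 ≤ (D 0).card := by
    apply Finset.card_pos.2
    refine ⟨y, Finset.mem_sdiff.2 ⟨Finset.mem_image.2 ⟨0, Finset.mem_filter.2 ⟨C.lat.zero_mem, by simp⟩, ?_⟩, ?_⟩⟩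
    · simp only [f, zero_add]; exact C.lat.fr_self hyb
    · intro h
      have := (Finset.mem_filter.1 h).2
      rw [sy] at this; norm_num at this
  have hDj : ∀ j, j + 1 < d → R.card ≤ (D (j+1)).card := by
    intro j hj
    set A := lev Bx 1 with hA
    set B := A ∪ A.image f with hB
    have hAB : ∀ a ∈ A, a ∈ Bx := fun a ha => (Finset.mem_filter.1 ha).1
    have hBB : ∀ b ∈ B, b ∈ Bx ∧ ∑ l, b l ≤ 2 := by
      intro b hb
      rcases Finset.mem_union.1 hb with h | h
      · refine ⟨hAB b h, ?_⟩
        have := (Finset.mem_filter.1 h).2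
        push_cast at this; linarith
      · obtain ⟨a, ha, rfl⟩ := Finset.mem_image.1 h
        refine ⟨C.lat.add_mem (hAB a ha) hyb, ?_⟩
        have h1 := (Finset.mem_filter.1 ha).2
        have h2 : ∑ l, f a l ≤ ∑ l, a l + ∑ l, y l := C.lat.ht_fr_le (hAB a ha) hyb
        push_cast at h1; linarith
    have h0A : (0 : ι → ℝ) ∈ A := Finset.mem_filter.2 ⟨C.lat.zero_mem, by simp⟩
    have hsch := scherk_box (lev Bx j) B (fun p hp => C.lat.fr_self (Finset.mem_filter.1 hp).1)
      (fun p hp => C.lat.fr_self (hBB p hp).1) (Finset.mem_filter.2 ⟨C.lat.zero_mem, by simp⟩)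
      (Finset.mem_union_left _ h0A) (by
        intro x hx b hb h0
        by_contra hb0
        obtain ⟨hx1, hx2⟩ := Finset.mem_filter.1 hx
        have := ht_zero_sum ((C.lat.mem x).1 hx1).2 ((C.lat.mem b).1 (hBB b hb).1).2 h0
        rw [C.supp_card hk (hBB b hb).1 hb0] at this
        have h2 := (hBB b hb).2
        have : ((d + 1 : ℕ) : ℝ) ≤ j + 2 := by linarith
        have : d + 1 ≤ j + 2 := by exact_mod_cast this
        omega)
    have him : Finset.image₂ (fun x y => fr (x + y)) (lev Bx j) B ⊆
        lev Bx (j+1) ∪ (lev Bx (j+1)).image f := by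
      intro t ht
      obtain ⟨s, hs, b, hb, rfl⟩ := Finset.mem_image₂.1 ht
      have key : ∀ a ∈ A, fr (s + a) ∈ lev Bx (j+1) := by
        intro a ha
        obtain ⟨h1, h2⟩ := Finset.mem_filter.1 hs
        obtain ⟨h3, h4⟩ := Finset.mem_filter.1 ha
        refine Finset.mem_filter.2 ⟨C.lat.add_mem h1 h3, ?_⟩
        have := C.lat.ht_fr_le h1 h3
        push_cast at h4 ⊢; linarith
      rcases Finset.mem_union.1 hb with h | h
      · exact Finset.mem_union_left _ (key b h)
      · obtain ⟨a, ha, rfl⟩ := Finset.mem_image.1 h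
        refine Finset.mem_union_right _ (Finset.mem_image.2 ⟨_, key a ha, ?_⟩)
        simp only [f]
        rw [fr_eq_fr]
        have e : fr (s + a) + y - (s + fr (a + y)) = ((a + y) - fr (a + y)) - ((s + a) - fr (s+a)) := by
          abel
        rw [e]
        exact (intVec ι).sub_mem (sub_fr _) (sub_fr _)
    have hc1 := Finset.card_le_card him
    have hc2 : (lev Bx (j+1) ∪ (lev Bx (j+1)).image f).card = (lev Bx (j+1)).card + (D (j+1)).card := by
      rw [← Finset.union_sdiff_self_eq_union, Finset.card_union_of_disjoint Finset.disjoint_sdiff]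
    have hc3 : A.card + R.card ≤ B.card := by
      rw [hB, ← Finset.union_sdiff_self_eq_union, Finset.card_union_of_disjoint Finset.disjoint_sdiff]
      have : R.card = (R.image f).card := by
        rw [Finset.card_image_of_injOn]
        exact finj.mono fun z hz => C.S_sub (hRS hz)
      rw [this]
      gcongr
      intro t ht
      obtain ⟨z, hz, rfl⟩ := Finset.mem_image.1 ht
      refine Finset.mem_sdiff.2 ⟨Finset.mem_image_of_mem f (Finset.mem_filter.2 ⟨C.S_sub (hRS hz), ?_⟩),
        C.fr_add_notin hk hy (hRS hz) (hR z hz)⟩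
      rw [((C.hS z).1 (hRS hz)).2.2]; simp
    have l1 : A.card = k + 1 := by rw [hA, C.lev_card hk (by omega)]; ring
    have l2 := C.lev_card hk (j := j) (by omega)
    have l3 := C.lev_card hk (j := j+1) (by omega)
    have l4 : (j+1) * k = j * k + k := by ring
    omega
  have hlow : 1 + (d - 1) * R.card ≤ ∑ j ∈ Finset.range d, (D j).card := by
    obtain ⟨e, rfl⟩ : ∃ e, d = e + 1 := ⟨d - 1, by omega⟩
    rw [Finset.sum_range_succ']
    have : e * R.card ≤ ∑ j ∈ Finset.range e, (D (j+1)).card := by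
      have := Finset.card_nsmul_le_sum (Finset.range e) (fun j => (D (j+1)).card) R.card
        (fun j hj => hDj j (by have := Finset.mem_range.1 hj; omega))
      simpa using this
    simp only [Nat.add_sub_cancel]
    omega
  have : 1 + (d - 1) * R.card + (Bx.filter (fun t => t i < y i)).card ≤ Bx.card := by omega
  have h' : ((1 + (d - 1) * R.card + (Bx.filter (fun t => t i < y i)).card : ℕ) : ℝ) ≤ Bx.card := by
    exact_mod_cast this
  push_cast [Nat.cast_sub (show 1 ≤ d by omega)] at h'
  rw [hcount] at h'
  linarith

def ev (j : ι) : ι → ℝ := Pi.single j 1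

theorem ev_self (j : ι) : ev j j = 1 := by simp [ev]
theorem ev_ne {i j : ι} (h : i ≠ j) : ev j i = 0 := by simp [ev, h]

def OnSeg (u w : ι → ℝ) (j : ι) : Prop :=
  ∃ τ : ℝ, 0 < τ ∧ τ < 1 ∧ u = ev j + τ • (w - ev j)

def Ray (y : ι → ℝ) (j : ι) (g : ℕ) (z : ι → ℝ) : Prop := z = ev j + (g : ℝ) • (y - ev j)

def InY (S : Finset (ι → ℝ)) (y : ι → ℝ) (j : ι) : Prop :=
  y ∈ S ∧ 1 < 2 * y j ∧ ∀ u ∈ S, ¬ OnSeg u y j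

def Cg (d : ℕ) (N : ℝ) (x : ι → ℝ) (i : ι) (r : ℤ) : Prop := ∃ z : ℤ, N * x i = r + d * z

theorem seg_self (τ : ℝ) (w : ι → ℝ) (j : ι) : (ev j + τ • (w - ev j)) j = 1 - τ * (1 - w j) := by
  simp [ev_self]; ring

theorem seg_ne (τ : ℝ) (w : ι → ℝ) {i j : ι} (h : i ≠ j) : (ev j + τ • (w - ev j)) i = τ * w i := by
  simp [ev_ne h]

theorem ev_sum (j : ι) : ∑ i, ev j i = 1 := by simp [ev]

theorem seg_sum (τ : ℝ) (w : ι → ℝ) (j : ι) (h : ∑ i, w i = 1) :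
    ∑ i, (ev j + τ • (w - ev j)) i = 1 := by
  simp only [Pi.add_apply, Pi.smul_apply, Pi.sub_apply, smul_eq_mul]
  rw [Finset.sum_add_distrib, ← Finset.mul_sum, Finset.sum_sub_distrib, ev_sum, h]; ring

theorem Cfg.Spos (C : Cfg d k L Bx S) {w : ι → ℝ} (hw : w ∈ S) (i : ι) : 0 < w i :=
  ((C.hS w).1 hw).2.1 i

theorem Cfg.Slt (C : Cfg d k L Bx S) {w : ι → ℝ} (hw : w ∈ S) (i : ι) : w i < 1 :=
  C.lt_one ((C.hS w).1 hw).2.1 ((C.hS w).1 hw).2.2 i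

theorem Cfg.Ssum (C : Cfg d k L Bx S) {w : ι → ℝ} (hw : w ∈ S) : ∑ i, w i = 1 :=
  ((C.hS w).1 hw).2.2

theorem Cfg.SL (C : Cfg d k L Bx S) {w : ι → ℝ} (hw : w ∈ S) : w ∈ L := ((C.hS w).1 hw).1

theorem Cfg.seg_mem (C : Cfg d k L Bx S) {w : ι → ℝ} (hw : w ∈ S) (j : ι) {s : ℝ} (h0 : 0 < s)
    (h1 : s ≤ 1) (hL : ev j + s • (w - ev j) ∈ L) : ev j + s • (w - ev j) ∈ S := by
  refine (C.hS _).2 ⟨hL, fun i => ?_, seg_sum _ _ _ (C.Ssum hw)⟩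
  by_cases h : i = j
  · subst h; rw [seg_self]
    nlinarith [C.Spos hw i, C.Slt hw i]
  · rw [seg_ne _ _ h]; exact mul_pos h0 (C.Spos hw i)

theorem Cfg.comb_mem (C : Cfg d k L Bx S) {y z : ι → ℝ} (hy : y ∈ S) (hz : z ∈ S) {j : ι}
    (h : 1 < y j + z j) : y + z - ev j ∈ S := by
  refine (C.hS _).2 ⟨L.sub_mem (L.add_mem (C.SL hy) (C.SL hz)) (C.lat.single j), fun i => ?_, ?_⟩
  · by_cases hi : i = j
    · subst hi; simp [ev_self]; linarith
    · simp [ev_ne hi]; linarith [C.Spos hy i, C.Spos hz i]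
  · simp only [Pi.add_apply, Pi.sub_apply]
    rw [Finset.sum_sub_distrib, Finset.sum_add_distrib, ev_sum, C.Ssum hy, C.Ssum hz]; ring

theorem Cfg.comb_gt (C : Cfg d k L Bx S) {y z : ι → ℝ} {j : ι}
    (h : y + z - ev j ∈ S) : 1 < y j + z j := by
  have := C.Spos h j
  simp [ev_self] at this; linarith

theorem Cfg.amin_seg (C : Cfg d k L Bx S) {u w : ι → ℝ} {j : ι} (hw : w ∈ S) (h : OnSeg u w j) :
    amin u w = Finset.univ.erase j := by
  obtain ⟨τ, h0, h1, rfl⟩ := h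
  ext i
  rw [mem_amin, Finset.mem_erase]
  constructor
  · intro h
    refine ⟨?_, Finset.mem_univ i⟩
    rintro rfl
    obtain ⟨l, hl⟩ := C.exists_ne i
    have := h l
    rw [seg_self, seg_ne _ _ hl] at this
    nlinarith [C.Spos hw l, C.Spos hw i]
  · rintro ⟨hi, -⟩ l
    rw [seg_ne _ _ hi]
    by_cases hl : l = j
    · subst hl; rw [seg_self]; nlinarith [C.Spos hw l, C.Spos hw i, C.Slt hw l]
    · rw [seg_ne _ _ hl]; apply le_of_eq; ring

theorem Cfg.seg_of_card (C : Cfg d k L Bx S) {u w : ι → ℝ} (hu : u ∈ S) (hw : w ∈ S) (hne : u ≠ w)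
    (h : (amin u w).card = d) : ∃ j, OnSeg u w j := by
  have h1 : ((amin u w)ᶜ).card = 1 := by
    rw [Finset.card_compl, C.hι, h]; omega
  obtain ⟨j, hj⟩ := Finset.card_eq_one.1 h1
  have hm : ∀ i, i ≠ j → i ∈ amin u w := by
    intro i hi
    by_contra hc
    have : i ∈ (amin u w)ᶜ := Finset.mem_compl.2 hc
    rw [hj] at this
    exact hi (Finset.mem_singleton.1 this)
  obtain ⟨i0, hi0⟩ := C.exists_ne j
  have hwp := C.Spos hw i0
  have hup := C.Spos hu i0
  have hlt : u i0 < w i0 := by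
    by_contra hc
    exact hne (eq_of_ratio ((C.hS w).1 hw).2.1 (C.Ssum hw) (C.Ssum hu) (hm i0 hi0) (not_lt.1 hc))
  have hco : ∀ i, i ≠ j → u i = u i0 / w i0 * w i := by
    intro i hi
    have a := mem_amin.1 (hm i hi) i0
    have b := mem_amin.1 (hm i0 hi0) i
    field_simp; linarith
  refine ⟨j, u i0 / w i0, by positivity, (div_lt_one hwp).2 hlt, ?_⟩
  funext i
  by_cases hi : i = j
  · have h2 := C.Ssum hu
    have h3 := seg_sum (u i0 / w i0) w j (C.Ssum hw)
    rw [← Finset.add_sum_erase _ _ (Finset.mem_univ j)] at h2 h3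
    have : ∑ x ∈ Finset.univ.erase j, u x = ∑ x ∈ Finset.univ.erase j, (ev j + (u i0 / w i0) • (w - ev j)) x := by
      refine Finset.sum_congr rfl fun x hx => ?_
      have hx := (Finset.mem_erase.1 hx).1
      rw [seg_ne _ _ hx, hco x hx]
    subst hi
    linarith
  · rw [seg_ne _ _ hi]; exact hco i hi

theorem Cfg.res_one (C : Cfg d k L Bx S) {w : ι → ℝ} (hw : w ∈ S) (h : ∀ u ∈ S, ∀ j, ¬ OnSeg u w j)
    (i : ι) : Cg d Bx.card w i 1 := by
  obtain ⟨h1, h2⟩ := C.main_eq hw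
  refine ⟨((S.erase w).filter (fun y => i ∈ amin y w)).card, ?_⟩
  rw [← h2 i, Finset.sum_congr rfl (g := fun _ => d)]
  · simp; ring
  · intro y hy
    obtain ⟨hyw, hy⟩ := Finset.mem_erase.1 (Finset.mem_filter.1 hy).1
    rcases h1 y hy hyw with hc | hc
    · rw [hc]; omega
    · obtain ⟨j, hj⟩ := C.seg_of_card hy hw hyw hc
      exact absurd hj (h y hy j)

theorem Cg.uniq {d : ℕ} {N : ℝ} {x : ι → ℝ} {i : ι} {a b : ℤ} (ha : Cg d N x i a) (hb : Cg d N x i b) :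
    (d : ℤ) ∣ a - b := by
  obtain ⟨z, hz⟩ := ha
  obtain ⟨z', hz'⟩ := hb
  refine ⟨z' - z, ?_⟩
  have : (a:ℝ) - b = d * (z' - z) := by linarith
  exact_mod_cast this

theorem Cfg.N_eq (C : Cfg d k L Bx S) : (Bx.card : ℝ) = d * k + 1 := by rw [C.hN]; push_cast; ring

theorem Cfg.cg_comb (C : Cfg d k L Bx S) {y z : ι → ℝ} {i j : ι} {a b : ℤ}
    (hy : Cg d Bx.card y i a) (hz : Cg d Bx.card z i b) :
    Cg d Bx.card (y + z - ev j) i (a + b - if i = j then 1 else 0) := by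
  obtain ⟨s, hs⟩ := hy
  obtain ⟨t, ht⟩ := hz
  have hN := C.N_eq
  by_cases h : i = j
  · subst h
    refine ⟨s + t - k, ?_⟩
    simp only [Pi.sub_apply, Pi.add_apply, ev_self, if_true]
    push_cast; linarith
  · refine ⟨s + t, ?_⟩
    simp only [Pi.sub_apply, Pi.add_apply, ev_ne h, if_neg h]
    push_cast; linarith

theorem Cfg.cg_ray (C : Cfg d k L Bx S) {y z : ι → ℝ} {i j : ι} {g : ℕ}
    (hy : Cg d Bx.card y i 1) (hz : Ray y j g z) :
    Cg d Bx.card z i (if i = j then 1 else g) := by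
  obtain ⟨s, hs⟩ := hy
  have hN := C.N_eq
  rw [Ray] at hz
  subst hz
  by_cases h : i = j
  · subst h
    refine ⟨k + g * (s - k), ?_⟩
    rw [seg_self, if_pos rfl]
    push_cast at hs ⊢
    have : (Bx.card:ℝ) * (1 - g * (1 - y i)) = Bx.card - g * (Bx.card - Bx.card * y i) := by ring
    rw [this, hs, hN]; ring
  · refine ⟨g * s, ?_⟩
    rw [seg_ne _ _ h, if_neg h]
    push_cast at hs ⊢
    have : (Bx.card:ℝ) * (g * y i) = g * (Bx.card * y i) := by ring
    rw [this, hs]; ring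

theorem InY.no_seg (C : Cfg d k L Bx S) {y : ι → ℝ} {j : ι} (hy : InY S y j) :
    ∀ u ∈ S, ∀ j', ¬ OnSeg u y j' := by
  intro u hu j' hseg
  obtain ⟨hyS, hy2, hno⟩ := hy
  by_cases hj : j' = j
  · subst hj; exact hno u hu hseg
  obtain ⟨τ, h0, h1, rfl⟩ := hseg
  have hw : y + y - ev j ∈ S := C.comb_mem hyS hyS (by linarith)
  set w := y + y - ev j with hwdef
  set u := ev j' + τ • (y - ev j') with hudef
  have wj : w j = 2 * y j - 1 := by simp [hwdef, ev_self]; ring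
  have wn : ∀ i, i ≠ j → w i = 2 * y i := by
    intro i hi; simp [hwdef, ev_ne hi]; ring
  have uj : u j' = 1 - τ * (1 - y j') := seg_self _ _ _
  have un : ∀ i, i ≠ j' → u i = τ * y i := fun i hi => seg_ne _ _ hi
  have hP := fun i => C.Spos hyS i
  have hQ := fun i => C.Slt hyS i
  have hd := C.hd
  obtain ⟨m, hm⟩ : ∃ m, m ∉ ({j, j'} : Finset ι) := by
    by_contra hc
    push Not at hc
    have : (Finset.univ : Finset ι) ⊆ {j, j'} := fun x _ => hc x
    have h2 := Finset.card_le_card this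
    have h3 := Finset.card_le_two (a := j) (b := j')
    rw [Finset.card_univ, C.hι] at h2
    omega
  simp only [Finset.mem_insert, Finset.mem_singleton, not_or] at hm
  have ham : amin u w = (Finset.univ.erase j).erase j' := by
    ext i
    rw [mem_amin, Finset.mem_erase, Finset.mem_erase]
    constructor
    · intro h
      have hmm := h m
      rw [un m hm.2, wn m hm.1] at hmm
      refine ⟨?_, ?_, Finset.mem_univ i⟩
      · rintro rfl
        rw [uj, wn i hj] at hmm
        nlinarith [hP m, hP i]
      · rintro rfl
        rw [wj, un i (Ne.symm hj)] at hmm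
        nlinarith [hP m, hP i, mul_pos h0 (hP m)]
    · rintro ⟨hi1, hi2, -⟩ l
      rw [un i hi1, wn i hi2]
      by_cases hl : l = j
      · subst hl; rw [wj, un l (Ne.symm hj)]; nlinarith [hP i, mul_pos h0 (hP i)]
      · rw [wn l hl]
        by_cases hl' : l = j'
        · subst hl'; rw [uj]; nlinarith [hP i, hP l]
        · rw [un l hl']; apply le_of_eq; ring
  have hcard : (amin u w).card = d - 1 := by
    rw [ham, Finset.card_erase_of_mem (Finset.mem_erase.2 ⟨hj, Finset.mem_univ _⟩),
      Finset.card_erase_of_mem (Finset.mem_univ _), Finset.card_univ, C.hι]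
    omega
  by_cases huw : u = w
  · have : amin u w = Finset.univ := by
      ext i; simp only [mem_amin, Finset.mem_univ, iff_true]
      intro l; rw [huw]; apply le_of_eq; ring
    rw [this, Finset.card_univ, C.hι] at hcard; omega
  · rcases (C.main_eq hw).1 u hu huw with h | h <;> omega

theorem Cfg.ray_of_seg (C : Cfg d k L Bx S) {u w : ι → ℝ} {j : ι} (hu : u ∈ S) (hw : w ∈ S)
    (h : OnSeg u w j) : ∃ y, InY S y j ∧ ∃ g : ℕ, 2 ≤ g ∧ Ray y j g w := by
  classical
  obtain ⟨y, hyF, hmax⟩ := Finset.exists_max_image (S.filter (fun u => OnSeg u w j)) (fun u => u j)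
    ⟨u, Finset.mem_filter.2 ⟨hu, h⟩⟩
  obtain ⟨hyS, τ, h0, h1, hyτ⟩ := Finset.mem_filter.1 hyF
  have hmax' : ∀ σ : ℝ, 0 < σ → σ < τ → ev j + σ • (w - ev j) ∈ L → False := by
    intro σ s0 s1 hL
    have hS := C.seg_mem hw j s0 (by linarith) hL
    have := hmax _ (Finset.mem_filter.2 ⟨hS, σ, s0, by linarith, rfl⟩)
    rw [seg_self, hyτ, seg_self] at this
    nlinarith [C.Slt hw j]
  set n := ⌊1 / τ⌋₊ with hn
  have hn1 : (n:ℝ) * τ ≤ 1 := by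
    have := Nat.floor_le (show 0 ≤ 1 / τ by positivity)
    rwa [← hn, le_div_iff₀ h0] at this
  have hn2 : 1 < ((n:ℝ) + 1) * τ := by
    have := Nat.lt_floor_add_one (1 / τ)
    rwa [← hn, div_lt_iff₀ h0] at this
  have heq : (n:ℝ) * τ = 1 := by
    by_contra hne
    have hlt := lt_of_le_of_ne hn1 hne
    apply hmax' (1 - n * τ) (by linarith) (by linarith)
    have : ev j + (1 - (n:ℝ) * τ) • (w - ev j) = w - n • (y - ev j) := by
      rw [hyτ]; funext i; simp; ring
    rw [this]
    exact L.sub_mem (C.SL hw) (L.nsmul_mem (L.sub_mem (C.SL hyS) (C.lat.single j)) n)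
  have hg : 2 ≤ n := by
    by_contra hc
    have : (n:ℝ) ≤ 1 := by exact_mod_cast (by omega : n ≤ 1)
    nlinarith
  have hg' : (2:ℝ) ≤ n := by exact_mod_cast hg
  refine ⟨y, ⟨hyS, ?_, ?_⟩, n, hg, ?_⟩
  · rw [hyτ, seg_self]
    nlinarith [C.Spos hw j]
  · rintro v hv ⟨σ, s0, s1, rfl⟩
    have : ev j + σ • (y - ev j) = ev j + (σ * τ) • (w - ev j) := by
      rw [hyτ]; funext i; simp; ring
    rw [this] at hv
    exact hmax' (σ * τ) (by positivity) (by nlinarith) (C.SL hv)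
  · rw [Ray, hyτ]
    have : (n:ℝ) • (ev j + τ • (w - ev j) - ev j) = ((n:ℝ) * τ) • (w - ev j) := by
      funext i; simp; ring
    rw [this, heq]; simp

theorem Cfg.tri (C : Cfg d k L Bx S) {w : ι → ℝ} (hw : w ∈ S) :
    (∀ i, Cg d Bx.card w i 1) ∨ ∃ j y, ∃ g : ℕ, InY S y j ∧ 2 ≤ g ∧ Ray y j g w ∧
      ∀ i, Cg d Bx.card w i (if i = j then 1 else g) := by
  by_cases h : ∀ u ∈ S, ∀ j, ¬ OnSeg u w j
  · left; exact C.res_one hw h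
  · right
    push Not at h
    obtain ⟨u, hu, j, hj⟩ := h
    obtain ⟨y, hy, g, hg, hr⟩ := C.ray_of_seg hu hw hj
    exact ⟨j, y, g, hy, hg, hr, fun i => C.cg_ray (C.res_one hy.1 (hy.no_seg C) i) hr⟩

theorem Cfg.not_dvd_one (C : Cfg d k L Bx S) {a : ℤ} (h : (d:ℤ) ∣ a) (ha : a = 1 ∨ a = -1) : False := by
  have hd := C.hd
  have h1 : (d:ℤ) ∣ 1 := by
    rcases ha with rfl | rfl
    · exact h
    · exact (dvd_neg.1 h)
  have := Int.le_of_dvd (by norm_num) h1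
  omega

theorem Cfg.type_two (C : Cfg d k L Bx S) {u : ι → ℝ} (hu : u ∈ S) {j : ι}
    (h : ∀ l, l ≠ j → Cg d Bx.card u l 2) :
    ∃ y, InY S y j ∧ ∃ g : ℕ, 2 ≤ g ∧ Ray y j g u := by
  rcases C.tri hu with h1 | ⟨j', y, g, hy, hg, hr, hc⟩
  · obtain ⟨l, hl⟩ := C.exists_ne j
    exact (C.not_dvd_one ((h l hl).uniq (h1 l)) (by norm_num)).elim
  · by_cases hj : j' = j
    · subst hj; exact ⟨y, hy, g, hg, hr⟩
    · have := hc j'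
      rw [if_pos rfl] at this
      exact (C.not_dvd_one ((h j' hj).uniq this) (by norm_num)).elim

theorem ray_seg {y w : ι → ℝ} {j : ι} {g : ℕ} (hg : 2 ≤ g) (h : Ray y j g w) : OnSeg y w j := by
  have hg' : (2:ℝ) ≤ g := by exact_mod_cast hg
  refine ⟨1 / g, by positivity, by rw [div_lt_one] <;> linarith, ?_⟩
  rw [Ray] at h
  rw [h]; funext i; simp; field_simp; ring

theorem ray_pred {y z : ι → ℝ} {j : ι} {g : ℕ} (hg : 1 ≤ g) (h : Ray y j g (z + y - ev j)) :
    Ray y j (g - 1) z := by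
  rw [Ray] at h ⊢
  have : z = (z + y - ev j) - y + ev j := by abel
  rw [this, h]
  push_cast [Nat.cast_sub hg]
  funext i; simp; ring

theorem Cfg.Y_unique (C : Cfg d k L Bx S) (hk : 1 ≤ k) {y y' : ι → ℝ} {j : ι} (hy : InY S y j)
    (hy' : InY S y' j) : y = y' := by
  classical
  by_contra hne
  obtain ⟨l, hl⟩ := C.exists_ne j
  set F := S.filter (fun y => InY S y j) with hF
  have mF : ∀ {y}, InY S y j → y ∈ F := fun h => Finset.mem_filter.2 ⟨h.1, h⟩
  have Fm : ∀ {y}, y ∈ F → InY S y j := fun h => (Finset.mem_filter.1 h).2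
  obtain ⟨a, haF, hamin⟩ := Finset.exists_min_image F (fun u => u l) ⟨y, mF hy⟩
  have hne2 : (F.erase a).Nonempty := by
    by_cases h : y = a
    · exact ⟨y', Finset.mem_erase.2 ⟨by rw [← h]; exact fun h => hne h.symm, mF hy'⟩⟩
    · exact ⟨y, Finset.mem_erase.2 ⟨h, mF hy⟩⟩
  obtain ⟨b, hbF, hbmin⟩ := Finset.exists_min_image (F.erase a) (fun u => u l) hne2
  obtain ⟨hba, hbF⟩ := Finset.mem_erase.1 hbF
  have ha := Fm haF
  have hb := Fm hbF
  have hu : b + a - ev j ∈ S := C.comb_mem hb.1 ha.1 (by linarith [ha.2.1, hb.2.1])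
  have hty : ∀ i, i ≠ j → Cg d Bx.card (b + a - ev j) i 2 := by
    intro i hi
    have := C.cg_comb (j := j) (C.res_one hb.1 (hb.no_seg C) i) (C.res_one ha.1 (ha.no_seg C) i)
    rw [if_neg hi] at this
    simpa using this
  obtain ⟨c, hc, g, hg, hr⟩ := C.type_two hu hty
  have hg' : (2:ℝ) ≤ g := by exact_mod_cast hg
  have hca : c = a := by
    by_contra hca
    have h1 := hbmin c (Finset.mem_erase.2 ⟨hca, mF hc⟩)
    have h2 := hamin b hbF
    have h3 := congrFun hr l
    rw [seg_ne _ _ hl] at h3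
    simp [ev_ne hl] at h3
    have : b l = a l := by
      nlinarith [C.Spos hc.1 l]
    exact hba (C.coord_inj hk (C.S_sub hb.1) (C.S_sub ha.1) this)
  subst hca
  have hr' := ray_pred (by omega) hr
  by_cases h2 : g = 2
  · subst h2
    rw [Ray] at hr'
    apply hba
    rw [hr']; simp
  · exact hb.2.2 c hc.1 (ray_seg (by omega) hr')

theorem Cfg.on_ray (C : Cfg d k L Bx S) (hk : 1 ≤ k) {y z : ι → ℝ} {j : ι} (hy : InY S y j)
    (hz : z ∈ S) (hu : z + y - ev j ∈ S) : ∃ g : ℕ, 1 ≤ g ∧ Ray y j g z := by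
  have hd := C.hd
  have cy := C.res_one hy.1 (hy.no_seg C)
  have fin : ∀ y', InY S y' j → ∀ g : ℕ, 2 ≤ g → Ray y' j g (z + y - ev j) →
      ∃ g : ℕ, 1 ≤ g ∧ Ray y j g z := by
    intro y' hy' g hg hr
    have := C.Y_unique hk hy' hy
    subst this
    exact ⟨g - 1, by omega, ray_pred (by omega) hr⟩
  rcases C.tri hz with h1 | ⟨j', y', g, hy', hg, hr, hc⟩
  · obtain ⟨y', hy', g, hg, hr⟩ := C.type_two hu (j := j) (by
      intro l hl
      have := C.cg_comb (j := j) (h1 l) (cy l)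
      rw [if_neg hl] at this
      simpa using this)
    exact fin y' hy' g hg hr
  · by_cases hj : j' = j
    · subst hj
      have := C.Y_unique hk hy' hy
      subst this
      exact ⟨g, by omega, hr⟩
    rcases C.tri hu with h1 | ⟨i, y'', g', hy'', hg', hr', hc'⟩
    · have h2 := C.cg_comb (j := j) (hc j') (cy j')
      rw [if_pos rfl, if_neg hj] at h2
      exact (C.not_dvd_one (h2.uniq (h1 j')) (by norm_num)).elim
    · by_cases hi : i = j
      · subst hi; exact fin y'' hy'' g' hg' hr'
      exfalso
      by_cases hi' : i = j'
      · subst hi'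
        have h2 := C.cg_comb (j := j) (hc i) (cy i)
        rw [if_pos rfl, if_neg hj] at h2
        have h3 := hc' i
        rw [if_pos rfl] at h3
        exact C.not_dvd_one (h2.uniq h3) (by norm_num)
      obtain ⟨m, hm⟩ : ∃ m, m ∉ ({j, j', i} : Finset ι) := by
        by_contra hc
        push Not at hc
        have : (Finset.univ : Finset ι) ⊆ {j, j', i} := fun x _ => hc x
        have h2 := Finset.card_le_card this
        have h3 := Finset.card_le_three (a := j) (b := j') (c := i)
        rw [Finset.card_univ, C.hι] at h2
        omega
      simp only [Finset.mem_insert, Finset.mem_singleton, not_or] at hm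
      obtain ⟨m1, m2, m3⟩ := hm
      have a1 := C.cg_comb (j := j) (hc j) (cy j)
      have a2 := C.cg_comb (j := j) (hc m) (cy m)
      rw [if_pos rfl, if_neg (Ne.symm hj)] at a1
      rw [if_neg m1, if_neg m2] at a2
      have b1 := hc' j
      have b2 := hc' m
      rw [if_neg (Ne.symm hi)] at b1
      rw [if_neg m3] at b2
      exact C.not_dvd_one (dvd_sub (a1.uniq b1) (a2.uniq b2)) (by right; ring)

theorem Cfg.off_vertex (C : Cfg d k L Bx S) (hk : 1 ≤ k) {y z : ι → ℝ} {j l : ι} (hy : InY S y j)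
    (hz : z ∈ S) (hl : l ≠ j) : z + y - ev l ∉ S := by
  intro hu
  have h1 := C.comb_gt hu
  have h2 : y j + y l ≤ 1 := by
    rw [← C.Ssum hy.1, ← Finset.sum_pair hl.symm]
    exact Finset.sum_le_sum_of_subset_of_nonneg (Finset.subset_univ _) fun i _ _ => (C.Spos hy.1 i).le
  have h3 := hy.2.1
  obtain ⟨y', hy', g, hg, hr⟩ : ∃ y', InY S y' l ∧ ∃ g : ℕ, 1 ≤ g ∧ Ray y' l g z := by
    by_cases h : ∃ u ∈ S, OnSeg u z l
    · obtain ⟨u, hu, hs⟩ := h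
      obtain ⟨y', hy', g, hg, hr⟩ := C.ray_of_seg hu hz hs
      exact ⟨y', hy', g, by omega, hr⟩
    · push Not at h
      exact ⟨z, ⟨hz, by linarith, h⟩, 1, le_refl _, by simp [Ray]⟩
  have hg' : (1:ℝ) ≤ g := by exact_mod_cast hg
  have h4 : z l ≤ y' l := by
    rw [Ray] at hr
    rw [hr, seg_self]
    nlinarith [C.Slt hy'.1 l]
  obtain ⟨g', hg1, hr1⟩ := C.on_ray hk hy' hy.1 (C.comb_mem hy.1 hy'.1 (by linarith))
  by_cases hg2 : g' = 1
  · subst hg2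
    have : y = y' := by rw [Ray] at hr1; rw [hr1]; simp
    subst this
    linarith [hy'.2.1]
  · exact hy.no_seg C y' hy'.1 l (ray_seg (by omega) hr1)

theorem Cfg.caseA (C : Cfg d k L Bx S) (hk : 1 ≤ k) (h : ∀ w ∈ S, ∀ u ∈ S, ∀ j, ¬ OnSeg u w j) :
    k = 1 := by
  classical
  have hd := C.hd
  have hN := C.N_eq
  have hres : ∀ w ∈ S, ∀ i, Cg d Bx.card w i 1 := fun w hw => C.res_one hw (h w hw)
  have hbd : ∀ y ∈ S, ∀ i, (Bx.card:ℝ) * y i ≤ k := by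
    intro y hy i
    have := C.lemK hk hy i S (Finset.Subset.refl _) (by
      intro z hz l hu
      obtain ⟨m, hm⟩ := C.exists_ne l
      have h2 := C.cg_comb (j := l) (hres z hz m) (hres y hy m)
      rw [if_neg hm] at h2
      exact C.not_dvd_one (h2.uniq (hres _ hu m)) (by norm_num))
    rw [C.hk] at this
    linarith
  have key : ∀ x ∈ S, ∀ i, (Bx.card:ℝ) * x i = 1 → ∀ l, l ≠ i → (Bx.card:ℝ) * x l = k := by
    intro x hx i hi l hl
    have h1 : ∑ l ∈ Finset.univ.erase i, ((k:ℝ) - Bx.card * x l) = 0 := by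
      rw [Finset.sum_sub_distrib, ← Finset.mul_sum, Finset.sum_const,
        Finset.card_erase_of_mem (Finset.mem_univ _), Finset.card_univ, C.hι]
      have := C.Ssum hx
      rw [← Finset.add_sum_erase _ _ (Finset.mem_univ i)] at this
      have e : ∑ l ∈ Finset.univ.erase i, x l = 1 - x i := by linarith
      rw [e]
      simp
      linarith
    rw [Finset.sum_eq_zero_iff_of_nonneg (fun l _ => by linarith [hbd x hx l])] at h1
    linarith [h1 l (Finset.mem_erase.2 ⟨hl, Finset.mem_univ l⟩)]
  obtain ⟨a, b, c, hab, hac, hbc⟩ : ∃ a b c : ι, a ≠ b ∧ a ≠ c ∧ b ≠ c :=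
    Fintype.two_lt_card_iff.1 (by rw [C.hι]; omega)
  obtain ⟨x, hx, hx1⟩ := C.exists_one hk b
  obtain ⟨x', hx', hx1'⟩ := C.exists_one hk c
  have e1 := key x hx b hx1 a hab
  have e2 := key x' hx' c hx1' a hac
  have : x a = x' a := mul_left_cancel₀ C.Npos.ne' (e1.trans e2.symm)
  have := C.coord_inj hk (C.S_sub hx) (C.S_sub hx') this
  subst this
  have e3 := key x hx b hx1 c hbc.symm
  rw [hx1'] at e3
  exact_mod_cast e3.symm

theorem arith_aux (d m q : ℕ) (hd : 3 ≤ d) (hm : 2 ≤ m)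
    (h : (m:ℝ) * (1 + ((d:ℝ) - 1) * (q + 1)) < d * (m + q) + 1) : q = 0 := by
  obtain ⟨e, rfl⟩ : ∃ e, d = e + 3 := ⟨d - 3, by omega⟩
  obtain ⟨n, rfl⟩ : ∃ n, m = n + 2 := ⟨m - 2, by omega⟩
  by_contra hq
  have hq : (1:ℝ) ≤ q := by exact_mod_cast Nat.one_le_iff_ne_zero.2 hq
  push_cast at h
  have he : (0:ℝ) ≤ e := by positivity
  have hn : (0:ℝ) ≤ n := by positivity
  nlinarith [mul_nonneg he hn, mul_nonneg (mul_nonneg he hn) (by linarith : (0:ℝ) ≤ q),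
    mul_nonneg he (by linarith : (0:ℝ) ≤ q), mul_nonneg hn (by linarith : (0:ℝ) ≤ q)]

theorem Cfg.final (C : Cfg d k L Bx S) (hk : 1 ≤ k) :
    ∃ j, ∃ y ∈ S, ∀ z ∈ S, ∃ t : ℝ, z = ev j + t • (y - ev j) := by
  classical
  have hd := C.hd
  by_cases h : ∀ w ∈ S, ∀ u ∈ S, ∀ j, ¬ OnSeg u w j
  · have h1 := C.caseA hk h
    have h2 : S.card = 1 := by rw [C.hk, h1]
    obtain ⟨y, hy⟩ := Finset.card_eq_one.1 h2
    obtain ⟨j⟩ : Nonempty ι := by rw [← Fintype.card_pos_iff, C.hι]; omega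
    refine ⟨j, y, by simp [hy], fun z hz => ⟨1, ?_⟩⟩
    rw [hy, Finset.mem_singleton] at hz
    subst hz; simp
  push Not at h
  obtain ⟨w, hw, u, hu, j, hj⟩ := h
  obtain ⟨y, hy, -⟩ := C.ray_of_seg hu hw hj
  refine ⟨j, y, hy.1, ?_⟩
  set ray := S.filter (fun z => ∃ g : ℕ, 1 ≤ g ∧ Ray y j g z) with hray
  have hyr : y ∈ ray := Finset.mem_filter.2 ⟨hy.1, 1, le_refl _, by simp [Ray]⟩
  have hyy : y + y - ev j ∈ S := C.comb_mem hy.1 hy.1 (by linarith [hy.2.1])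
  have hyyr : y + y - ev j ∈ ray := Finset.mem_filter.2 ⟨hyy, 2, by norm_num, by
    rw [Ray]; funext i; simp; ring⟩
  have ylt := C.Slt hy.1 j
  have hm2 : 2 ≤ ray.card := by
    have : ({y, y + y - ev j} : Finset (ι → ℝ)) ⊆ ray := by
      intro z hz
      rcases Finset.mem_insert.1 hz with rfl | hz
      · exact hyr
      · rw [Finset.mem_singleton.1 hz]; exact hyyr
    have h2 := Finset.card_le_card this
    rwa [Finset.card_pair] at h2
    intro he
    have := congrFun he j
    simp [ev_self] at this
    linarith
  obtain ⟨la, hla, hmin⟩ := Finset.exists_min_image ray (fun z => z j) ⟨y, hyr⟩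
  obtain ⟨hlaS, g, hg1, hg⟩ := Finset.mem_filter.1 hla
  have hmg : ray.card ≤ g := by
    have : ray ⊆ (Finset.Icc 1 g).image (fun g : ℕ => ev j + (g:ℝ) • (y - ev j)) := by
      intro z hz
      obtain ⟨hzS, n, hn1, hn⟩ := Finset.mem_filter.1 hz
      refine Finset.mem_image.2 ⟨n, Finset.mem_Icc.2 ⟨hn1, ?_⟩, hn.symm⟩
      have h1 := hmin z hz
      rw [Ray] at hn hg
      simp only [hn, hg, seg_self] at h1
      have : (n:ℝ) ≤ g := by nlinarith
      exact_mod_cast this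
    have h2 := (Finset.card_le_card this).trans Finset.card_image_le
    simpa using h2
  set q := (S \ ray).card with hq
  have hkq : ray.card + q = k := by
    rw [← C.hk, hq, add_comm]
    exact Finset.card_sdiff_add_card_eq_card (Finset.filter_subset _ _)
  have hK := C.lemK hk hy.1 j (insert la (S \ ray)) (by
      intro z hz
      rcases Finset.mem_insert.1 hz with rfl | hz
      · exact hlaS
      · exact (Finset.mem_sdiff.1 hz).1) (by
      intro z hz l hu
      have hzS : z ∈ S := by
        rcases Finset.mem_insert.1 hz with rfl | hz
        · exact hlaS
        · exact (Finset.mem_sdiff.1 hz).1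
      by_cases hl : l = j
      · subst hl
        obtain ⟨n, hn1, hn⟩ := C.on_ray hk hy hzS hu
        rcases Finset.mem_insert.1 hz with rfl | hz
        · have hmem : z + y - ev l ∈ ray := Finset.mem_filter.2 ⟨hu, g + 1, by omega, by
            rw [Ray] at hg ⊢
            rw [hg]; funext i; simp; ring⟩
          have := hmin _ hmem
          simp [ev_self] at this
          linarith
        · exact (Finset.mem_sdiff.1 hz).2 (Finset.mem_filter.2 ⟨hzS, n, hn1, hn⟩)
      · exact C.off_vertex hk hy hzS hl hu)
  rw [Finset.card_insert_of_notMem (fun h => (Finset.mem_sdiff.1 h).2 hla), ← hq] at hK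
  have hN := C.N_eq
  have hq0 : q = 0 := by
    apply arith_aux d ray.card q hd hm2
    have h1 := C.Spos hlaS j
    rw [Ray] at hg
    rw [hg, seg_self] at h1
    have hNp := C.Npos
    have hmg' : (ray.card:ℝ) ≤ g := by exact_mod_cast hmg
    have hkq' : (k:ℝ) = ray.card + q := by rw [← hkq]; push_cast; ring
    have e1 : (ray.card:ℝ) * (1 + ((d:ℝ) - 1) * (q + 1)) ≤ ray.card * (Bx.card - Bx.card * y j) := by
      push_cast at hK
      exact mul_le_mul_of_nonneg_left hK (by positivity)
    have e2 : (ray.card:ℝ) * (Bx.card - Bx.card * y j) ≤ g * (Bx.card - Bx.card * y j) := by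
      apply mul_le_mul_of_nonneg_right hmg'
      nlinarith
    have e3 : (g:ℝ) * (Bx.card - Bx.card * y j) < Bx.card := by nlinarith
    rw [← hkq', ← hN]
    linarith
  intro z hz
  have : S \ ray = ∅ := Finset.card_eq_zero.1 (hq ▸ hq0)
  have hzr : z ∈ ray := (Finset.sdiff_eq_empty_iff_subset.1 this) hz
  obtain ⟨-, n, -, hn⟩ := Finset.mem_filter.1 hzr
  exact ⟨n, hn⟩

end

def cornerS (n : ℕ) (r : ℝ) : Set (Fin n → ℝ) := {x | (∀ i, 0 ≤ x i) ∧ ∑ i, x i ≤ r}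

theorem cornerS_vol (n : ℕ) : ∀ r : ℝ, 0 ≤ r →
    volume (cornerS n r) = ENNReal.ofReal (r ^ n / (n.factorial : ℝ)) := by
  induction n with
  | zero =>
    intro r hr
    have : cornerS 0 r = Set.univ := by
      ext x; simp [cornerS, hr]
    rw [this, volume_pi, Measure.pi_of_empty]
    simp
  | succ n ih =>
    intro r hr
    have hp := volume_preserving_piFinSuccAbove (fun _ : Fin (n+1) => ℝ) 0
    set Q : Set (ℝ × (Fin n → ℝ)) := {q | 0 ≤ q.1 ∧ (∀ i, 0 ≤ q.2 i) ∧ q.1 + ∑ i, q.2 i ≤ r} with hQ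
    have hQm : MeasurableSet Q := by
      apply IsClosed.measurableSet
      have : Q = {q | 0 ≤ q.1} ∩ ((⋂ i, {q | 0 ≤ q.2 i}) ∩ {q | q.1 + ∑ i, q.2 i ≤ r}) := by
        ext q; simp [hQ]
      rw [this]
      refine IsClosed.inter (isClosed_le continuous_const continuous_fst) (IsClosed.inter
        (isClosed_iInter fun i => isClosed_le continuous_const (by fun_prop))
        (isClosed_le (by fun_prop) continuous_const))
    have h1 : cornerS (n+1) r = (MeasurableEquiv.piFinSuccAbove (fun _ : Fin (n+1) => ℝ) 0) ⁻¹' Q := by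
      ext x
      simp only [cornerS, hQ, Set.mem_ofPred_eq, Set.mem_preimage, MeasurableEquiv.piFinSuccAbove_apply]
      rw [Fin.forall_fin_succ, Fin.sum_univ_succ]
      simp [Fin.insertNthEquiv, Fin.tail, and_assoc]
    rw [h1, hp.measure_preimage hQm.nullMeasurableSet, Measure.volume_eq_prod, Measure.prod_apply hQm]
    have h2 : ∀ a : ℝ, volume (Prod.mk a ⁻¹' Q) =
        (Set.Icc 0 r).indicator (fun a => ENNReal.ofReal ((r - a) ^ n / (n.factorial : ℝ))) a := by
      intro a
      by_cases ha : a ∈ Set.Icc 0 r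
      · rw [Set.indicator_of_mem ha, ← ih (r - a) (by linarith [ha.2])]
        congr 1
        ext x
        simp only [hQ, cornerS, Set.mem_preimage, Set.mem_ofPred_eq]
        constructor
        · rintro ⟨_, h, h'⟩; exact ⟨h, by linarith⟩
        · rintro ⟨h, h'⟩; exact ⟨ha.1, h, by linarith⟩
      · rw [Set.indicator_of_notMem ha]
        have : Prod.mk a ⁻¹' Q = ∅ := by
          ext x
          simp only [hQ, Set.mem_preimage, Set.mem_ofPred_eq, Set.mem_empty_iff_false, iff_false]
          rintro ⟨h0, h, h'⟩
          exact ha ⟨h0, by linarith [Finset.sum_nonneg fun i (_ : i ∈ Finset.univ) => h i]⟩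
        rw [this]; simp
    simp_rw [h2]
    rw [lintegral_indicator measurableSet_Icc, ← ofReal_integral_eq_lintegral_ofReal]
    · congr 1
      rw [integral_Icc_eq_integral_Ioc, ← intervalIntegral.integral_of_le hr,
        intervalIntegral.integral_div]
      have : ∫ x in (0:ℝ)..r, (r - x) ^ n = r ^ (n+1) / (n+1) := by
        rw [intervalIntegral.integral_comp_sub_left (fun x => x ^ n) r]
        simp
      rw [this, Nat.factorial_succ]
      push_cast
      field_simp
    · exact (Continuous.integrableOn_Icc (by fun_prop))
    · refine (ae_restrict_iff' measurableSet_Icc).2 (Filter.Eventually.of_forall fun a ha => ?_)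
      have : 0 ≤ r - a := by linarith [ha.2]
      show (0:ℝ) ≤ _
      positivity

def vr {d : ℕ} (v : Fin (d+1) → Fin d → ℤ) (i : Fin (d+1)) : Fin d → ℝ := fun j => ((v i j : ℤ) : ℝ)

def aB {d : ℕ} (v : Fin (d+1) → Fin d → ℤ) (h : AffineIndependent ℝ (vr v)) :
    AffineBasis (Fin (d+1)) ℝ (Fin d → ℝ) :=
  ⟨vr v, h, (h.affineSpan_eq_top_iff_card_eq_finrank_add_one).2 (by simp)⟩

def ptv {d : ℕ} (v : Fin (d+1) → Fin d → ℤ) (p : Fin (d+1) → ℝ) : Fin d → ℝ := ∑ i, p i • vr v i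

theorem ptv_apply {d : ℕ} (v : Fin (d+1) → Fin d → ℤ) (p : Fin (d+1) → ℝ) (j : Fin d) :
    ptv v p j = ∑ i, p i * (v i j : ℝ) := by
  simp [ptv, vr, Finset.sum_apply]

theorem coord_ptv {d : ℕ} (v : Fin (d+1) → Fin d → ℤ) (h : AffineIndependent ℝ (vr v))
    (p : Fin (d+1) → ℝ) (hp : ∑ i, p i = 1) (i : Fin (d+1)) : (aB v h).coord i (ptv v p) = p i := by
  have h1 := (aB v h).coord_apply_combination_of_mem (Finset.mem_univ i) hp
  rw [Finset.univ.affineCombination_eq_linear_combination _ _ hp] at h1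
  exact h1

theorem ptv_coord {d : ℕ} (v : Fin (d+1) → Fin d → ℤ) (h : AffineIndependent ℝ (vr v))
    (x : Fin d → ℝ) : ptv v (fun i => (aB v h).coord i x) = x :=
  (aB v h).linear_combination_coord_eq_self x

def latL {d : ℕ} (v : Fin (d+1) → Fin d → ℤ) : AddSubgroup (Fin (d+1) → ℝ) where
  carrier := {p | (∃ z : ℤ, ∑ i, p i = z) ∧ ∀ j, ∃ z : ℤ, ptv v p j = z}
  zero_mem' := ⟨⟨0, by simp⟩, fun j => ⟨0, by simp [ptv_apply]⟩⟩
  add_mem' := by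
    rintro a b ⟨⟨x, hx⟩, ha⟩ ⟨⟨y, hy⟩, hb⟩
    refine ⟨⟨x + y, by simp [Finset.sum_add_distrib, hx, hy]⟩, fun j => ?_⟩
    obtain ⟨z, hz⟩ := ha j
    obtain ⟨w, hw⟩ := hb j
    refine ⟨z + w, ?_⟩
    rw [ptv_apply] at *
    push_cast
    rw [← hz, ← hw, ← Finset.sum_add_distrib]
    exact Finset.sum_congr rfl fun i _ => by simp; ring
  neg_mem' := by
    rintro a ⟨⟨x, hx⟩, ha⟩
    refine ⟨⟨-x, by simp [hx]⟩, fun j => ?_⟩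
    obtain ⟨z, hz⟩ := ha j
    refine ⟨-z, ?_⟩
    rw [ptv_apply] at *
    push_cast
    rw [← hz, ← Finset.sum_neg_distrib]
    exact Finset.sum_congr rfl fun i _ => by simp

theorem mem_latL {d : ℕ} {v : Fin (d+1) → Fin d → ℤ} {p : Fin (d+1) → ℝ} :
    p ∈ latL v ↔ (∃ z : ℤ, ∑ i, p i = z) ∧ ∀ j, ∃ z : ℤ, ptv v p j = z := Iff.rfl

def Dz {d : ℕ} (v : Fin (d+1) → Fin d → ℤ) : Matrix (Fin d) (Fin d) ℤ :=
  Matrix.of fun i j => v i.succ j - v 0 j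

def Dr {d : ℕ} (v : Fin (d+1) → Fin d → ℤ) : Matrix (Fin d) (Fin d) ℝ :=
  (Dz v).map (Int.castRingHom ℝ)

theorem Dr_det {d : ℕ} (v : Fin (d+1) → Fin d → ℤ) : (Dr v).det = ((Dz v).det : ℝ) := by
  rw [Dr]
  have := (Int.castRingHom ℝ).map_det (Dz v)
  rw [eq_intCast] at this
  rw [this]; rfl

theorem vecMul_Dr {d : ℕ} (v : Fin (d+1) → Fin d → ℤ) (c : Fin d → ℝ) (j : Fin d) :
    Matrix.vecMul c (Dr v) j = ∑ i, c i * ((v i.succ j : ℝ) - v 0 j) := by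
  simp [Matrix.vecMul, dotProduct, Dr, Dz]

theorem ptv_split {d : ℕ} (v : Fin (d+1) → Fin d → ℤ) (p : Fin (d+1) → ℝ) (j : Fin d) :
    ptv v p j = (∑ i, p i) * v 0 j + Matrix.vecMul (fun i : Fin d => p i.succ) (Dr v) j := by
  rw [ptv_apply, vecMul_Dr, Fin.sum_univ_succ, Fin.sum_univ_succ]
  simp_rw [mul_sub]
  rw [Finset.sum_sub_distrib, ← Finset.sum_mul]; ring

theorem Dr_inj {d : ℕ} (v : Fin (d+1) → Fin d → ℤ) (h : AffineIndependent ℝ (vr v)) {c : Fin d → ℝ}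
    (hc : Matrix.vecMul c (Dr v) = 0) : c = 0 := by
  let p : Fin (d+1) → ℝ := Fin.cons (1 - ∑ i, c i) c
  let p0 : Fin (d+1) → ℝ := Fin.cons 1 0
  have hp : ∑ i, p i = 1 := by simp [p, Fin.sum_univ_succ]
  have hp0 : ∑ i, p0 i = 1 := by simp [p0, Fin.sum_univ_succ]
  have e : ptv v p = ptv v p0 := by
    funext j
    rw [ptv_split, ptv_split, hp, hp0]
    have a1 : (fun i : Fin d => p i.succ) = c := by funext i; simp [p]
    have a2 : (fun i : Fin d => p0 i.succ) = 0 := by funext i; simp [p0]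
    rw [a1, a2, hc]; simp
  funext i
  have h1 := coord_ptv v h p hp i.succ
  rw [e, coord_ptv v h p0 hp0] at h1
  simp [p, p0] at h1
  simp [← h1]

theorem Dr_det_ne {d : ℕ} (v : Fin (d+1) → Fin d → ℤ) (h : AffineIndependent ℝ (vr v)) :
    (Dr v).det ≠ 0 := by
  intro h0
  obtain ⟨c, hc, hc0⟩ := Matrix.exists_vecMul_eq_zero_iff.2 h0
  exact hc (Dr_inj v h hc0)

theorem vol_simplex {d : ℕ} (v : Fin (d+1) → Fin d → ℤ) (h : AffineIndependent ℝ (vr v)) :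
    volume (convexHull ℝ (Set.range (vr v))) =
      ENNReal.ofReal |((Dz v).det : ℝ)| * ENNReal.ofReal (1 / (d.factorial : ℝ)) := by
  have h1 : convexHull ℝ (Set.range (vr v)) =
      (fun x => vr v 0 + x) '' (Matrix.toLin' (Dr v).transpose '' cornerS d 1) := by
    have hc : convexHull ℝ (Set.range (vr v)) = { x | ∀ i, 0 ≤ (aB v h).coord i x } :=
      (aB v h).convexHull_eq_nonneg_coord
    rw [hc, Set.image_image]
    ext x
    constructor
    · intro hx
      set p := fun i => (aB v h).coord i x with hp
      have hp1 : ∑ i, p i = 1 := (aB v h).sum_coord_apply_eq_one x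
      refine ⟨fun i => p i.succ, ⟨fun i => hx i.succ, ?_⟩, ?_⟩
      · rw [Fin.sum_univ_succ] at hp1
        have := hx 0
        show ∑ i : Fin d, p i.succ ≤ 1
        have h3 : 0 ≤ p 0 := hx 0
        linarith
      · rw [← ptv_coord v h x]
        funext j
        rw [ptv_split, hp1]
        beta_reduce
        rw [Pi.add_apply, Matrix.toLin'_apply, Matrix.mulVec_transpose]
        simp [vr, hp]
    · rintro ⟨c, ⟨hc0, hc1⟩, rfl⟩ i
      let p : Fin (d+1) → ℝ := Fin.cons (1 - ∑ i, c i) c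
      have hp : ∑ i, p i = 1 := by simp [p, Fin.sum_univ_succ]
      have e : vr v 0 + Matrix.toLin' (Dr v).transpose c = ptv v p := by
        funext j
        rw [ptv_split, hp, Matrix.toLin'_apply, Matrix.mulVec_transpose]
        simp [vr, p]
      simp only [e]
      rw [coord_ptv v h p hp]
      refine Fin.cases ?_ (fun i => ?_) i
      · simp [p]; exact hc1
      · simp [p]; exact hc0 i
  rw [h1, Set.image_add_left, measure_preimage_add, Measure.addHaar_image_linearMap,
    LinearMap.det_toLin', Matrix.det_transpose, Dr_det, cornerS_vol d 1 zero_le_one, one_pow]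

theorem box_card {d : ℕ} (v : Fin (d+1) → Fin d → ℤ) (h : AffineIndependent ℝ (vr v)) :
    {p : Fin (d+1) → ℝ | p ∈ latL v ∧ ∀ i, 0 ≤ p i ∧ p i < 1}.Finite ∧
    {p : Fin (d+1) → ℝ | p ∈ latL v ∧ ∀ i, 0 ≤ p i ∧ p i < 1}.ncard = (Dz v).det.natAbs := by
  set B := {p : Fin (d+1) → ℝ | p ∈ latL v ∧ ∀ i, 0 ≤ p i ∧ p i < 1} with hB
  have hdr := Dr_det_ne v h
  have hdz : (Dz v).det ≠ 0 := by
    intro h0; rw [Dr_det, h0] at hdr; simp at hdr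
  have hli : LinearIndependent ℤ (fun i => Dz v i) :=
    Matrix.linearIndependent_rows_of_det_ne_zero hdz
  let M := Submodule.span ℤ (Set.range (fun i => Dz v i))
  have hM : (Dz v).det.natAbs = Nat.card ((Fin d → ℤ) ⧸ M) := by
    rw [← Submodule.natAbs_det_basis_change (Pi.basisFun ℤ (Fin d)) M (Module.Basis.span hli)]
    congr 1
    rw [Pi.basisFun_det_apply]
    congr 1
    ext i j
    exact (congrFun (congrArg Subtype.val (Module.Basis.span_apply hli i)) j).symm
  have hmemM : ∀ z : Fin d → ℤ, z ∈ M ↔ ∃ c : Fin d → ℤ,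
      Matrix.vecMul (fun i => (c i : ℝ)) (Dr v) = fun j => (z j : ℝ) := by
    intro z
    rw [Submodule.mem_span_range_iff_exists_fun]
    refine exists_congr fun c => ?_
    rw [funext_iff, funext_iff]
    refine forall_congr' fun j => ?_
    rw [vecMul_Dr]
    simp only [Finset.sum_apply, Pi.smul_apply, smul_eq_mul, Dz, Matrix.of_apply]
    rw [← Int.cast_inj (α := ℝ)]
    push_cast
    exact Iff.rfl
  have hz : ∀ p : B, ∃ z : Fin d → ℤ,
      Matrix.vecMul (fun i : Fin d => p.1 i.succ) (Dr v) = fun j => (z j : ℝ) := by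
    rintro ⟨p, hp, -⟩
    obtain ⟨⟨s, hs⟩, hj⟩ := mem_latL.1 hp
    choose w hw using hj
    refine ⟨fun j => w j - s * v 0 j, ?_⟩
    funext j
    have := ptv_split v p j
    rw [hw, hs] at this
    push_cast
    linarith
  choose zf hzf using hz
  let G : B → (Fin d → ℤ) ⧸ M := fun p => Submodule.Quotient.mk (zf p)
  have hbij : Function.Bijective G := by
    constructor
    · intro p p' hpp
      have h1 := (Submodule.Quotient.eq M).1 hpp
      obtain ⟨c, hc⟩ := (hmemM _).1 h1
      have h2 : (fun i : Fin d => p.1 i.succ) - (fun i : Fin d => p'.1 i.succ) - (fun i => (c i:ℝ)) = 0 := by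
        apply Dr_inj v h
        rw [Matrix.sub_vecMul, Matrix.sub_vecMul, hzf, hzf, hc]
        funext j; simp
      have h3 : p.1 - p'.1 ∈ intVec (Fin (d+1)) := by
        obtain ⟨s, hs⟩ := p.2.1.1
        obtain ⟨s', hs'⟩ := p'.2.1.1
        have h4 : ∀ i : Fin d, p.1 i.succ = p'.1 i.succ + c i := by
          intro i; have := congrFun h2 i; simp at this; linarith
        rw [mem_intVec]
        refine Fin.cases ?_ (fun i => ⟨c i, by simp [h4]⟩)
        refine ⟨s - s' - ∑ i, c i, ?_⟩
        rw [Fin.sum_univ_succ] at hs hs'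
        rw [Finset.sum_congr rfl fun i _ => h4 i, Finset.sum_add_distrib] at hs
        simp only [Pi.sub_apply]
        push_cast
        linarith
      have h5 := fr_eq_fr.2 h3
      rw [fr_eq_self p.2.2, fr_eq_self p'.2.2] at h5
      exact Subtype.ext h5
    · intro q
      obtain ⟨z, rfl⟩ := Submodule.Quotient.mk_surjective M q
      set c : Fin d → ℝ := Matrix.vecMul (fun j => (z j : ℝ)) (Dr v)⁻¹ with hc
      have hcz : Matrix.vecMul c (Dr v) = fun j => (z j : ℝ) := by
        rw [hc, Matrix.vecMul_vecMul, Matrix.nonsing_inv_mul _ (isUnit_iff_ne_zero.2 hdr), Matrix.vecMul_one]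
      let q : Fin (d+1) → ℝ := Fin.cons (- ∑ i, c i) c
      have hqs : ∑ i, q i = 0 := by simp [q, Fin.sum_univ_succ]
      have hq : q ∈ latL v := by
        refine mem_latL.2 ⟨⟨0, by rw [hqs]; simp⟩, fun j => ⟨z j, ?_⟩⟩
        rw [ptv_split, hqs]
        have : (fun i : Fin d => q i.succ) = c := by funext i; simp [q]
        rw [this, hcz]; simp
      have hint : q - fr q ∈ latL v := by
        have hi := sub_fr q
        choose n hn using hi
        refine mem_latL.2 ⟨⟨∑ i, n i, by push_cast; exact Finset.sum_congr rfl fun i _ => hn i⟩, fun j =>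
          ⟨∑ i, n i * v i j, ?_⟩⟩
        rw [ptv_apply]; push_cast
        exact Finset.sum_congr rfl fun i _ => by rw [hn]
      have hfr : fr q ∈ B := by
        refine ⟨?_, fun i => ⟨Int.fract_nonneg _, Int.fract_lt_one _⟩⟩
        have : fr q = q - (q - fr q) := by abel
        rw [this]; exact (latL v).sub_mem hq hint
      refine ⟨⟨fr q, hfr⟩, ?_⟩
      refine (Submodule.Quotient.eq M).2 ((hmemM _).2 ?_)
      refine ⟨fun i => - ⌊c i⌋, ?_⟩
      have e : (fun i : Fin d => ((-⌊c i⌋ : ℤ) : ℝ)) = (fun i : Fin d => fr q i.succ) - c := by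
        funext i
        have e1 : q i.succ = c i := by simp [q]
        show _ = Int.fract (q i.succ) - c i
        rw [e1]; push_cast; unfold Int.fract; ring
      rw [e, Matrix.sub_vecMul, hcz]
      have := hzf ⟨fr q, hfr⟩
      simp only at this
      rw [this]
      funext j; simp
  have hcard := Nat.card_eq_of_bijective G hbij
  rw [← hM] at hcard
  have hne : Nat.card B ≠ 0 := by rw [hcard]; exact Int.natAbs_ne_zero.2 hdz
  have := Nat.finite_of_card_ne_zero hne
  exact ⟨Set.toFinite B, hcard⟩

theorem ptv_lin {d : ℕ} (v : Fin (d+1) → Fin d → ℤ) (a b : Fin (d+1) → ℝ) (t : ℝ) :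
    ptv v (a + t • (b - a)) = ptv v a + t • (ptv v b - ptv v a) := by
  simp only [ptv, Pi.add_apply, Pi.smul_apply, Pi.sub_apply, smul_eq_mul, add_smul, mul_smul, sub_smul,
    Finset.sum_add_distrib, smul_sub, Finset.sum_sub_distrib, Finset.smul_sum]

theorem ptv_ev {d : ℕ} (v : Fin (d+1) → Fin d → ℤ) (j : Fin (d+1)) : ptv v (ev j) = vr v j := by
  simp [ptv, ev, Pi.single_apply]

theorem main_aux (d k : ℕ) (hd : 3 ≤ d) (hk : 1 ≤ k)
    (T : Set (Fin d → ℝ)) (hT : IsLatticeSimplex d T) (hclean : IsClean d T)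
    (hint : {x ∈ interior T | IsLatticePt d x}.ncard = k)
    (hvol : volume T = ((d * k + 1 : ℕ) : ℝ≥0∞) / (Nat.factorial d : ℝ≥0∞)) :
    ∃ v ∈ Set.extremePoints ℝ T, ∃ u : Fin d → ℝ, u ≠ 0 ∧
      ∀ x ∈ interior T, IsLatticePt d x → ∃ t : ℝ, x = v + t • u := by
  classical
  obtain ⟨v, hv, hTv⟩ := hT
  have hv : AffineIndependent ℝ (vr v) := hv
  have hTv : T = convexHull ℝ (Set.range (vr v)) := hTv
  have hTn : T = { x | ∀ i, 0 ≤ (aB v hv).coord i x } :=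
    hTv.trans (aB v hv).convexHull_eq_nonneg_coord
  have hTi : interior T = { x | ∀ i, 0 < (aB v hv).coord i x } := by
    rw [hTv]; exact (aB v hv).interior_convexHull
  have hText : Set.extremePoints ℝ T ⊆ Set.range (vr v) := by
    rw [hTv]; exact extremePoints_convexHull_subset
  have hfront : ∀ x, x ∈ T → x ∉ interior T → x ∈ frontier T :=
    fun x h1 h2 => ⟨subset_closure h1, h2⟩
  obtain ⟨hfin, hcard⟩ := box_card v hv
  rw [Set.ncard_eq_toFinset_card _ hfin] at hcard
  set Bx := hfin.toFinset with hBx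
  have hmemB : ∀ p, p ∈ Bx ↔ p ∈ latL v ∧ ∀ i, 0 ≤ p i ∧ p i < 1 := fun p => by simp [hBx]
  have hdet : (Dz v).det.natAbs = d * k + 1 := by
    have h1 := vol_simplex v hv
    rw [← hTv, hvol] at h1
    have h2 := congrArg ENNReal.toReal h1
    rw [ENNReal.toReal_div, ENNReal.toReal_mul, ENNReal.toReal_ofReal (abs_nonneg _),
      ENNReal.toReal_ofReal (by positivity), ENNReal.toReal_natCast, ENNReal.toReal_natCast] at h2
    have h3 : ((d * k + 1 : ℕ) : ℝ) = |((Dz v).det : ℝ)| := by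
      have : (d.factorial : ℝ) ≠ 0 := by exact_mod_cast d.factorial_ne_zero
      field_simp at h2
      exact h2
    have h4 : (((Dz v).det.natAbs : ℕ) : ℝ) = |((Dz v).det : ℝ)| := by
      rw [Nat.cast_natAbs, Int.cast_abs]
    rw [← h4] at h3
    exact_mod_cast h3.symm
  rw [hdet] at hcard
  set S := Bx.filter (fun p => (∀ i, 0 < p i) ∧ ∑ i, p i = 1) with hS
  have hlt : ∀ p : Fin (d+1) → ℝ, (∀ i, 0 < p i) → ∑ i, p i = 1 → ∀ i, p i < 1 := by
    intro p h0 h1 i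
    have : Nontrivial (Fin (d+1)) := Fin.nontrivial_iff_two_le.2 (by omega)
    obtain ⟨j, hj⟩ := exists_ne i
    have : p i + p j ≤ ∑ i, p i := by
      rw [← Finset.sum_pair hj.symm]
      exact Finset.sum_le_sum_of_subset_of_nonneg (Finset.subset_univ _) fun i _ _ => (h0 i).le
    linarith [h0 j]
  have hmemS : ∀ p, p ∈ S ↔ p ∈ latL v ∧ (∀ i, 0 < p i) ∧ ∑ i, p i = 1 := by
    intro p
    rw [hS, Finset.mem_filter, hmemB]
    constructor
    · rintro ⟨⟨h1, _⟩, h2⟩; exact ⟨h1, h2⟩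
    · rintro ⟨h1, h2, h3⟩; exact ⟨⟨h1, fun i => ⟨(h2 i).le, hlt p h2 h3 i⟩⟩, h2, h3⟩
  have hcS : ∀ x ∈ interior T, IsLatticePt d x → (fun i => (aB v hv).coord i x) ∈ S := by
    intro x hx hl
    rw [hTi] at hx
    have hs : ∑ i, (aB v hv).coord i x = 1 := (aB v hv).sum_coord_apply_eq_one x
    refine (hmemS _).2 ⟨mem_latL.2 ⟨⟨1, by rw [hs]; simp⟩, ?_⟩, hx, hs⟩
    rw [ptv_coord]; exact hl
  have hSc : ∀ p ∈ S, ptv v p ∈ interior T ∧ IsLatticePt d (ptv v p) := by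
    intro p hp
    obtain ⟨h1, h2, h3⟩ := (hmemS p).1 hp
    refine ⟨?_, (mem_latL.1 h1).2⟩
    rw [hTi]
    intro i
    rw [coord_ptv v hv p h3]; exact h2 i
  have hSk : S.card = k := by
    have : {x ∈ interior T | IsLatticePt d x} = ptv v '' (S : Set (Fin (d+1) → ℝ)) := by
      ext x
      constructor
      · rintro ⟨h1, h2⟩
        exact ⟨_, hcS x h1 h2, ptv_coord v hv x⟩
      · rintro ⟨p, hp, rfl⟩; exact hSc p hp
    rw [this, Set.ncard_image_of_injOn, Set.ncard_coe_finset] at hint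
    · exact hint
    · intro p hp q hq hpq
      funext i
      rw [← coord_ptv v hv p ((hmemS p).1 hp).2.2, ← coord_ptv v hv q ((hmemS q).1 hq).2.2, hpq]
  have hvlat : ∀ j, IsLatticePt d (vr v j) := fun j i => ⟨v j i, rfl⟩
  have C : Cfg d k (latL v) Bx S :=
    { lat :=
        { single := fun i => by
            refine mem_latL.2 ⟨⟨1, by simp⟩, ?_⟩
            have : ptv v (Pi.single i 1) = vr v i := ptv_ev v i
            rw [this]; exact hvlat i
          sum := fun p hp => (mem_latL.1 hp).1
          mem := hmemB }
      hι := by simp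
      hd := hd
      hN := hcard
      hS := hmemS
      hclean := by
        intro p hp hs i hi
        obtain ⟨h1, h2⟩ := (hmemB p).1 hp
        have hco := coord_ptv v hv p hs
        have hxT : ptv v p ∈ T := by
          rw [hTn]; intro l; rw [hco]; exact (h2 l).1
        have hxi : ptv v p ∉ interior T := by
          rw [hTi]; intro h
          have := h i
          rw [hco, hi] at this
          exact lt_irrefl _ this
        have : ptv v p ∈ frontier T ∩ {x | IsLatticePt d x} :=
          ⟨hfront _ hxT hxi, (mem_latL.1 h1).2⟩
        rw [show frontier T ∩ {x | IsLatticePt d x} = _ from hclean] at this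
        obtain ⟨j, hj⟩ := hText this
        have h3 : (aB v hv).coord j (vr v j) = 1 := (aB v hv).coord_apply_eq j
        rw [hj, hco] at h3
        linarith [(h2 j).2]
      hk := hSk }
  obtain ⟨j, y, hy, hall⟩ := C.final hk
  have hnint : vr v j ∉ interior T := by
    rw [hTi]; intro h
    obtain ⟨l, hl⟩ := C.exists_ne j
    have h1 := h l
    have h2 : (aB v hv).coord l (vr v j) = 0 := (aB v hv).coord_apply_ne hl
    rw [h2] at h1
    exact lt_irrefl _ h1
  refine ⟨vr v j, ?_, ptv v y - vr v j, ?_, ?_⟩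
  · rw [← show frontier T ∩ {x | IsLatticePt d x} = _ from hclean]
    refine ⟨hfront _ ?_ hnint, hvlat j⟩
    rw [hTv]; exact subset_convexHull ℝ _ ⟨j, rfl⟩
  · intro h0
    rw [sub_eq_zero] at h0
    exact hnint (h0 ▸ (hSc y hy).1)
  · intro x hx hl
    obtain ⟨t, ht⟩ := hall _ (hcS x hx hl)
    refine ⟨t, ?_⟩
    rw [← ptv_ev v j, ← ptv_lin, ← ht, ptv_coord]

/-- In a minimal-volume clean `k`-point lattice `d`-simplex (`d ≥ 3`,
`k ≥ 1`), there are a vertex `v` and a line through `v` containing every interior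
lattice point. -/
theorem interior_points_on_line_through_vertex (d k : ℕ) (hd : 3 ≤ d) (hk : 1 ≤ k)
    (T : Set (Fin d → ℝ)) (hT : IsLatticeSimplex d T) (hclean : IsClean d T)
    (hint : {x ∈ interior T | IsLatticePt d x}.ncard = k)
    (hvol : volume T = ((d * k + 1 : ℕ) : ℝ≥0∞) / (Nat.factorial d : ℝ≥0∞)) :
    ∃ v ∈ Set.extremePoints ℝ T, ∃ u : Fin d → ℝ, u ≠ 0 ∧
      ∀ x ∈ interior T, IsLatticePt d x → ∃ t : ℝ, x = v + t • u := by
  exact main_aux d k hd hk T hT hclean hint hvol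
end
end

section
/- Let P ⊂ ℝ³ be a convex lattice polyhedron (the convex hull of a finite subset of ℤ³ with nonempty topological interior). Let b be the number of lattice points on the boundary of P and k the number of lattice points in the interior of P, and assume k ≥ 1. Then Vol(P) ≥ (2b + 3k − 7)/6. -/
open MeasureTheory Set
open scoped ENNReal

noncomputable section

section PickAux

open Matrix

/-- coordinates of `y` with respect to the rows of `M`. -/
def crd {n : ℕ} (M : Matrix (Fin n) (Fin n) ℝ) (y : Fin n → ℝ) : Fin n → ℝ := y ᵥ* M⁻¹

lemma crd_add {n : ℕ} (M : Matrix (Fin n) (Fin n) ℝ) (y z : Fin n → ℝ) :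
    crd M (y + z) = crd M y + crd M z := by
  simp [crd, Matrix.add_vecMul]

lemma crd_smul {n : ℕ} (M : Matrix (Fin n) (Fin n) ℝ) (a : ℝ) (z : Fin n → ℝ) :
    crd M (a • z) = a • crd M z := by
  simp [crd, Matrix.smul_vecMul]

lemma crd_neg {n : ℕ} (M : Matrix (Fin n) (Fin n) ℝ) (z : Fin n → ℝ) :
    crd M (-z) = - crd M z := by
  simp [crd, Matrix.neg_vecMul]

lemma crd_spec {n : ℕ} {M : Matrix (Fin n) (Fin n) ℝ} (hM : M.det ≠ 0) (y : Fin n → ℝ) :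
    ∑ i, crd M y i • M i = y := by
  have : crd M y ᵥ* M = y := by
    rw [crd, Matrix.vecMul_vecMul, Matrix.nonsing_inv_mul _ (isUnit_iff_ne_zero.mpr hM),
      Matrix.vecMul_one]
  rw [← Matrix.vecMul_eq_sum]
  exact this

lemma crd_of_sum {n : ℕ} {M : Matrix (Fin n) (Fin n) ℝ} (hM : M.det ≠ 0) (c : Fin n → ℝ) :
    crd M (∑ i, c i • M i) = c := by
  rw [← Matrix.vecMul_eq_sum, crd, Matrix.vecMul_vecMul,
    Matrix.mul_nonsing_inv _ (isUnit_iff_ne_zero.mpr hM), Matrix.vecMul_one]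

lemma crd_cont {n : ℕ} (M : Matrix (Fin n) (Fin n) ℝ) : Continuous (crd M) := by
  unfold crd
  fun_prop

/-- subdividing at `p`. -/
lemma det_sub {n : ℕ} {M : Matrix (Fin n) (Fin n) ℝ} (hM : M.det ≠ 0) (p : Fin n → ℝ)
    (i : Fin n) : (M.updateRow i p).det = crd M p i * M.det := by
  conv_lhs => rw [← crd_spec hM p]
  rw [Matrix.det_updateRow_sum]; rfl

lemma cover_sub {n : ℕ} {M : Matrix (Fin n) (Fin n) ℝ} (hM : M.det ≠ 0) (p x : Fin n → ℝ)
    (hp : ∃ i, 0 < crd M p i) (hx : ∀ i, 0 ≤ crd M x i) (hp0 : ∀ i, 0 ≤ crd M p i) :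
    ∃ i, 0 < crd M p i ∧ ∀ j, 0 ≤ crd (M.updateRow i p) x j := by
  classical
  obtain ⟨i, hi, hmin⟩ := Finset.exists_min_image (Finset.univ.filter fun i => 0 < crd M p i)
    (fun i => crd M x i / crd M p i) (by obtain ⟨i, hi⟩ := hp; exact ⟨i, by simpa using hi⟩)
  simp only [Finset.mem_filter, Finset.mem_univ, true_and] at hi hmin
  refine ⟨i, hi, ?_⟩
  set r := crd M x i / crd M p i with hr
  have hr0 : 0 ≤ r := div_nonneg (hx i) hi.le
  set c : Fin n → ℝ := fun j => if j = i then r else crd M x j - r * crd M p j with hc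
  have hdet : (M.updateRow i p).det ≠ 0 := by
    rw [det_sub hM]; exact mul_ne_zero hi.ne' hM
  have hxs : x = ∑ j, c j • (M.updateRow i p) j := by
    have h1 : x = r • p + ∑ j, (crd M x j - r * crd M p j) • M j := by
      have e1 : ∑ j, (r * crd M p j) • M j = r • p := by
        conv_rhs => rw [← crd_spec hM p]
        rw [Finset.smul_sum]
        exact Finset.sum_congr rfl fun j _ => mul_smul _ _ _
      have e2 : ∑ j, (crd M x j - r * crd M p j) • M j = x - r • p := by
        rw [← e1]
        conv_rhs => rw [← crd_spec hM x]
        rw [← Finset.sum_sub_distrib]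
        exact Finset.sum_congr rfl fun j _ => sub_smul _ _ _
      rw [e2]; abel
    rw [h1, ← Finset.add_sum_erase _ _ (Finset.mem_univ i),
      ← Finset.add_sum_erase _ (fun j => c j • (M.updateRow i p) j) (Finset.mem_univ i)]
    have : crd M x i - r * crd M p i = 0 := by rw [hr]; field_simp; ring
    rw [this, zero_smul, zero_add]
    congr 1
    · simp [hc]
    · apply Finset.sum_congr rfl
      intro j hj
      have hj' := Finset.ne_of_mem_erase hj
      simp [hc, hj']
  intro j
  rw [hxs, crd_of_sum hdet, hc]
  dsimp only
  split_ifs with h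
  · exact hr0
  · rcases (hp0 j).eq_or_lt with h0 | h0
    · rw [← h0]; simpa using hx j
    · have := hmin j h0
      rw [le_div_iff₀ h0] at this
      linarith

/-- homogenization -/
def hom (x : Fin 3 → ℝ) : Fin 4 → ℝ := Matrix.vecCons 1 x

lemma hom_cont : Continuous hom := by
  unfold hom
  exact Continuous.matrixVecCons continuous_const continuous_id

lemma hom_inj {x y : Fin 3 → ℝ} (h : hom x = hom y) : x = y := by
  have := congrArg Matrix.vecTail h
  simpa [hom] using this

lemma gain_aux (T : Multiset (Matrix (Fin 4) (Fin 4) ℝ)) (hdet : ∀ M ∈ T, M.det ≠ 0)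
    (c : Matrix (Fin 4) (Fin 4) ℝ → Fin 4 → ℝ)
    (hc : ∀ M ∈ T, ∀ i, 0 ≤ c M i)
    (h1 : ∀ M ∈ T, ∀ i, M i 0 = 1)
    (hr : ∀ M ∈ T, 2 ≤ (Finset.univ.filter fun i => 0 < c M i).card)
    (hloc : ∀ u : Fin 4 → ℝ, u 0 = 0 → ∃ M ∈ T, ∀ i, c M i = 0 → 0 ≤ crd M u i) :
    T.card + 3 ≤ (T.map fun M => (Finset.univ.filter fun i => 0 < c M i).card).sum := by
  classical
  -- direction existence
  have hdir : ∀ M ∈ T, ∀ d : Fin 4 → ℝ, ∑ i, d i = 0 → ∃ u : Fin 4 → ℝ, u 0 = 0 ∧ crd M u = d := by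
    intro M hM d hd
    refine ⟨∑ i, d i • M i, ?_, crd_of_sum (hdet M hM) d⟩
    simp [Finset.sum_apply, h1 M hM, hd]
  have hzero : ∀ M ∈ T, (Finset.univ.filter fun i => 0 < c M i).card +
      (Finset.univ.filter fun i => c M i = 0).card = 4 := by
    intro M hM
    have h := Finset.card_filter_add_card_filter_not (s := (Finset.univ : Finset (Fin 4)))
      (fun i => 0 < c M i)
    simp only [Finset.card_univ, Fintype.card_fin] at h
    refine Eq.trans ?_ h
    congr 2
    ext i
    have := hc M hM i
    simp only [Finset.mem_filter, Finset.mem_univ, true_and, not_lt]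
    constructor
    · intro h; linarith
    · intro h; linarith
  have hlow : ∀ R : Multiset (Matrix (Fin 4) (Fin 4) ℝ), (∀ M ∈ R, M ∈ T) →
      2 * R.card ≤ (R.map fun M => (Finset.univ.filter fun i => 0 < c M i).card).sum := by
    intro R
    induction R using Multiset.induction with
    | empty => simp
    | cons M R ih =>
      intro h
      have a1 := hr M (h M (by simp))
      have a2 := ih (fun N hN => h N (by simp [hN]))
      simp only [Multiset.card_cons, Multiset.map_cons, Multiset.sum_cons]
      omega
  by_contra hcon
  push Not at hcon
  rcases T.empty_or_exists_mem with h0 | ⟨M1, hM1⟩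
  · obtain ⟨M, hM, -⟩ := hloc 0 rfl
    simp [h0] at hM
  obtain ⟨R, hR⟩ := Multiset.exists_cons_of_mem hM1
  have hRT : ∀ M ∈ R, M ∈ T := fun M hM => by rw [hR]; simp [hM]
  have e1 := hlow R hRT
  have z1 := hzero M1 hM1
  have r1 := hr M1 hM1
  rw [hR] at hcon
  simp only [Multiset.card_cons, Multiset.map_cons, Multiset.sum_cons] at hcon
  rcases R.empty_or_exists_mem with h0 | ⟨M2, hM2⟩
  · -- single
    have : 0 < (Finset.univ.filter fun i => c M1 i = 0).card := by
      subst h0; simp at hcon; omega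
    obtain ⟨i, hi⟩ := Finset.card_pos.mp this
    simp only [Finset.mem_filter, Finset.mem_univ, true_and] at hi
    obtain ⟨u, hu0, hu⟩ := hdir M1 hM1 (fun j => if j = i then -3 else 1) (by
      fin_cases i <;> simp [Fin.sum_univ_four] <;> norm_num)
    obtain ⟨M, hM, hMi⟩ := hloc u hu0
    rw [hR, h0] at hM
    simp only [Multiset.cons_zero, Multiset.mem_singleton] at hM
    subst hM
    have := hMi i hi
    rw [hu] at this
    norm_num at this
  obtain ⟨R', hR'⟩ := Multiset.exists_cons_of_mem hM2
  have hM2T := hRT M2 hM2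
  have e2 := hlow R' (fun M hM => hRT M (by rw [hR']; simp [hM]))
  have z2 := hzero M2 hM2T
  have r2 := hr M2 hM2T
  rw [hR'] at hcon
  simp only [Multiset.card_cons, Multiset.map_cons, Multiset.sum_cons] at hcon
  have hc0 : R'.card = 0 := by omega
  rw [Multiset.card_eq_zero] at hc0
  have w1 : (Finset.univ.filter fun i => c M1 i = 0).card = 2 := by omega
  have w2 : 0 < (Finset.univ.filter fun i => c M2 i = 0).card := by omega
  obtain ⟨a, b, hab, hset⟩ := Finset.card_eq_two.mp w1
  have ha : c M1 a = 0 := by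
    have : a ∈ (Finset.univ.filter fun i => c M1 i = 0) := by rw [hset]; simp
    simpa using this
  have hb : c M1 b = 0 := by
    have : b ∈ (Finset.univ.filter fun i => c M1 i = 0) := by rw [hset]; simp
    simpa using this
  obtain ⟨e, he⟩ := Finset.card_pos.mp w2
  simp only [Finset.mem_filter, Finset.mem_univ, true_and] at he
  have hTmem : ∀ M ∈ T, M = M1 ∨ M = M2 := by
    intro M hM
    rw [hR, hR', hc0] at hM
    simpa using hM
  -- all u with opposite signs at a, b give zero for e
  have key : ∀ u : Fin 4 → ℝ, u 0 = 0 → crd M1 u a < 0 → 0 < crd M1 u b → crd M2 u e = 0 := by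
    intro u hu ua ub
    have k1 : 0 ≤ crd M2 u e := by
      obtain ⟨M, hM, hMi⟩ := hloc u hu
      rcases hTmem M hM with rfl | rfl
      · have := hMi a ha; linarith
      · exact hMi e he
    have k2 : 0 ≤ crd M2 (-u) e := by
      obtain ⟨M, hM, hMi⟩ := hloc (-u) (by simp [hu])
      rcases hTmem M hM with rfl | rfl
      · have := hMi b hb
        rw [crd_neg] at this
        simp at this; linarith
      · exact hMi e he
    rw [crd_neg] at k2
    simp at k2
    linarith
  obtain ⟨u, hu0, hu⟩ := hdir M1 hM1 (fun j => if j = a then -1 else if j = b then 1 else 0) (by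
      rw [← Finset.add_sum_erase _ _ (Finset.mem_univ a),
        ← Finset.add_sum_erase _ _ (Finset.mem_erase.mpr ⟨hab.symm, Finset.mem_univ b⟩)]
      rw [Finset.sum_eq_zero]
      · simp [hab.symm]
      · intro j hj
        simp only [Finset.mem_erase] at hj
        simp [hj.1, hj.2.1])
  obtain ⟨w, hw0, hw⟩ := hdir M2 hM2T (fun j => if j = e then -3 else 1) (by
      fin_cases e <;> simp [Fin.sum_univ_four] <;> norm_num)
  have ua : crd M1 u a = -1 := by rw [hu]; simp
  have ub : crd M1 u b = 1 := by rw [hu]; simp [hab.symm]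
  have ku := key u hu0 (by rw [ua]; norm_num) (by rw [ub]; norm_num)
  set m := |crd M1 w a| + |crd M1 w b| + 1 with hm
  have hm0 : 0 < m := by positivity
  have a1 := abs_nonneg (crd M1 w a)
  have a2 := abs_nonneg (crd M1 w b)
  have a3 := le_abs_self (crd M1 w a)
  have a4 := neg_abs_le (crd M1 w b)
  have kk := key (m • u + w) (by simp [hu0, hw0]) (by
      rw [crd_add, crd_smul]; simp [ua]; linarith) (by
      rw [crd_add, crd_smul]; simp [ub]; linarith)
  rw [crd_add, crd_smul] at kk
  simp [ku, hw] at kk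


/-- A covering family of lattice tetrahedra with vertices in `V`. -/
def CovFam (Q V : Set (Fin 3 → ℝ)) (T : Multiset (Matrix (Fin 4) (Fin 4) ℝ)) : Prop :=
  (∀ M ∈ T, M.det ≠ 0 ∧ ∀ i, ∃ q ∈ V, IsLatticePt 3 q ∧ M i = hom q) ∧
  (∀ x ∈ Q, ∃ M ∈ T, ∀ i, 0 ≤ crd M (hom x) i)

open Filter Topology in
lemma local_dir {Q V : Set (Fin 3 → ℝ)} {T : Multiset (Matrix (Fin 4) (Fin 4) ℝ)}
    (h : CovFam Q V T) {p : Fin 3 → ℝ} (hp : p ∈ interior Q) (u : Fin 4 → ℝ) (hu : u 0 = 0) :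
    ∃ M ∈ T, (∀ i, 0 ≤ crd M (hom p) i) ∧ ∀ i, crd M (hom p) i = 0 → 0 ≤ crd M u i := by
  classical
  by_contra hcon
  push Not at hcon
  have hhom : ∀ δ : ℝ, hom (p + δ • Matrix.vecTail u) = hom p + δ • u := by
    intro δ
    ext i
    refine Fin.cases ?_ (fun j => ?_) i
    · simp [hom, hu]
    · simp [hom, Matrix.vecTail]
  have ev : ∀ M ∈ T.toFinset, ∀ᶠ δ in 𝓝[>] (0 : ℝ), ¬ ∀ i, 0 ≤ crd M (hom p + δ • u) i := by
    intro M hM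
    rw [Multiset.mem_toFinset] at hM
    by_cases hc : ∀ i, 0 ≤ crd M (hom p) i
    · obtain ⟨i, hi0, hi⟩ := hcon M hM hc
      filter_upwards [self_mem_nhdsWithin] with δ hδ hall
      have := hall i
      rw [crd_add, crd_smul] at this
      simp only [Pi.add_apply, Pi.smul_apply, hi0, zero_add, smul_eq_mul] at this
      have hδ' : (0 : ℝ) < δ := hδ
      nlinarith
    · push Not at hc
      obtain ⟨i, hi⟩ := hc
      have hcont : Continuous fun δ : ℝ => crd M (hom p + δ • u) i := by
        have := crd_cont M
        fun_prop
      have : ∀ᶠ δ in 𝓝 (0 : ℝ), crd M (hom p + δ • u) i < 0 :=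
        hcont.continuousAt.eventually_lt continuousAt_const (by simpa using hi)
      filter_upwards [this.filter_mono nhdsWithin_le_nhds] with δ hδ hall
      exact absurd (hall i) (not_le.mpr hδ)
  rw [← Filter.eventually_all_finset] at ev
  have evQ : ∀ᶠ δ in 𝓝[>] (0 : ℝ), p + δ • Matrix.vecTail u ∈ Q := by
    have hcont : Continuous fun δ : ℝ => p + δ • Matrix.vecTail u := by fun_prop
    have : ∀ᶠ δ in 𝓝 (0 : ℝ), p + δ • Matrix.vecTail u ∈ Q :=
      hcont.continuousAt.eventually_mem (by simpa using mem_interior_iff_mem_nhds.mp hp)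
    exact this.filter_mono nhdsWithin_le_nhds
  obtain ⟨δ, h1, h2⟩ := (ev.and evQ).exists
  obtain ⟨M, hM, hMi⟩ := h.2 _ h2
  rw [hhom] at hMi
  exact h1 M (by simpa using hM) hMi

/-- subdivision of a tetrahedron -/
def subd (p : Fin 3 → ℝ) (M : Matrix (Fin 4) (Fin 4) ℝ) : Multiset (Matrix (Fin 4) (Fin 4) ℝ) :=
  open Classical in
  if ∀ i, 0 ≤ crd M (hom p) i then
    (Finset.univ.filter fun i => 0 < crd M (hom p) i).val.map fun i => M.updateRow i (hom p)
  else {M}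

lemma sum_crd {M : Matrix (Fin 4) (Fin 4) ℝ} (hM : M.det ≠ 0) (h1 : ∀ i, M i 0 = 1)
    (p : Fin 3 → ℝ) : ∑ i, crd M (hom p) i = 1 := by
  have := congrFun (crd_spec hM (hom p)) 0
  simpa [Finset.sum_apply, h1, hom] using this

lemma step {Q V : Set (Fin 3 → ℝ)} {T : Multiset (Matrix (Fin 4) (Fin 4) ℝ)}
    (h : CovFam Q V T) {p : Fin 3 → ℝ} (hp : p ∈ interior Q) (hpV : p ∉ V) (hpl : IsLatticePt 3 p) :
    ∃ T', CovFam Q (insert p V) T' ∧ (T'.map fun M => |M.det|).sum = (T.map fun M => |M.det|).sum ∧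
      T.card + 3 ≤ T'.card := by
  classical
  have hone : ∀ M ∈ T, ∀ i, M i 0 = 1 := by
    intro M hM i
    obtain ⟨q, -, -, hq⟩ := (h.1 M hM).2 i
    rw [hq]; rfl
  refine ⟨T.bind (subd p), ⟨?_, ?_⟩, ?_, ?_⟩
  · intro N hN
    obtain ⟨M, hM, hNM⟩ := Multiset.mem_bind.mp hN
    unfold subd at hNM
    split_ifs at hNM with hc
    · rw [Multiset.mem_map] at hNM
      obtain ⟨i, hi, rfl⟩ := hNM
      have hi' : 0 < crd M (hom p) i := by simpa using hi
      refine ⟨?_, fun j => ?_⟩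
      · rw [det_sub (h.1 M hM).1]
        exact mul_ne_zero hi'.ne' (h.1 M hM).1
      · by_cases hj : j = i
        · subst hj
          exact ⟨p, by simp, hpl, by simp⟩
        · obtain ⟨q, h1, h2, h3⟩ := (h.1 M hM).2 j
          exact ⟨q, by simp [h1], h2, by rw [← h3]; simp [hj]⟩
    · rw [Multiset.mem_singleton] at hNM
      subst hNM
      refine ⟨(h.1 N hM).1, fun j => ?_⟩
      obtain ⟨q, h1, h2, h3⟩ := (h.1 N hM).2 j
      exact ⟨q, by simp [h1], h2, h3⟩
  · intro x hx
    obtain ⟨M, hM, hMi⟩ := h.2 x hx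
    have hdet := (h.1 M hM).1
    by_cases hc : ∀ i, 0 ≤ crd M (hom p) i
    · have hpos : ∃ i, 0 < crd M (hom p) i := by
        by_contra hno
        push Not at hno
        have := sum_crd hdet (hone M hM) p
        have h2 : ∑ i, crd M (hom p) i ≤ 0 := Finset.sum_nonpos fun i _ => hno i
        linarith
      obtain ⟨i, hi, hj⟩ := cover_sub hdet (hom p) (hom x) hpos hMi hc
      refine ⟨M.updateRow i (hom p), Multiset.mem_bind.mpr ⟨M, hM, ?_⟩, hj⟩
      rw [subd, if_pos hc, Multiset.mem_map]
      exact ⟨i, by simpa using hi, rfl⟩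
    · refine ⟨M, Multiset.mem_bind.mpr ⟨M, hM, ?_⟩, hMi⟩
      rw [subd, if_neg hc]; simp
  · rw [Multiset.map_bind, Multiset.sum_bind]
    congr 1
    apply Multiset.map_congr rfl
    intro M hM
    by_cases hc : ∀ i, 0 ≤ crd M (hom p) i
    · rw [subd, if_pos hc, Multiset.map_map]
      have e1 : ∀ i, ((fun M : Matrix (Fin 4) (Fin 4) ℝ => |M.det|) ∘
          fun i => M.updateRow i (hom p)) i = crd M (hom p) i * |M.det| := by
        intro i
        simp only [Function.comp]
        rw [det_sub (h.1 M hM).1, abs_mul, abs_of_nonneg (hc i)]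
      rw [Multiset.map_congr rfl (fun i _ => e1 i)]
      change ∑ i ∈ Finset.univ.filter (fun i => 0 < crd M (hom p) i), _ = _
      rw [Finset.sum_filter_of_ne, ← Finset.sum_mul, sum_crd (h.1 M hM).1 (hone M hM), one_mul]
      intro i _ hne
      exact lt_of_le_of_ne (hc i) (fun h0 => hne (by rw [← h0]; ring))
    · rw [subd, if_neg hc]; simp
  · rw [Multiset.card_bind]
    have hg := gain_aux (T.filter fun M => ∀ i, 0 ≤ crd M (hom p) i)
      (fun M hM => (h.1 M (Multiset.mem_filter.mp hM).1).1) (fun M => crd M (hom p))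
      (fun M hM => (Multiset.mem_filter.mp hM).2)
      (fun M hM => hone M (Multiset.mem_filter.mp hM).1) ?_ ?_
    · have hsplit := Multiset.filter_add_not (fun M => ∀ i, 0 ≤ crd M (hom p) i) T
      conv_lhs => rw [← hsplit]
      conv_rhs => rw [← hsplit]
      rw [Multiset.map_add, Multiset.sum_add, Multiset.card_add]
      have e1 : (Multiset.map (Multiset.card ∘ subd p)
          (T.filter fun M => ∀ i, 0 ≤ crd M (hom p) i)) =
          (T.filter fun M => ∀ i, 0 ≤ crd M (hom p) i).map fun M =>
          (Finset.univ.filter fun i => 0 < crd M (hom p) i).card := by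
        apply Multiset.map_congr rfl
        intro M hM
        simp only [Function.comp]
        rw [subd, if_pos (Multiset.mem_filter.mp hM).2, Multiset.card_map]
        rfl
      have e2 : (Multiset.map (Multiset.card ∘ subd p)
          (T.filter fun M => ¬ ∀ i, 0 ≤ crd M (hom p) i)) =
          (T.filter fun M => ¬ ∀ i, 0 ≤ crd M (hom p) i).map fun M => 1 := by
        apply Multiset.map_congr rfl
        intro M hM
        simp only [Function.comp]
        rw [subd, if_neg (Multiset.mem_filter.mp hM).2, Multiset.card_singleton]
      rw [e1, e2]
      simp only [Multiset.map_const', Multiset.sum_replicate, smul_eq_mul, mul_one]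
      omega
    · intro M hM
      rw [Multiset.mem_filter] at hM
      obtain ⟨hM, hc⟩ := hM
      by_contra hlt
      push Not at hlt
      have hs := sum_crd (h.1 M hM).1 (hone M hM) p
      have hfs : ∑ i ∈ Finset.univ.filter (fun i => 0 < crd M (hom p) i), crd M (hom p) i = 1 := by
        rw [← hs, Finset.sum_filter_of_ne]
        intro i _ hne
        exact lt_of_le_of_ne (hc i) (Ne.symm hne)
      have hcard : (Finset.univ.filter (fun i => 0 < crd M (hom p) i)).card = 1 := by
        have : (Finset.univ.filter (fun i => 0 < crd M (hom p) i)).card ≠ 0 := by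
          intro h0
          rw [Finset.card_eq_zero] at h0
          rw [h0] at hfs
          simp at hfs
        omega
      obtain ⟨i, hi⟩ := Finset.card_eq_one.mp hcard
      rw [hi, Finset.sum_singleton] at hfs
      have hz : ∀ j, j ≠ i → crd M (hom p) j = 0 := by
        intro j hj
        by_contra hne
        have : j ∈ Finset.univ.filter (fun i => 0 < crd M (hom p) i) := by
          simpa using lt_of_le_of_ne (hc j) (Ne.symm hne)
        rw [hi] at this
        exact hj (by simpa using this)
      have hpi := crd_spec (h.1 M hM).1 (hom p)
      rw [Finset.sum_eq_single i (fun j _ hj => by rw [hz j hj, zero_smul]) (by simp), hfs,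
        one_smul] at hpi
      obtain ⟨q, hqV, -, hq⟩ := (h.1 M hM).2 i
      rw [hq] at hpi
      exact hpV (hom_inj hpi ▸ hqV)
    · intro u hu
      obtain ⟨M, hM, h1, h2⟩ := local_dir h hp u hu
      exact ⟨M, Multiset.mem_filter.mpr ⟨hM, h1⟩, h2⟩

lemma phase2 {Q : Set (Fin 3 → ℝ)} (I : Finset (Fin 3 → ℝ)) : ∀ {V : Set (Fin 3 → ℝ)}
    {T : Multiset (Matrix (Fin 4) (Fin 4) ℝ)}
    (_ : CovFam Q V T) (_ : ∀ p ∈ I, p ∈ interior Q ∧ p ∉ V ∧ IsLatticePt 3 p),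
    ((T.card + 3 * I.card : ℕ) : ℝ) ≤ (T.map fun M => |M.det|).sum := by
  classical
  induction I using Finset.induction_on with
  | empty =>
    intro V T h _
    have hM : ∀ M ∈ T, (1 : ℝ) ≤ |M.det| := by
      intro M hM
      obtain ⟨hd, hr⟩ := h.1 M hM
      have hint : ∀ i j, ∃ z : ℤ, M i j = z := by
        intro i j
        obtain ⟨q, -, hq, hi⟩ := hr i
        rw [hi]
        refine Fin.cases ⟨1, by simp [hom]⟩ (fun j => ?_) j
        obtain ⟨z, hz⟩ := hq j
        exact ⟨z, by simpa [hom] using hz⟩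
      choose N hN using hint
      have : M = (Matrix.of N).map (Int.castRingHom ℝ) := by
        ext i j; simp [hN]
      rw [this, ← RingHom.mapMatrix_apply, ← RingHom.map_det] at hd ⊢
      simp only [eq_intCast, ne_eq, Int.cast_eq_zero] at hd ⊢
      exact_mod_cast Int.one_le_abs hd
    have := Multiset.card_nsmul_le_sum (s := T.map fun M => |M.det|) (a := 1) (by
      intro x hx
      obtain ⟨M, h1, rfl⟩ := Multiset.mem_map.mp hx
      exact hM M h1)
    simpa using this
  | insert p I hpI ih =>
    intro V T h hI
    obtain ⟨h1, h2, h3⟩ := hI p (by simp)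
    obtain ⟨T', hT', hs, hc⟩ := step h h1 h2 h3
    have := ih hT' (fun q hq => by
      obtain ⟨g1, g2, g3⟩ := hI q (by simp [hq])
      refine ⟨g1, ?_, g3⟩
      rintro (rfl | h')
      · exact hpI hq
      · exact g2 h')
    rw [hs] at this
    refine le_trans ?_ this
    rw [Finset.card_insert_of_notMem hpI]
    exact_mod_cast (by omega)


lemma crd_row {n : ℕ} {M : Matrix (Fin n) (Fin n) ℝ} (hM : M.det ≠ 0) (j : Fin n) :
    crd M (M j) = Pi.single j 1 := by
  have h := crd_of_sum hM (Pi.single j 1)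
  rw [Finset.sum_eq_single j (fun i _ hi => by simp [hi]) (by simp)] at h
  simpa using h

lemma crd_dot {n : ℕ} (M : Matrix (Fin n) (Fin n) ℝ) (y : Fin n → ℝ) (i : Fin n) :
    (fun k => M⁻¹ k i) ⬝ᵥ y = crd M y i := by
  rw [dotProduct_comm]; rfl

/-- the matrix with rows `s (B i)` -/
def mat {n : ℕ} (s : Fin n → Fin 3 → ℝ) (B : Fin 3 → Fin n) : Matrix (Fin 3) (Fin 3) ℝ :=
  fun i => s (B i)

/-- general position with respect to the planes spanned by pairs -/
def GenPt {n : ℕ} (s : Fin n → Fin 3 → ℝ) (x : Fin 3 → ℝ) : Prop :=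
  ∀ i j, x ∉ Submodule.span ℝ {s i, s j}

/-- generic weights -/
def GenWt {n : ℕ} (s : Fin n → Fin 3 → ℝ) (w : Fin n → ℝ) : Prop :=
  ∀ l : Fin 3 → ℝ, LinearIndepOn ℝ s {j | l ⬝ᵥ s j = w j}

/-- facet triples of the lifted configuration -/
def Good {n : ℕ} (s : Fin n → Fin 3 → ℝ) (w : Fin n → ℝ) (B : Fin 3 → Fin n) : Prop :=
  StrictMono B ∧ (mat s B).det ≠ 0 ∧
    ∃ l : Fin 3 → ℝ, (∀ i, l ⬝ᵥ s (B i) = w (B i)) ∧ ∀ j, j ∉ range B → l ⬝ᵥ s j < w j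

lemma exists_max {n : ℕ} (s : Fin n → Fin 3 → ℝ) (w : Fin n → ℝ)
    (h0 : (0 : Fin 3 → ℝ) ∈ interior (convexHull ℝ (range s))) (hw : ∀ j, 0 < w j)
    (x : Fin 3 → ℝ) :
    ∃ l : Fin 3 → ℝ, (∀ j, l ⬝ᵥ s j ≤ w j) ∧
      ∀ l' : Fin 3 → ℝ, (∀ j, l' ⬝ᵥ s j ≤ w j) → l' ⬝ᵥ x ≤ l ⬝ᵥ x := by
  set D : Set (Fin 3 → ℝ) := {l | ∀ j, l ⬝ᵥ s j ≤ w j} with hD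
  have hcont : ∀ y : Fin 3 → ℝ, Continuous fun l : Fin 3 → ℝ => l ⬝ᵥ y := fun y => by
    unfold dotProduct; fun_prop
  have hclosed : IsClosed D := by
    have : D = ⋂ j, {l | l ⬝ᵥ s j ≤ w j} := by ext; simp [hD]
    rw [this]
    exact isClosed_iInter fun j => isClosed_le (hcont _) continuous_const
  obtain ⟨r, hr, hball⟩ := Metric.nhds_basis_closedBall.mem_iff.mp (mem_interior_iff_mem_nhds.mp h0)
  set W := ∑ j, w j with hW
  have hle : ∀ l ∈ D, ∀ y ∈ convexHull ℝ (range s), l ⬝ᵥ y ≤ W := by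
    intro l hl y hy
    have hsub : convexHull ℝ (range s) ⊆ {y | l ⬝ᵥ y ≤ W} := by
      apply convexHull_min
      · rintro _ ⟨j, rfl⟩
        exact (hl j).trans (Finset.single_le_sum (fun i _ => (hw i).le) (Finset.mem_univ j))
      · exact convex_halfSpace_le ⟨fun a b => dotProduct_add _ _ _,
          fun c a => by rw [dotProduct_smul]⟩ W
    exact hsub hy
  have hbdd : Bornology.IsBounded D := by
    rw [Metric.isBounded_iff_subset_closedBall 0]
    refine ⟨W / r, fun l hl => ?_⟩
    have hW0 : 0 ≤ W := Finset.sum_nonneg fun i _ => (hw i).le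
    rw [mem_closedBall_zero_iff, pi_norm_le_iff_of_nonneg (by positivity)]
    intro i
    rw [Real.norm_eq_abs, le_div_iff₀ hr]
    have hm : ∀ t : ℝ, |t| ≤ r → l i * t ≤ W := by
      intro t ht
      have := hle l hl (Pi.single i t) (hball (by
        rw [mem_closedBall_zero_iff, Pi.norm_single]; exact ht))
      simpa using this
    have h1 := hm r (by rw [abs_of_pos hr])
    have h2 := hm (-r) (by rw [abs_neg, abs_of_pos hr])
    rcases abs_cases (l i) with h | h <;> rw [h.1] <;> linarith
  have hcomp : IsCompact D := Metric.isCompact_of_isClosed_isBounded hclosed hbdd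
  obtain ⟨l, hl, hmax⟩ := hcomp.exists_isMaxOn ⟨0, fun j => by simpa using (hw j).le⟩
    (hcont x).continuousOn
  exact ⟨l, hl, fun l' hl' => hmax hl'⟩

open Filter Topology in
lemma improve {n : ℕ} {s : Fin n → Fin 3 → ℝ} {w : Fin n → ℝ} {x l : Fin 3 → ℝ}
    (hl : ∀ j, l ⬝ᵥ s j ≤ w j)
    (hmax : ∀ l' : Fin 3 → ℝ, (∀ j, l' ⬝ᵥ s j ≤ w j) → l' ⬝ᵥ x ≤ l ⬝ᵥ x)
    (u : Fin 3 → ℝ) (hu : ∀ j, l ⬝ᵥ s j = w j → u ⬝ᵥ s j ≤ 0) : u ⬝ᵥ x ≤ 0 := by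
  have ev : ∀ j, ∀ᶠ δ in 𝓝[>] (0 : ℝ), (l + δ • u) ⬝ᵥ s j ≤ w j := by
    intro j
    by_cases hj : l ⬝ᵥ s j = w j
    · filter_upwards [self_mem_nhdsWithin] with δ hδ
      have hδ' : (0 : ℝ) < δ := hδ
      rw [add_dotProduct, smul_dotProduct, smul_eq_mul]
      have := hu j hj
      nlinarith
    · have hlt := lt_of_le_of_ne (hl j) hj
      have hcont : Continuous fun δ : ℝ => (l + δ • u) ⬝ᵥ s j := by
        simp only [add_dotProduct, smul_dotProduct]; fun_prop
      have : ∀ᶠ δ in 𝓝 (0 : ℝ), (l + δ • u) ⬝ᵥ s j < w j :=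
        hcont.continuousAt.eventually_lt continuousAt_const (by simpa using hlt)
      exact (this.filter_mono nhdsWithin_le_nhds).mono fun δ h => h.le
  rw [← Filter.eventually_all] at ev
  obtain ⟨δ, h1, h2⟩ := (ev.and self_mem_nhdsWithin).exists
  have hδ' : (0 : ℝ) < δ := h2
  have := hmax _ h1
  rw [add_dotProduct, smul_dotProduct, smul_eq_mul] at this
  by_contra hcon
  push Not at hcon
  have := mul_pos hδ' hcon
  linarith

lemma exists_dot (f : (Fin 3 → ℝ) →ₗ[ℝ] ℝ) : ∃ u : Fin 3 → ℝ, ∀ y, u ⬝ᵥ y = f y := by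
  refine ⟨fun i => f (Pi.single i 1), fun y => ?_⟩
  rw [LinearMap.pi_apply_eq_sum_univ f y, dotProduct]
  refine Finset.sum_congr rfl fun i _ => ?_
  rw [smul_eq_mul, mul_comm]
  congr 2
  ext j
  simp [Pi.single_apply, eq_comm]

lemma cover_gen {n : ℕ} {s : Fin n → Fin 3 → ℝ} {w : Fin n → ℝ}
    (h0 : (0 : Fin 3 → ℝ) ∈ interior (convexHull ℝ (range s))) (hw : ∀ j, 0 < w j)
    (hgw : GenWt s w) {x : Fin 3 → ℝ} (hx : GenPt s x) :
    ∃ B, Good s w B ∧ ∀ i, 0 ≤ crd (mat s B) x i := by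
  classical
  obtain ⟨l, hl, hmax⟩ := exists_max s w h0 hw x
  set T : Finset (Fin n) := Finset.univ.filter fun j => l ⬝ᵥ s j = w j with hT
  have hTi : LinearIndepOn ℝ s (T : Set (Fin n)) := by
    have := hgw l
    simpa [hT] using this
  have hTle : T.card ≤ 3 := by
    have := LinearIndependent.fintype_card_le_finrank hTi
    simpa using this
  have hspan : x ∈ Submodule.span ℝ (s '' T) := by
    by_contra hcon
    obtain ⟨f, hf, hker⟩ := Submodule.exists_le_ker_of_notMem hcon
    obtain ⟨u, hu⟩ := exists_dot f
    have hz : ∀ j, l ⬝ᵥ s j = w j → f (s j) = 0 := fun j hj =>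
      hker (Submodule.subset_span ⟨j, by simp [hT, hj], rfl⟩)
    have h1 := improve hl hmax u (fun j hj => by rw [hu, hz j hj])
    have h2 := improve hl hmax (-u) (fun j hj => by rw [neg_dotProduct, hu, hz j hj]; simp)
    rw [neg_dotProduct] at h2
    rw [hu] at h1 h2
    exact hf (by linarith)
  have hn : Nonempty (Fin n) := by
    have h1 := interior_subset h0
    have : (range s).Nonempty := by
      rw [← convexHull_nonempty_iff (𝕜 := ℝ)]; exact ⟨0, h1⟩
    exact range_nonempty_iff_nonempty.mp this
  have hsub : ∀ i j, T ⊆ {i, j} → False := by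
    intro i j hij
    refine hx i j (Submodule.span_mono ?_ hspan)
    rintro _ ⟨k, hk, rfl⟩
    have := hij hk
    simp only [Finset.mem_insert, Finset.mem_singleton] at this
    rcases this with rfl | rfl <;> simp
  have hT3 : T.card = 3 := by
    obtain ⟨a⟩ := hn
    by_contra hne
    have : T.card = 0 ∨ T.card = 1 ∨ T.card = 2 := by omega
    rcases this with h | h | h
    · rw [Finset.card_eq_zero] at h
      exact hsub a a (by rw [h]; simp)
    · obtain ⟨i, hi⟩ := Finset.card_eq_one.mp h
      exact hsub i i (by rw [hi]; simp)
    · obtain ⟨i, j, -, hij⟩ := Finset.card_eq_two.mp h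
      exact hsub i j (by rw [hij])
  set B := T.orderEmbOfFin hT3 with hB
  have hrange : range B = (T : Set (Fin n)) := Finset.range_orderEmbOfFin T hT3
  have hmem : ∀ i, l ⬝ᵥ s (B i) = w (B i) := by
    intro i
    have : B i ∈ T := Finset.orderEmbOfFin_mem T hT3 i
    simpa [hT] using this
  have hdet : (mat s B).det ≠ 0 := by
    rw [← isUnit_iff_ne_zero, ← Matrix.isUnit_iff_isUnit_det,
      ← Matrix.linearIndependent_rows_iff_isUnit]
    exact LinearIndependent.comp hTi (fun i : Fin 3 => ⟨B i, Finset.orderEmbOfFin_mem T hT3 i⟩)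
      (fun i j hij => B.injective (by simpa using hij))
  have hout : ∀ j, j ∉ range B → l ⬝ᵥ s j < w j := by
    intro j hj
    refine lt_of_le_of_ne (hl j) fun h => hj ?_
    rw [hrange]; simp [hT, h]
  refine ⟨B, ⟨B.strictMono, hdet, l, hmem, hout⟩, fun i => ?_⟩
  have := improve hl hmax (-(fun k => (mat s B)⁻¹ k i)) (fun j hj => by
    have hjr : j ∈ range B := by rw [hrange]; simp [hT, hj]
    obtain ⟨m, rfl⟩ := hjr
    rw [neg_dotProduct, crd_dot]
    have : crd (mat s B) (s (B m)) = Pi.single m 1 := crd_row hdet m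
    rw [this]
    by_cases h : i = m <;> simp [h])
  rw [neg_dotProduct, crd_dot] at this
  linarith


lemma genPt_ae {n : ℕ} (s : Fin n → Fin 3 → ℝ) : ∀ᵐ x, GenPt s x := by
  unfold GenPt
  rw [ae_all_iff]; intro i
  rw [ae_all_iff]; intro j
  have hne : Submodule.span ℝ {s i, s j} ≠ ⊤ := by
    intro h
    have h1 := finrank_span_le_card (R := ℝ) ({s i, s j} : Set (Fin 3 → ℝ))
    rw [h, finrank_top, Module.finrank_fin_fun] at h1
    have h2 : ({s i, s j} : Set (Fin 3 → ℝ)).toFinset.card ≤ 2 := by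
      rw [Set.toFinset_card, ← Nat.card_eq_fintype_card, Nat.card_coe_set_eq]
      exact (Set.ncard_insert_le _ _).trans (by simp)
    omega
  have := Measure.addHaar_submodule (volume : Measure (Fin 3 → ℝ)) _ hne
  rw [ae_iff]
  simpa using this

lemma genWt_ae {n : ℕ} (s : Fin n → Fin 3 → ℝ) : ∀ᵐ w, GenWt s w := by
  classical
  have key : ∀ T : Finset (Fin n), ¬ LinearIndepOn ℝ s (T : Set (Fin n)) →
      ∀ᵐ w : Fin n → ℝ, ∀ l : Fin 3 → ℝ, ¬ ∀ j ∈ T, l ⬝ᵥ s j = w j := by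
    intro T hT
    rw [linearIndepOn_finset_iff] at hT
    push Not at hT
    obtain ⟨f, hf, i, hi, hfi⟩ := hT
    set L : (Fin n → ℝ) →ₗ[ℝ] ℝ := ∑ j ∈ T, f j • LinearMap.proj j with hL
    have hLa : ∀ w, L w = ∑ j ∈ T, f j * w j := by intro w; simp [hL]
    have hne : LinearMap.ker L ≠ ⊤ := by
      intro h
      have : Pi.single i 1 ∈ LinearMap.ker L := by rw [h]; trivial
      rw [LinearMap.mem_ker, hLa, Finset.sum_eq_single i (fun j _ hj => by simp [hj])
        (fun h => absurd hi h)] at this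
      simp at this
      exact hfi this
    have h0 := Measure.addHaar_submodule (volume : Measure (Fin n → ℝ)) _ hne
    have h1 : ∀ᵐ w : Fin n → ℝ, w ∉ LinearMap.ker L := by
      rw [ae_iff]; simp only [not_not]; exact h0
    filter_upwards [h1] with w hw l hl
    apply hw
    rw [LinearMap.mem_ker, hLa]
    have := congrArg (fun y => l ⬝ᵥ y) hf
    simp only [dotProduct_sum, dotProduct_smul, dotProduct_zero, smul_eq_mul] at this
    rw [← this]
    exact Finset.sum_congr rfl fun j hj => by rw [hl j hj]
  have all : ∀ᵐ w : Fin n → ℝ, ∀ T : Finset (Fin n), ¬ LinearIndepOn ℝ s (T : Set (Fin n)) →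
      ∀ l : Fin 3 → ℝ, ¬ ∀ j ∈ T, l ⬝ᵥ s j = w j := by
    rw [ae_all_iff]; intro T
    by_cases hT : LinearIndepOn ℝ s (T : Set (Fin n))
    · exact Filter.Eventually.of_forall fun w h => absurd hT h
    · filter_upwards [key T hT] with w hw _ using hw
  filter_upwards [all] with w hw l
  by_contra hcon
  refine hw (Finset.univ.filter fun j => l ⬝ᵥ s j = w j) (by simpa using hcon) l ?_
  intro j hj
  simpa using hj

open Filter Topology in
lemma exists_weights {n : ℕ} {s : Fin n → Fin 3 → ℝ} (hinj : Function.Injective s)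
    (hsupp : ∀ v, ∃ φ : Fin 3 → ℝ, φ ⬝ᵥ s v = 1 ∧ ∀ j, φ ⬝ᵥ s j ≤ 1) :
    ∃ w : Fin n → ℝ, (∀ j, 0 < w j) ∧ GenWt s w ∧
      (∀ v, ∃ l : Fin 3 → ℝ, l ⬝ᵥ s v = w v ∧ ∀ j, j ≠ v → l ⬝ᵥ s j < w j) ∧
      (∀ B, Good s w B → ∃ φ : Fin 3 → ℝ, (∀ i, φ ⬝ᵥ s (B i) = 1) ∧ ∀ j, φ ⬝ᵥ s j ≤ 1) := by
  classical
  -- facet condition near the constant weight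
  have hfac : ∀ᶠ w in 𝓝 (1 : Fin n → ℝ), ∀ B, Good s w B →
      ∃ φ : Fin 3 → ℝ, (∀ i, φ ⬝ᵥ s (B i) = 1) ∧ ∀ j, φ ⬝ᵥ s j ≤ 1 := by
    rw [Filter.eventually_all]; intro B
    by_cases hdet : (mat s B).det = 0
    · exact Filter.Eventually.of_forall fun w h => absurd hdet h.2.1
    have hu : IsUnit (mat s B).det := isUnit_iff_ne_zero.mpr hdet
    set L : (Fin n → ℝ) → Fin 3 → ℝ := fun w => (mat s B)⁻¹ *ᵥ (w ∘ B) with hL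
    have hLe : ∀ w i, L w ⬝ᵥ s (B i) = w (B i) := by
      intro w i
      have : mat s B *ᵥ L w = w ∘ B := by
        rw [hL]; simp only; rw [Matrix.mulVec_mulVec, Matrix.mul_nonsing_inv _ hu, one_mulVec]
      have := congrFun this i
      rw [dotProduct_comm]
      exact this
    by_cases hall : ∀ j, L 1 ⬝ᵥ s j ≤ 1
    · exact Filter.Eventually.of_forall fun w _ => ⟨L 1, fun i => hLe 1 i, hall⟩
    push Not at hall
    obtain ⟨j, hj⟩ := hall
    have hcont : Continuous fun w : Fin n → ℝ => L w ⬝ᵥ s j := by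
      simp only [hL, Matrix.mulVec, dotProduct, Function.comp]; fun_prop
    have hev : ∀ᶠ w in 𝓝 (1 : Fin n → ℝ), w j < L w ⬝ᵥ s j :=
      (continuous_apply j).continuousAt.eventually_lt hcont.continuousAt (by simpa using hj)
    filter_upwards [hev] with w hw hg
    exfalso
    obtain ⟨-, -, l, hl1, hl2⟩ := hg
    have hll : l = L w := by
      have : mat s B *ᵥ l = w ∘ B := by
        ext i
        rw [Function.comp, ← hl1 i, dotProduct_comm]; rfl
      rw [hL]; simp only
      rw [← this, Matrix.mulVec_mulVec, Matrix.nonsing_inv_mul _ hu, one_mulVec]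
    have : l ⬝ᵥ s j ≤ w j := by
      by_cases hjr : j ∈ range B
      · obtain ⟨i, rfl⟩ := hjr
        exact (hl1 i).le
      · exact (hl2 j hjr).le
    rw [hll] at this
    linarith
  -- strictly convex weight
  set w0 : ℝ → Fin n → ℝ := fun ε j => 1 + ε * (s j ⬝ᵥ s j) with hw0
  have hw0c : Continuous w0 := by
    rw [hw0]; fun_prop
  have hw00 : w0 0 = 1 := by ext j; simp [hw0]
  have hstr : ∀ v, ∀ᶠ ε in 𝓝[>] (0 : ℝ), ∃ l : Fin 3 → ℝ, l ⬝ᵥ s v = w0 ε v ∧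
      ∀ j, j ≠ v → l ⬝ᵥ s j < w0 ε j := by
    intro v
    obtain ⟨φ, hφ1, hφ⟩ := hsupp v
    set l : ℝ → Fin 3 → ℝ := fun ε => φ + ε • ((2 : ℝ) • s v - (s v ⬝ᵥ s v) • φ) with hl
    have hle : ∀ ε j, l ε ⬝ᵥ s j =
        φ ⬝ᵥ s j + ε * (2 * (s v ⬝ᵥ s j) - (s v ⬝ᵥ s v) * (φ ⬝ᵥ s j)) := by
      intro ε j
      simp [hl, add_dotProduct, sub_dotProduct, smul_dotProduct]
    have : ∀ j, ∀ᶠ ε in 𝓝[>] (0 : ℝ), j ≠ v → l ε ⬝ᵥ s j < w0 ε j := by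
      intro j
      by_cases hjv : j = v
      · exact Filter.Eventually.of_forall fun ε h => absurd hjv h
      by_cases h1 : φ ⬝ᵥ s j = 1
      · filter_upwards [self_mem_nhdsWithin] with ε hε _
        have hε' : (0 : ℝ) < ε := hε
        rw [hle, h1, hw0]
        have hpos : 0 < (s j - s v) ⬝ᵥ (s j - s v) := by
          have hne : s j - s v ≠ 0 := sub_ne_zero.mpr fun h => hjv (hinj h)
          refine lt_of_le_of_ne ?_ (Ne.symm (fun h => hne (dotProduct_self_eq_zero.mp h)))
          exact Finset.sum_nonneg fun i _ => mul_self_nonneg _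
        rw [sub_dotProduct, dotProduct_sub, dotProduct_sub, dotProduct_comm (s j) (s v)] at hpos
        dsimp only
        nlinarith [mul_pos hε' hpos]
      · have hlt := lt_of_le_of_ne (hφ j) h1
        have hc1 : Continuous fun ε : ℝ => l ε ⬝ᵥ s j := by
          simp only [hle]; fun_prop
        have hc2 : Continuous fun ε : ℝ => w0 ε j := by
          rw [hw0]; fun_prop
        have : ∀ᶠ ε in 𝓝 (0 : ℝ), l ε ⬝ᵥ s j < w0 ε j :=
          hc1.continuousAt.eventually_lt hc2.continuousAt (by
            rw [hle, hw00]; simpa using hlt)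
        filter_upwards [this.filter_mono nhdsWithin_le_nhds] with ε h _ using h
    rw [← Filter.eventually_all] at this
    filter_upwards [this] with ε hε
    refine ⟨l ε, ?_, hε⟩
    rw [hle, hφ1, hw0]; ring
  rw [← Filter.eventually_all] at hstr
  have hfac' : ∀ᶠ ε in 𝓝[>] (0 : ℝ), ∀ᶠ w in 𝓝 (w0 ε), ∀ B, Good s w B →
      ∃ φ : Fin 3 → ℝ, (∀ i, φ ⬝ᵥ s (B i) = 1) ∧ ∀ j, φ ⬝ᵥ s j ≤ 1 := by
    have := (hw0c.tendsto 0).eventually (by rw [hw00]; exact hfac.eventually_nhds)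
    exact this.filter_mono nhdsWithin_le_nhds
  obtain ⟨ε, ⟨h1, h2⟩, h3⟩ := ((hstr.and hfac').and self_mem_nhdsWithin).exists
  have hε : (0 : ℝ) < ε := h3
  have hw0pos : ∀ j, 0 < w0 ε j := by
    intro j
    have : 0 ≤ s j ⬝ᵥ s j := Finset.sum_nonneg fun i _ => mul_self_nonneg _
    rw [hw0]; positivity
  have hpos : ∀ᶠ w in 𝓝 (w0 ε), ∀ j, 0 < w j := by
    rw [Filter.eventually_all]; intro j
    exact continuousAt_const.eventually_lt (continuous_apply j).continuousAt (hw0pos j)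
  have hstr2 : ∀ᶠ w in 𝓝 (w0 ε), ∀ v, ∃ l : Fin 3 → ℝ, l ⬝ᵥ s v = w v ∧
      ∀ j, j ≠ v → l ⬝ᵥ s j < w j := by
    rw [Filter.eventually_all]; intro v
    obtain ⟨l, hl1, hl2⟩ := h1 v
    have : ∀ j, ∀ᶠ w in 𝓝 (w0 ε), j ≠ v → ((w v / w0 ε v) • l) ⬝ᵥ s j < w j := by
      intro j
      by_cases hjv : j = v
      · exact Filter.Eventually.of_forall fun ε h => absurd hjv h
      have hc : Continuous fun w : Fin n → ℝ => ((w v / w0 ε v) • l) ⬝ᵥ s j := by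
        simp only [smul_dotProduct]; fun_prop
      have : ∀ᶠ w in 𝓝 (w0 ε), ((w v / w0 ε v) • l) ⬝ᵥ s j < w j :=
        hc.continuousAt.eventually_lt (continuous_apply j).continuousAt (by
          rw [div_self (hw0pos v).ne', one_smul]; exact hl2 j hjv)
      filter_upwards [this] with w h _ using h
    rw [← Filter.eventually_all] at this
    filter_upwards [this] with w hw
    refine ⟨_, ?_, hw⟩
    rw [smul_dotProduct, hl1, smul_eq_mul, div_mul_cancel₀ _ (hw0pos v).ne']
  have hdense : Dense {w | GenWt s w} := Measure.dense_of_ae (genWt_ae s)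
  obtain ⟨w, hw, hgen⟩ := ((mem_closure_iff_frequently.mp (hdense (w0 ε))).and_eventually
    ((hpos.and hstr2).and h2)).exists
  exact ⟨w, hgen.1.1, hw, hgen.1.2, hgen.2⟩


lemma GenPt.neg {n : ℕ} {s : Fin n → Fin 3 → ℝ} {x : Fin 3 → ℝ} (hx : GenPt s x) :
    GenPt s (-x) := fun i j h => hx i j (by simpa using h)

lemma mat_spec {n : ℕ} {s : Fin n → Fin 3 → ℝ} {B : Fin 3 → Fin n} (hdet : (mat s B).det ≠ 0)
    (x : Fin 3 → ℝ) : ∑ i, crd (mat s B) x i • s (B i) = x := crd_spec hdet x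

lemma crd_ne_zero {n : ℕ} {s : Fin n → Fin 3 → ℝ} {B : Fin 3 → Fin n}
    (hdet : (mat s B).det ≠ 0) {x : Fin 3 → ℝ} (hx : GenPt s x) (i : Fin 3) :
    crd (mat s B) x i ≠ 0 := by
  intro h0
  have hab : ∀ i : Fin 3, ∃ a b : Fin 3, ∀ j, j = i ∨ j = a ∨ j = b := by decide
  obtain ⟨a, b, hab⟩ := hab i
  apply hx (B a) (B b)
  rw [← mat_spec hdet x]
  refine Submodule.sum_mem _ fun j _ => ?_
  rcases hab j with rfl | rfl | rfl
  · rw [h0, zero_smul]; exact Submodule.zero_mem _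
  · exact Submodule.smul_mem _ _ (Submodule.subset_span (by simp))
  · exact Submodule.smul_mem _ _ (Submodule.subset_span (by simp))

lemma dot_le {n : ℕ} {s : Fin n → Fin 3 → ℝ} {w : Fin n → ℝ} {B' : Fin 3 → Fin n}
    {l l' : Fin 3 → ℝ} (hl : ∀ j, l ⬝ᵥ s j ≤ w j) (hdet : (mat s B').det ≠ 0)
    (hl' : ∀ i, l' ⬝ᵥ s (B' i) = w (B' i)) {x : Fin 3 → ℝ}
    (hx : ∀ i, 0 ≤ crd (mat s B') x i) :
    l ⬝ᵥ x ≤ l' ⬝ᵥ x ∧ ((∃ i, 0 < crd (mat s B') x i ∧ l ⬝ᵥ s (B' i) < w (B' i)) →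
      l ⬝ᵥ x < l' ⬝ᵥ x) := by
  have e : ∀ m : Fin 3 → ℝ, m ⬝ᵥ x = ∑ i, crd (mat s B') x i * (m ⬝ᵥ s (B' i)) := by
    intro m
    conv_lhs => rw [← mat_spec hdet x]
    simp [dotProduct_sum, dotProduct_smul]
  rw [e l, e l']
  constructor
  · exact Finset.sum_le_sum fun i _ => mul_le_mul_of_nonneg_left (by rw [hl']; exact hl _) (hx i)
  · rintro ⟨i, hi, hlt⟩
    exact Finset.sum_lt_sum
      (fun i _ => mul_le_mul_of_nonneg_left (by rw [hl']; exact hl _) (hx i))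
      ⟨i, Finset.mem_univ i, mul_lt_mul_of_pos_left (by rw [hl']; exact hlt) hi⟩

lemma good_le {n : ℕ} {s : Fin n → Fin 3 → ℝ} {w : Fin n → ℝ} {B : Fin 3 → Fin n}
    {l : Fin 3 → ℝ} (h1 : ∀ i, l ⬝ᵥ s (B i) = w (B i))
    (h2 : ∀ j, j ∉ range B → l ⬝ᵥ s j < w j) (j : Fin n) : l ⬝ᵥ s j ≤ w j := by
  by_cases hjr : j ∈ range B
  · obtain ⟨i, rfl⟩ := hjr
    exact (h1 i).le
  · exact (h2 j hjr).le

lemma good_unique {n : ℕ} {s : Fin n → Fin 3 → ℝ} {w : Fin n → ℝ} {B B' : Fin 3 → Fin n}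
    (hB : Good s w B) (hB' : Good s w B') {x : Fin 3 → ℝ} (hx : GenPt s x)
    (h : ∀ i, 0 ≤ crd (mat s B) x i) (h' : ∀ i, 0 ≤ crd (mat s B') x i) : B = B' := by
  obtain ⟨hm, hd, l, l1, l2⟩ := hB
  obtain ⟨hm', hd', l', l1', l2'⟩ := hB'
  have a := dot_le (good_le l1 l2) hd' l1' h'
  have b := dot_le (good_le l1' l2') hd l1 h
  have s1 : range B' ⊆ range B := by
    rintro _ ⟨i, rfl⟩
    by_contra hn
    have := a.2 ⟨i, lt_of_le_of_ne (h' i) (crd_ne_zero hd' hx i).symm, l2 _ hn⟩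
    linarith [b.1]
  have s2 : range B ⊆ range B' := by
    rintro _ ⟨i, rfl⟩
    by_contra hn
    have := b.2 ⟨i, lt_of_le_of_ne (h i) (crd_ne_zero hd hx i).symm, l2' _ hn⟩
    linarith [a.1]
  exact (hm.range_inj hm').mp (Subset.antisymm s2 s1)

open Filter Topology in
lemma wedge_cover {n : ℕ} {s : Fin n → Fin 3 → ℝ} {w : Fin n → ℝ}
    (h0 : (0 : Fin 3 → ℝ) ∈ interior (convexHull ℝ (range s))) (hw : ∀ j, 0 < w j)
    (hgw : GenWt s w) (v : Fin n) (hv : s v ≠ 0)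
    (hstr : ∃ l : Fin 3 → ℝ, l ⬝ᵥ s v = w v ∧ ∀ j, j ≠ v → l ⬝ᵥ s j < w j)
    {x : Fin 3 → ℝ} (hx : GenPt s x) :
    ∃ B, Good s w B ∧ ∃ i, B i = v ∧ ∀ j, j ≠ i → 0 < crd (mat s B) x j := by
  classical
  obtain ⟨lv, hlv, hlv'⟩ := hstr
  have hlvle : ∀ j, lv ⬝ᵥ s j ≤ w j := by
    intro j
    by_cases hj : j = v
    · rw [hj, hlv]
    · exact (hlv' j hj).le
  have ev1 : ∀ᶠ δ in 𝓝[>] (0 : ℝ), GenPt s (s v + δ • x) := by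
    unfold GenPt
    rw [Filter.eventually_all]; intro i
    rw [Filter.eventually_all]; intro j
    by_cases hex : ∃ δ0 : ℝ, 0 < δ0 ∧ s v + δ0 • x ∈ Submodule.span ℝ {s i, s j}
    · obtain ⟨δ0, hδ0, hmem⟩ := hex
      filter_upwards [Ioo_mem_nhdsGT hδ0] with δ hδ hmem'
      have h1 := Submodule.sub_mem _ hmem hmem'
      have h2 : s v + δ0 • x - (s v + δ • x) = (δ0 - δ) • x := by rw [sub_smul]; abel
      rw [h2] at h1
      exact hx i j ((Submodule.smul_mem_iff _ (sub_ne_zero.mpr hδ.2.ne')).mp h1)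
    · push Not at hex
      filter_upwards [self_mem_nhdsWithin] with δ hδ
      exact hex δ hδ
  have ev2 : ∀ B, ∀ᶠ δ in 𝓝[>] (0 : ℝ), Good s w B → v ∉ range B →
      ¬ ∀ i, 0 ≤ crd (mat s B) (s v + δ • x) i := by
    intro B
    by_cases hB : Good s w B
    swap
    · exact Filter.Eventually.of_forall fun δ h => absurd h hB
    by_cases hvB : v ∈ range B
    · exact Filter.Eventually.of_forall fun δ _ h => absurd hvB h
    have hneg : ¬ ∀ i, 0 ≤ crd (mat s B) (s v) i := by
      intro hall
      obtain ⟨-, hd, l, l1, l2⟩ := hB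
      have a := dot_le hlvle hd l1 hall
      have hpos : ∃ i, 0 < crd (mat s B) (s v) i := by
        by_contra hno
        push Not at hno
        apply hv
        rw [← mat_spec hd (s v)]
        exact Finset.sum_eq_zero fun i _ => by rw [le_antisymm (hno i) (hall i), zero_smul]
      obtain ⟨i, hi⟩ := hpos
      have := a.2 ⟨i, hi, hlv' _ fun h => hvB ⟨i, h⟩⟩
      have := l2 v hvB
      linarith
    push Not at hneg
    obtain ⟨i, hi⟩ := hneg
    have hcont : Continuous fun δ : ℝ => crd (mat s B) (s v + δ • x) i := by
      have := crd_cont (mat s B)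
      fun_prop
    have : ∀ᶠ δ in 𝓝 (0 : ℝ), crd (mat s B) (s v + δ • x) i < 0 :=
      hcont.continuousAt.eventually_lt continuousAt_const (by simpa using hi)
    filter_upwards [this.filter_mono nhdsWithin_le_nhds] with δ hδ _ _ hall
    exact absurd (hall i) (not_le.mpr hδ)
  rw [← Filter.eventually_all] at ev2
  obtain ⟨δ, ⟨h1, h2⟩, h3⟩ := ((ev1.and ev2).and self_mem_nhdsWithin).exists
  have hδ : (0 : ℝ) < δ := h3
  obtain ⟨B, hB, hBc⟩ := cover_gen h0 hw hgw h1
  have hvB : v ∈ range B := by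
    by_contra hn
    exact h2 B hB hn hBc
  obtain ⟨i, rfl⟩ := hvB
  refine ⟨B, hB, i, rfl, fun j hj => ?_⟩
  have hc := hBc j
  have hrow : crd (mat s B) (s (B i)) = Pi.single i 1 := crd_row hB.2.1 i
  rw [crd_add, crd_smul, hrow] at hc
  simp only [Pi.add_apply, Pi.single_apply, if_neg hj, Pi.smul_apply, smul_eq_mul, zero_add] at hc
  exact lt_of_le_of_ne (nonneg_of_mul_nonneg_right hc hδ) (crd_ne_zero hB.2.1 hx j).symm

lemma sign_count (c : Fin 3 → ℝ) (hc : ∀ i, c i ≠ 0) :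
    open Classical in
    ∑ i, ((if ∀ j, j ≠ i → 0 < c j then 1 else 0) + (if ∀ j, j ≠ i → 0 < (-c) j then 1 else 0))
      ≤ 2 * ((if ∀ j, 0 ≤ c j then 1 else 0) + (if ∀ j, 0 ≤ (-c) j then 1 else 0)) + 1 := by
  have h0 := hc 0
  have h1 := hc 1
  have h2 := hc 2
  rw [Fin.sum_univ_three]
  simp only [Fin.forall_fin_succ, Fin.forall_fin_zero_pi, IsEmpty.forall_iff, Pi.neg_apply]
  rcases lt_or_gt_of_ne h0 with g0 | g0 <;> rcases lt_or_gt_of_ne h1 with g1 | g1 <;>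
    rcases lt_or_gt_of_ne h2 with g2 | g2 <;>
    simp [g0, g1, g2, g0.le, g1.le, g2.le, g0.not_gt, g1.not_gt, g2.not_gt, g0.not_ge, g1.not_ge,
      g2.not_ge]

lemma count {n : ℕ} {s : Fin n → Fin 3 → ℝ} {w : Fin n → ℝ}
    (h0 : (0 : Fin 3 → ℝ) ∈ interior (convexHull ℝ (range s))) (hw : ∀ j, 0 < w j)
    (hgw : GenWt s w) (hv : ∀ v, s v ≠ 0)
    (hstr : ∀ v, ∃ l : Fin 3 → ℝ, l ⬝ᵥ s v = w v ∧ ∀ j, j ≠ v → l ⬝ᵥ s j < w j)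
    (F : Finset (Fin 3 → Fin n)) (hF : ∀ B, B ∈ F ↔ Good s w B) :
    2 * n ≤ F.card + 4 := by
  classical
  obtain ⟨x, hx⟩ := (Measure.dense_of_ae (genPt_ae s)).nonempty
  have hx : GenPt s x := hx
  have hone : ∀ y, GenPt s y → ∑ B ∈ F, (if ∀ j, 0 ≤ crd (mat s B) y j then 1 else 0) ≤ 1 := by
    intro y hy
    rw [← Finset.card_filter, Finset.card_le_one]
    intro B hB B' hB'
    rw [Finset.mem_filter, hF] at hB hB'
    exact good_unique hB.1 hB'.1 hy hB.2 hB'.2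
  have hwedge : ∀ y, GenPt s y → n ≤ ∑ B ∈ F, ∑ i, (if ∀ j, j ≠ i → 0 < crd (mat s B) y j
      then 1 else 0) := by
    intro y hy
    rw [← Finset.sum_product', ← Finset.sum_fiberwise _ (fun q : (Fin 3 → Fin n) × Fin 3 => q.1 q.2)]
    have : n = ∑ _v : Fin n, 1 := by simp
    conv_lhs => rw [this]
    refine Finset.sum_le_sum fun v _ => ?_
    obtain ⟨B, hB, i, hi, hj⟩ := wedge_cover h0 hw hgw v (hv v) (hstr v) hy
    refine le_trans ?_ (Finset.single_le_sum (fun _ _ => Nat.zero_le _)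
      (show (B, i) ∈ _ from ?_))
    · rw [if_pos hj]
    · simp [hF, hB, hi]
  have hsum := Finset.sum_le_sum (s := F) fun B hB =>
    sign_count (crd (mat s B) x) (crd_ne_zero ((hF B).mp hB).2.1 hx)
  simp only [Finset.sum_add_distrib, ← Finset.mul_sum, ← crd_neg] at hsum
  have e1 := hwedge x hx
  have e2 := hwedge (-x) hx.neg
  have e3 := hone x hx
  have e4 := hone (-x) hx.neg
  have e5 : ∑ B ∈ F, 1 = F.card := by simp
  omega

lemma cover_all {n : ℕ} {s : Fin n → Fin 3 → ℝ} {w : Fin n → ℝ}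
    (h0 : (0 : Fin 3 → ℝ) ∈ interior (convexHull ℝ (range s))) (hw : ∀ j, 0 < w j)
    (hgw : GenWt s w) (x : Fin 3 → ℝ) :
    ∃ B, Good s w B ∧ ∀ i, 0 ≤ crd (mat s B) x i := by
  have hcl : IsClosed (⋃ B ∈ {B | Good s w B}, {x | ∀ i, 0 ≤ crd (mat s B) x i}) := by
    apply Set.Finite.isClosed_biUnion (Set.toFinite _)
    intro B _
    have : {x | ∀ i, 0 ≤ crd (mat s B) x i} = ⋂ i, {x | 0 ≤ crd (mat s B) x i} := by ext; simp
    rw [this]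
    refine isClosed_iInter fun i => isClosed_le continuous_const ?_
    exact (continuous_apply i).comp (crd_cont _)
  have hd := Measure.dense_of_ae (genPt_ae s)
  have hsub : {x | GenPt s x} ⊆ ⋃ B ∈ {B | Good s w B}, {x | ∀ i, 0 ≤ crd (mat s B) x i} := by
    intro y hy
    obtain ⟨B, hB, hc⟩ := cover_gen h0 hw hgw hy
    exact mem_biUnion hB hc
  have := closure_minimal hsub hcl (hd x)
  simpa using this


lemma vol_pre (N : Matrix (Fin 3) (Fin 3) ℝ) (hN : N.det ≠ 0) (S : Set (Fin 3 → ℝ)) :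
    volume ((fun x : Fin 3 → ℝ => x ᵥ* N) ⁻¹' S) = ENNReal.ofReal |N.det⁻¹| * volume S := by
  have h := Measure.addHaar_preimage_linearMap (volume : Measure (Fin 3 → ℝ))
    (f := Matrix.toLin' Nᵀ) (by rwa [LinearMap.det_toLin', Matrix.det_transpose]) S
  rw [LinearMap.det_toLin', Matrix.det_transpose] at h
  rw [← h]
  congr 1
  ext x
  simp [Matrix.toLin'_apply, Matrix.mulVec_transpose]

/-- standard solid simplex -/
def stdS : Set (Fin 3 → ℝ) := {c | (∀ i, 0 ≤ c i) ∧ ∑ i, c i ≤ 1}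

def ordM : Matrix (Fin 3) (Fin 3) ℝ := !![1, -1, 0; 0, 1, -1; 0, 0, 1]

lemma ordM_det : ordM.det = 1 := by
  simp [ordM, Matrix.det_fin_three]

lemma vol_stdS : 1 ≤ 6 * volume stdS := by
  have hc : (Set.Icc (0 : Fin 3 → ℝ) 1) ⊆
      ⋃ τ : Equiv.Perm (Fin 3), (fun x : Fin 3 → ℝ => x ᵥ* (ordM.submatrix τ id)) ⁻¹' stdS := by
    intro x hx
    rw [mem_iUnion]
    refine ⟨(Tuple.sort x).symm, ?_⟩
    have hm := Tuple.monotone_sort x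
    set σ := Tuple.sort x
    have h01 : x (σ 0) ≤ x (σ 1) := hm (by decide)
    have h12 : x (σ 1) ≤ x (σ 2) := hm (by decide)
    have h0 : 0 ≤ x (σ 0) := hx.1 _
    have h1 : x (σ 2) ≤ 1 := hx.2 _
    have e : x ᵥ* (ordM.submatrix σ.symm id) = ![x (σ 0), x (σ 1) - x (σ 0), x (σ 2) - x (σ 1)] := by
      ext j
      have : (x ᵥ* (ordM.submatrix σ.symm id)) j = ∑ i, x (σ i) * ordM i j := by
        rw [← Equiv.sum_comp σ.symm]
        simp [Matrix.vecMul, dotProduct]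
      rw [this]
      fin_cases j <;> simp [Fin.sum_univ_three, ordM] <;> ring
    simp only [mem_preimage, e]
    constructor
    · intro i; fin_cases i <;> simp <;> linarith
    · simp [Fin.sum_univ_three]; linarith
  have hv : volume (Set.Icc (0 : Fin 3 → ℝ) 1) = 1 := by
    rw [Real.volume_Icc_pi]; simp
  rw [← hv]
  refine (measure_mono hc).trans ((measure_iUnion_le _).trans ?_)
  have : ∀ τ : Equiv.Perm (Fin 3),
      volume ((fun x : Fin 3 → ℝ => x ᵥ* (ordM.submatrix τ id)) ⁻¹' stdS) = volume stdS := by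
    intro τ
    have hd : (ordM.submatrix τ id).det = (Equiv.Perm.sign τ : ℤ) := by
      rw [Matrix.det_permute, ordM_det, mul_one]
    have hu : ((Equiv.Perm.sign τ : ℤ) : ℝ) = 1 ∨ ((Equiv.Perm.sign τ : ℤ) : ℝ) = -1 := by
      rcases Int.units_eq_one_or (Equiv.Perm.sign τ) with h | h <;> simp [h]
    rw [vol_pre]
    · rw [hd]; rcases hu with h | h <;> simp [h]
    · rw [hd]; rcases hu with h | h <;> simp [h]
  simp only [this, tsum_fintype, Finset.sum_const, Finset.card_univ, Fintype.card_perm]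
  simp [Nat.factorial]

lemma stdS_closed : IsClosed stdS := by
  unfold stdS
  rw [setOf_and]
  refine IsClosed.inter ?_ (isClosed_le (by fun_prop) (by fun_prop))
  rw [setOf_forall]
  exact isClosed_iInter fun i => isClosed_le (by fun_prop) (by fun_prop)

lemma vol_sum {n : ℕ} {s : Fin n → Fin 3 → ℝ} {w : Fin n → ℝ}
    (h0 : (0 : Fin 3 → ℝ) ∈ convexHull ℝ (range s))
    (F : Finset (Fin 3 → Fin n)) (hF : ∀ B, B ∈ F ↔ Good s w B) :
    ∑ B ∈ F, |(mat s B).det| ≤ 6 * (volume (convexHull ℝ (range s))).toReal := by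
  set Q := convexHull ℝ (range s)
  have hfin : volume Q ≠ ⊤ :=
    (((finite_range s).isCompact_convexHull (𝕜 := ℝ)).measure_lt_top).ne
  let t : (Fin 3 → Fin n) → Set (Fin 3 → ℝ) := fun B => (fun x => crd (mat s B) x) ⁻¹' stdS
  have hdet : ∀ B ∈ F, (mat s B).det ≠ 0 := fun B hB => ((hF B).1 hB).2.1
  have hsub : (⋃ B ∈ F, t B) ⊆ Q := by
    intro x hx
    simp only [mem_iUnion] at hx
    obtain ⟨B, hB, hx⟩ := hx
    have hx1 : ∀ i, 0 ≤ crd (mat s B) x i := hx.1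
    have hx2 : ∑ i, crd (mat s B) x i ≤ 1 := hx.2
    have e := mat_spec (hdet B hB) x
    have hs : ∀ i, s (B i) ∈ Q := fun i => subset_convexHull ℝ _ ⟨B i, rfl⟩
    have := (convex_convexHull ℝ (range s)).sum_mem (t := Finset.univ)
      (w := Fin.cons (1 - ∑ i, crd (mat s B) x i) (crd (mat s B) x))
      (z := Fin.cons (0 : Fin 3 → ℝ) (fun i => s (B i))) (by
        intro i _; refine Fin.cases ?_ (fun i => ?_) i
        · simpa using hx2
        · simpa using hx1 i) (by rw [Fin.sum_univ_succ]; simp) (by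
        intro i _; refine Fin.cases ?_ (fun i => ?_) i
        · simpa using h0
        · simpa using hs i)
    rw [Fin.sum_univ_succ] at this
    simp only [Fin.cons_zero, Fin.cons_succ, smul_zero, zero_add] at this
    rwa [e] at this
  have hmeas : ∀ B ∈ F, NullMeasurableSet (t B) volume := fun B _ =>
    ((stdS_closed.preimage (crd_cont _)).measurableSet).nullMeasurableSet
  have hdisj : Set.Pairwise (↑F) (Function.onFun (AEDisjoint volume) t) := by
    intro B hB B' hB' hne
    have hae := genPt_ae s
    refine measure_mono_null ?_ hae
    intro x hx
    simp only [mem_compl_iff, mem_setOf_eq]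
    intro hg
    exact hne (good_unique ((hF B).1 hB) ((hF B').1 hB') hg hx.1.1 hx.2.1)
  have hvol : ∀ B ∈ F, volume (t B) = ENNReal.ofReal |(mat s B).det| * volume stdS := by
    intro B hB
    have := vol_pre (mat s B)⁻¹ (by
      rw [Matrix.det_nonsing_inv]; simpa using hdet B hB) stdS
    rw [Matrix.det_nonsing_inv, Ring.inverse_eq_inv', inv_inv] at this
    exact this
  have h1 : ∑ B ∈ F, ENNReal.ofReal |(mat s B).det| * volume stdS ≤ volume Q := by
    rw [← Finset.sum_congr rfl hvol, ← measure_biUnion_finset₀ hdisj hmeas]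
    exact measure_mono hsub
  have h2 : ENNReal.ofReal (∑ B ∈ F, |(mat s B).det|) ≤ 6 * volume Q := by
    rw [ENNReal.ofReal_sum_of_nonneg (fun _ _ => abs_nonneg _)]
    calc _ = (∑ B ∈ F, ENNReal.ofReal |(mat s B).det|) * 1 := (mul_one _).symm
      _ ≤ (∑ B ∈ F, ENNReal.ofReal |(mat s B).det|) * (6 * volume stdS) := by
        gcongr; exact vol_stdS
      _ = 6 * ∑ B ∈ F, ENNReal.ofReal |(mat s B).det| * volume stdS := by
        rw [← Finset.sum_mul]; ring
      _ ≤ _ := by gcongr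
  have h3 := ENNReal.toReal_mono (ENNReal.mul_ne_top (by simp) hfin) h2
  rw [ENNReal.toReal_ofReal (Finset.sum_nonneg fun _ _ => abs_nonneg _), ENNReal.toReal_mul] at h3
  simpa using h3

/-- tetrahedron with apex at the origin -/
def tet {n : ℕ} (s : Fin n → Fin 3 → ℝ) (B : Fin 3 → Fin n) : Matrix (Fin 4) (Fin 4) ℝ :=
  Fin.cons (hom 0) fun i => hom (s (B i))

lemma tet_det {n : ℕ} (s : Fin n → Fin 3 → ℝ) (B : Fin 3 → Fin n) :
    (tet s B).det = (mat s B).det := by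
  rw [Matrix.det_succ_row_zero, Fin.sum_univ_succ]
  have : ∀ j : Fin 3, tet s B 0 j.succ = 0 := by intro j; simp [tet, hom]
  have h0 : tet s B 0 0 = 1 := by simp [tet, hom]
  simp only [this, h0]
  simp only [mul_zero, zero_mul, Finset.sum_const_zero, add_zero, Fin.val_zero, pow_zero, one_mul]
  congr 1

lemma covFam {n : ℕ} {s : Fin n → Fin 3 → ℝ} {w : Fin n → ℝ}
    (h0 : (0 : Fin 3 → ℝ) ∈ interior (convexHull ℝ (range s))) (hw : ∀ j, 0 < w j)
    (hgw : GenWt s w) (hlat : ∀ v, IsLatticePt 3 (s v))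
    (hfac : ∀ B, Good s w B → ∃ φ : Fin 3 → ℝ, (∀ i, φ ⬝ᵥ s (B i) = 1) ∧ ∀ j, φ ⬝ᵥ s j ≤ 1)
    (F : Finset (Fin 3 → Fin n)) (hF : ∀ B, B ∈ F ↔ Good s w B) :
    CovFam (convexHull ℝ (range s)) (insert 0 (range s)) (F.val.map (tet s)) := by
  constructor
  · intro M hM
    obtain ⟨B, hB, rfl⟩ := Multiset.mem_map.1 hM
    have hB : Good s w B := (hF B).1 hB
    refine ⟨by rw [tet_det]; exact hB.2.1, fun i => ?_⟩
    refine Fin.cases ?_ (fun i => ?_) i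
    · exact ⟨0, by simp, fun i => ⟨0, by simp⟩, rfl⟩
    · exact ⟨s (B i), by simp, hlat _, rfl⟩
  · intro x hx
    obtain ⟨B, hB, hc⟩ := cover_all h0 hw hgw x
    obtain ⟨φ, p1, p2⟩ := hfac B hB
    refine ⟨tet s B, Multiset.mem_map.2 ⟨B, (hF B).2 hB, rfl⟩, ?_⟩
    have hφ : φ ⬝ᵥ x ≤ 1 := by
      have hconv : Convex ℝ {y : Fin 3 → ℝ | φ ⬝ᵥ y ≤ 1} :=
        convex_halfSpace_le (f := fun y => φ ⬝ᵥ y)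
          ⟨fun a b => dotProduct_add _ _ _, fun a b => dotProduct_smul _ _ _⟩ 1
      exact convexHull_min (by rintro _ ⟨j, rfl⟩; exact p2 j) hconv hx
    have e := mat_spec hB.2.1 x
    have hsum : ∑ i, crd (mat s B) x i ≤ 1 := by
      have : φ ⬝ᵥ x = ∑ i, crd (mat s B) x i := by
        conv_lhs => rw [← e]
        simp [dotProduct_sum, dotProduct_smul, p1]
      rwa [← this]
    have hx4 : hom x = ∑ i, (Fin.cons (1 - ∑ i, crd (mat s B) x i) (crd (mat s B) x) : Fin 4 → ℝ) i
        • tet s B i := by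
      rw [Fin.sum_univ_succ]
      ext j
      refine Fin.cases ?_ (fun j => ?_) j
      · simp [tet, hom]
      · have := congrFun e j
        simp only [Finset.sum_apply, Pi.smul_apply] at this
        simp [tet, hom, ← this]
    rw [hx4, crd_of_sum (by rw [tet_det]; exact hB.2.1)]
    intro i
    refine Fin.cases ?_ (fun i => ?_) i
    · simpa using hsum
    · simpa using hc i

lemma core_fin {n : ℕ} {s : Fin n → Fin 3 → ℝ} (hinj : Function.Injective s)
    (h0 : (0 : Fin 3 → ℝ) ∈ interior (convexHull ℝ (range s)))
    (hlat : ∀ v, IsLatticePt 3 (s v))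
    (hsupp : ∀ v, ∃ φ : Fin 3 → ℝ, φ ⬝ᵥ s v = 1 ∧ ∀ j, φ ⬝ᵥ s j ≤ 1)
    (I : Finset (Fin 3 → ℝ))
    (hI : ∀ p ∈ I, p ∈ interior (convexHull ℝ (range s)) ∧ p ∉ insert 0 (range s) ∧
      IsLatticePt 3 p) :
    2 * (n : ℝ) + 3 * I.card - 4 ≤ 6 * (volume (convexHull ℝ (range s))).toReal := by
  classical
  obtain ⟨w, hw, hgw, hstr, hfac⟩ := exists_weights hinj hsupp
  let F : Finset (Fin 3 → Fin n) := Finset.univ.filter fun B => Good s w B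
  have hF : ∀ B, B ∈ F ↔ Good s w B := fun B => by simp [F]
  have hv : ∀ v, s v ≠ 0 := by
    intro v h
    obtain ⟨φ, p, _⟩ := hsupp v
    rw [h] at p; simp at p
  have hcount := count h0 hw hgw hv hstr F hF
  have h2 := phase2 I (covFam h0 hw hgw hlat hfac F hF) hI
  have h3 := vol_sum (interior_subset h0) F hF
  rw [Multiset.map_map] at h2
  have e : (Multiset.map ((fun M => |M.det|) ∘ tet s) F.val).sum = ∑ B ∈ F, |(mat s B).det| := by
    simp only [Function.comp_def, tet_det]; rfl
  rw [e, Multiset.card_map] at h2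
  have h4 : (F.val.card : ℕ) = F.card := rfl
  rw [h4] at h2
  push_cast at h2
  have : (2 * n : ℝ) ≤ F.card + 4 := by exact_mod_cast hcount
  linarith


lemma supp_exists {Q : Set (Fin 3 → ℝ)} (hQ : Convex ℝ Q) (h0 : (0 : Fin 3 → ℝ) ∈ interior Q)
    {x : Fin 3 → ℝ} (hx : x ∉ interior Q) :
    ∃ φ : Fin 3 → ℝ, φ ⬝ᵥ x = 1 ∧ ∀ y ∈ Q, φ ⬝ᵥ y ≤ 1 := by
  obtain ⟨f, hf⟩ := geometric_hahn_banach_open_point hQ.interior isOpen_interior hx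
  obtain ⟨u, hu⟩ := exists_dot (f : (Fin 3 → ℝ) →ₗ[ℝ] ℝ)
  have hpos : 0 < f x := by simpa using hf 0 h0
  have hle : ∀ y ∈ Q, f y ≤ f x := by
    intro y hy
    have hy' : y ∈ closure (interior Q) := by
      rw [hQ.closure_interior_eq_closure_of_nonempty_interior ⟨0, h0⟩]
      exact subset_closure hy
    exact closure_minimal (fun z hz => (hf z hz).le)
      (isClosed_le f.continuous continuous_const) hy'
  refine ⟨(f x)⁻¹ • u, ?_, fun y hy => ?_⟩
  · rw [smul_dotProduct, hu]; simp [hpos.ne']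
  · rw [smul_dotProduct, hu]
    simp only [smul_eq_mul, ContinuousLinearMap.coe_coe]
    rw [inv_mul_le_iff₀ hpos, mul_one]; exact hle y hy

lemma extreme_notMem_interior {P : Set (Fin 3 → ℝ)} {x : Fin 3 → ℝ}
    (hx : x ∈ P.extremePoints ℝ) : x ∉ interior P := by
  intro hi
  obtain ⟨ε, he, hb⟩ := Metric.isOpen_iff.1 isOpen_interior x hi
  have hn : ‖(fun _ => ε / 2 : Fin 3 → ℝ)‖ < ε := by
    rw [pi_norm_const, Real.norm_of_nonneg (by positivity)]; linarith
  have h1 : x + (fun _ => ε / 2) ∈ P := interior_subset (hb (by simpa [mem_ball_iff_norm] using hn))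
  have h2 : x - (fun _ => ε / 2) ∈ P := interior_subset (hb (by simpa [mem_ball_iff_norm] using hn))
  have h3 := (mem_extremePoints.1 hx).2 _ h1 _ h2 (by
    refine ⟨1/2, 1/2, by norm_num, by norm_num, by norm_num, ?_⟩
    ext i; simp; ring)
  have := congrFun h3.1 0
  simp at this
  linarith

lemma lattice_finite {P : Set (Fin 3 → ℝ)} (hP : Bornology.IsBounded P) :
    (P ∩ {x | IsLatticePt 3 x}).Finite := by
  obtain ⟨R, hR⟩ := hP.exists_norm_le
  obtain ⟨N, hN⟩ := exists_nat_ge R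
  refine ((Set.finite_Icc (fun _ => -(N : ℤ) : Fin 3 → ℤ) (fun _ => (N : ℤ))).image
    (fun v : Fin 3 → ℤ => fun j : Fin 3 => (v j : ℝ))).subset ?_
  rintro x ⟨hx, hl⟩
  choose z hz using hl
  refine ⟨z, ?_, by ext i; exact (hz i).symm⟩
  have : ∀ i, |(z i : ℝ)| ≤ N := by
    intro i
    rw [← hz i]
    exact ((norm_le_pi_norm x i).trans (hR x hx)).trans hN
  constructor
  · intro i; have := (abs_le.1 (this i)).1; exact_mod_cast this
  · intro i; have := (abs_le.1 (this i)).2; exact_mod_cast this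

theorem picks_main (P : Set (Fin 3 → ℝ))
    (hP : ∃ F : Finset (Fin 3 → ℤ),
      P = convexHull ℝ ((fun v : Fin 3 → ℤ => fun j : Fin 3 => (v j : ℝ)) '' ↑F))
    (b k : ℕ)
    (hb : (frontier P ∩ {x | IsLatticePt 3 x}).ncard = b)
    (hk : (interior P ∩ {x | IsLatticePt 3 x}).ncard = k)
    (hk1 : 1 ≤ k) :
    (2 * (b : ℝ) + 3 * (k : ℝ) - 7) / 6 ≤ (volume P).toReal := by
  classical
  obtain ⟨F, hPF⟩ := hP
  have hcomp : IsCompact P := by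
    rw [hPF]; exact (F.finite_toSet.image _).isCompact_convexHull (𝕜 := ℝ)
  have hconv : Convex ℝ P := by rw [hPF]; exact convex_convexHull ℝ _
  have hfin := lattice_finite hcomp.isBounded
  have hfr : frontier P ⊆ P := hcomp.isClosed.frontier_subset
  have hSfin : (frontier P ∩ {x | IsLatticePt 3 x}).Finite :=
    hfin.subset (inter_subset_inter_left _ hfr)
  have hIfin : (interior P ∩ {x | IsLatticePt 3 x}).Finite :=
    hfin.subset (inter_subset_inter_left _ interior_subset)
  have hhull : convexHull ℝ (frontier P ∩ {x | IsLatticePt 3 x}) = P := by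
    apply subset_antisymm
    · exact convexHull_min (inter_subset_left.trans hfr) hconv
    · have h1 := closure_convexHull_extremePoints hcomp hconv
      conv_lhs => rw [← h1]
      refine closure_minimal (convexHull_mono ?_) (hSfin.isCompact_convexHull (𝕜 := ℝ)).isClosed
      intro x hx
      refine ⟨⟨subset_closure hx.1, extreme_notMem_interior hx⟩, ?_⟩
      have hx' := hx
      rw [hPF] at hx'
      obtain ⟨v, _, rfl⟩ := extremePoints_convexHull_subset hx'
      exact fun i => ⟨v i, rfl⟩
  obtain ⟨o, ho, hol⟩ : (interior P ∩ {x | IsLatticePt 3 x}).Nonempty := by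
    rw [← Set.ncard_pos hIfin]; omega
  let τ := Homeomorph.addRight (-o)
  have hτ : ∀ x, τ x = x + -o := fun x => rfl
  have hτl : ∀ x, IsLatticePt 3 x → IsLatticePt 3 (τ x) := by
    intro x hx i
    obtain ⟨a, ha⟩ := hx i
    obtain ⟨c, hc⟩ := hol i
    exact ⟨a - c, by rw [hτ]; simp [ha, hc, sub_eq_add_neg]⟩
  have hcard : hSfin.toFinset.card = b := by rw [← hb, Set.ncard_eq_toFinset_card _ hSfin]
  let e := hSfin.toFinset.equivFinOfCardEq hcard
  let s : Fin b → Fin 3 → ℝ := fun i => τ (e.symm i : Fin 3 → ℝ)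
  have hmem : ∀ i, (e.symm i : Fin 3 → ℝ) ∈ frontier P ∩ {x | IsLatticePt 3 x} := fun i =>
    hSfin.mem_toFinset.1 (e.symm i).2
  have hrange : range s = τ '' (frontier P ∩ {x | IsLatticePt 3 x}) := by
    ext y; constructor
    · rintro ⟨i, rfl⟩; exact ⟨_, hmem i, rfl⟩
    · rintro ⟨x, hx, rfl⟩
      exact ⟨e ⟨x, hSfin.mem_toFinset.2 hx⟩, by simp [s]⟩
  have hQ : convexHull ℝ (range s) = τ '' P := by
    rw [hrange]
    conv_rhs => rw [← hhull]
    have : (τ : (Fin 3 → ℝ) → (Fin 3 → ℝ)) =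
        (AffineEquiv.vaddConst ℝ (-o) : (Fin 3 → ℝ) ≃ᵃ[ℝ] (Fin 3 → ℝ)).toAffineMap := by
      ext x; simp [hτ]
    rw [this, AffineMap.image_convexHull]
  have hQi : interior (convexHull ℝ (range s)) = τ '' interior P := by
    rw [hQ, ← τ.image_interior]
  have h0 : (0 : Fin 3 → ℝ) ∈ interior (convexHull ℝ (range s)) := by
    rw [hQi]; exact ⟨o, ho, by simp [hτ]⟩
  have hni : ∀ v, s v ∉ interior (convexHull ℝ (range s)) := by
    intro v hv
    rw [hQi] at hv
    obtain ⟨x, hx, hxe⟩ := hv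
    have := τ.injective hxe
    rw [this] at hx
    exact (hmem v).1.2 hx
  have hvol : volume (convexHull ℝ (range s)) = volume P := by
    rw [hQ]
    change volume ((fun x => x + -o) '' P) = _
    rw [image_add_right, measure_preimage_add_right]
  let I := (hIfin.toFinset.erase o).image τ
  have hIc : I.card + 1 = k := by
    rw [Finset.card_image_of_injective _ τ.injective, Finset.card_erase_add_one, ← hk,
      Set.ncard_eq_toFinset_card _ hIfin]
    exact hIfin.mem_toFinset.2 ⟨ho, hol⟩
  have := core_fin (s := s) (fun i j h => by
      have := τ.injective h
      exact e.symm.injective (Subtype.ext this)) h0 (fun v => hτl _ (hmem v).2)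
    (fun v => by
      obtain ⟨φ, h1, h2⟩ := supp_exists (convex_convexHull ℝ (range s)) h0 (hni v)
      exact ⟨φ, h1, fun j => h2 _ (subset_convexHull ℝ _ ⟨j, rfl⟩)⟩) I (by
      intro p hp
      obtain ⟨x, hx, rfl⟩ := Finset.mem_image.1 hp
      obtain ⟨hxo, hx⟩ := Finset.mem_erase.1 hx
      have hx := hIfin.mem_toFinset.1 hx
      have hin : τ x ∈ interior (convexHull ℝ (range s)) := by rw [hQi]; exact ⟨x, hx.1, rfl⟩
      refine ⟨hin, ?_, hτl _ hx.2⟩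
      rintro (h | ⟨v, hv⟩)
      · apply hxo
        apply τ.injective
        rw [h, hτ]; simp
      · exact hni v (hv ▸ hin))
  rw [hvol] at this
  have hk' : (k : ℝ) = I.card + 1 := by rw [← hIc]; push_cast; ring
  rw [hk']
  linarith


end PickAux

/-- A convex lattice polyhedron in `ℝ³` with `b` boundary lattice points
and `k ≥ 1` interior lattice points satisfies `Vol(P) ≥ (2b + 3k - 7)/6`. -/
theorem picks_inequality (P : Set (Fin 3 → ℝ))
    (hP : ∃ F : Finset (Fin 3 → ℤ),
      P = convexHull ℝ ((fun v : Fin 3 → ℤ => fun j : Fin 3 => (v j : ℝ)) '' ↑F))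
    (hne : (interior P).Nonempty)
    (b k : ℕ)
    (hb : (frontier P ∩ {x | IsLatticePt 3 x}).ncard = b)
    (hk : (interior P ∩ {x | IsLatticePt 3 x}).ncard = k)
    (hk1 : 1 ≤ k) :
    (2 * (b : ℝ) + 3 * (k : ℝ) - 7) / 6 ≤ (volume P).toReal := by
  exact picks_main P hP b k hb hk hk1
end
end
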